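/- Assume the sequence (b_h) is not constant. Then the real numbers q_{μ,r} (r ≥ 2, 1 ≤ μ ≤ d(r)−1), F_{ℓ,r} (ℓ ∈ ℤ, r ≥ 2), and L_{ℓ,r} (ℓ ∈ ℤ, r ≥ 2) form a family that is algebraically independent over ℚ. -/

import Mathlib

noncomputable section

/-- The Lucas numbers: `L 0 = 2`, `L 1 = 1`, `L (n+2) = L n + L (n+1)`. -/
def lucasNum : ℕ → ℕ
  | 0 => 2
  | 1 => 1
  | n + 2 => lucasNum n + lucasNum (n + 1)

/-- `d` is an integer `≥ 2` which is not a perfect power. -/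
def NotPerfectPower (d : ℕ) : Prop := 2 ≤ d ∧ ∀ a n : ℕ, 2 ≤ n → d ≠ a ^ n

/-- The golden ratio `(1+√5)/2`, as a complex number. -/
def goldenRatioC : ℂ := (1 + Real.sqrt 5) / 2

/-- Index set for the numbers `q_{μ,r}`: pairs `(μ, r)` with `r ≥ 2` and
`1 ≤ μ ≤ d(r) - 1`, where `r = d(r)^j` with `d(r)` not a perfect power. -/
def QIdx : Type :=
  {p : ℕ × ℕ // ∃ d j : ℕ, NotPerfectPower d ∧ 1 ≤ j ∧ p.2 = d ^ j ∧ 1 ≤ p.1 ∧ p.1 ≤ d - 1}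

/-- Index set for the numbers `F_{ℓ,r}` and `L_{ℓ,r}`: pairs `(ℓ, r)` with `ℓ ∈ ℤ`, `r ≥ 2`. -/
def FLIdx : Type := {p : ℤ × ℕ // 2 ≤ p.2}

section DifferenceField

open MvPolynomial

variable {I k : Type*} [Field k]

/-- The twisted translation of a polynomial ring: `τ` on coefficients, `X i ↦ X i - R i`. -/
def twistTranslate (τ : k →+* k) (R : I → k) : MvPolynomial I k →+* MvPolynomial I k :=
  eval₂Hom (C.comp τ) (fun i => X i - C (R i))

@[simp] lemma twistTranslate_C (τ : k →+* k) (R : I → k) (x : k) :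
    twistTranslate τ R (C x) = C (τ x) := by simp [twistTranslate]

@[simp] lemma twistTranslate_X (τ : k →+* k) (R : I → k) (i : I) :
    twistTranslate τ R (X i) = X i - C (R i) := by simp [twistTranslate]

lemma pderiv_twistTranslate (τ : k →+* k) (R : I → k) (i : I) (Q : MvPolynomial I k) :
    pderiv i (twistTranslate τ R Q) = twistTranslate τ R (pderiv i Q) := by
  classical
  induction Q using MvPolynomial.induction_on with
  | C a => simp
  | add p q hp hq => simp [hp, hq]
  | mul_X p j hp =>
    rw [map_mul, pderiv_mul, hp, pderiv_mul, map_add, map_mul, map_mul, twistTranslate_X,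
      map_sub, pderiv_C, pderiv_X, sub_zero]
    by_cases h : i = j
    · subst h; simp
    · simp [Pi.single_eq_of_ne' h]

lemma coeff_twistTranslate [Fintype I] (m : MonomialOrder I) (τ : k →+* k) (R : I → k)
    (Q : MvPolynomial I k) (t : I →₀ ℕ) (ht : m.toSyn (m.degree Q) ≤ m.toSyn t) :
    (twistTranslate τ R Q).coeff t = τ (Q.coeff t) := by
  classical
  have hmon : ∀ s : I →₀ ℕ, m.Monic (∏ i, (X i - C (R i)) ^ s i) ∧
      m.degree (∏ i, (X i - C (R i)) ^ s i) = s := by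
    intro s
    have h1 : ∀ i : I, m.Monic ((X i - C (R i)) ^ s i) := fun i =>
      MonomialOrder.Monic.pow (m.monic_X_sub_C i (R i))
    refine ⟨MonomialOrder.Monic.prod fun i _ => h1 i, ?_⟩
    rw [m.degree_prod fun i _ => (h1 i).ne_zero]
    have : ∀ i : I, m.degree ((X i - C (R i)) ^ s i) = Finsupp.single i (s i) := by
      intro i
      rw [m.degree_pow, m.degree_X_sub_C, Finsupp.smul_single, smul_eq_mul, mul_one]
    simp_rw [this]
    exact Finsupp.univ_sum_single s
  have h0 : ∀ s ∈ Q.support, s ≠ t → (∏ i, (X i - C (R i)) ^ s i).coeff t = 0 := by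
    intro s hs hst
    apply m.coeff_eq_zero_of_lt
    rw [(hmon s).2]
    refine lt_of_le_of_ne ((m.le_degree hs).trans ht) fun h => hst (m.toSyn.injective h)
  rw [twistTranslate, coe_eval₂Hom, eval₂_eq', coeff_sum]
  simp only [RingHom.comp_apply, coeff_C_mul]
  rw [Finset.sum_eq_single t]
  · have := (hmon t).1.coeff_degree
    rw [(hmon t).2] at this
    rw [this, mul_one]
  · intro s hs hst
    rw [h0 s hs hst, mul_zero]
  · intro h
    rw [notMem_support_iff.1 h]; simp

lemma totalDegree_pderiv_lt {Q : MvPolynomial I k} (hQ : Q.totalDegree ≠ 0) (i : I) :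
    (pderiv i Q).totalDegree < Q.totalDegree := by
  classical
  rw [totalDegree, Finset.sup_lt_iff (Nat.pos_of_ne_zero hQ)]
  intro s hs
  rw [mem_support_iff, coeff_pderiv] at hs
  have h1 : s + Finsupp.single i 1 ∈ Q.support := mem_support_iff.2 (left_ne_zero_of_mul hs)
  have h2 := le_totalDegree h1
  change (s + Finsupp.single i 1).degree ≤ _ at h2
  change s.degree < _
  rw [map_add, Finsupp.degree_single] at h2
  omega

lemma exists_eq_C_of_pderiv_eq_zero [CharZero k] {Q : MvPolynomial I k}
    (hQ : ∀ i, pderiv i Q = 0) : ∃ x, Q = C x := by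
  classical
  refine ⟨Q.coeff 0, ?_⟩
  ext s
  rw [coeff_C]
  split_ifs with h
  · rw [h]
  · obtain ⟨i, hi⟩ := Finsupp.ne_iff.1 (Ne.symm h)
    have h1 := congrArg (coeff (s - Finsupp.single i 1)) (hQ i)
    rw [coeff_pderiv, coeff_zero] at h1
    have h2 : s - Finsupp.single i 1 + Finsupp.single i 1 = s :=
      tsub_add_cancel_of_le (by
        rw [Finsupp.single_le_iff]; exact Nat.one_le_iff_ne_zero.2 hi)
    rw [h2] at h1
    rcases mul_eq_zero.1 h1 with h3 | h3
    · exact h3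
    · exact absurd h3 (by norm_cast)

/-- Solutions of first order inhomogeneous difference equations `f - σ f = R` over a difference
field which are algebraically dependent satisfy a nontrivial linear relation with constant
coefficients modulo the base field. -/
theorem exists_linear_relation_of_difference_relation {F L : Type*} [Field L] [Field F]
    [CharZero k] [Algebra k L] [Algebra F k] [Algebra F L] [IsScalarTower F k L] [Fintype I]
    (τ : k →+* k) (σ : L →+* L) (hστ : ∀ x, σ (algebraMap k L x) = algebraMap k L (τ x))
    (hfix : ∀ x : L, σ x = x → ∃ c : F, x = algebraMap F L c)
    (f : I → L) (R : I → k) (hR : ∀ i, f i - σ (f i) = algebraMap k L (R i))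
    (hdep : ¬ AlgebraicIndependent k f) :
    ∃ c : I → F, c ≠ 0 ∧ ∃ g : k, ∑ i, algebraMap F L (c i) * f i = algebraMap k L g := by
  classical
  let _ : LinearOrder I := LinearOrder.lift' (Fintype.equivFin I) (Fintype.equivFin I).injective
  let m : MonomialOrder I := MonomialOrder.lex
  set T := twistTranslate τ R with hT
  have hinjk : Function.Injective (algebraMap k L) := (algebraMap k L).injective
  have haeval : ∀ Q : MvPolynomial I k, aeval f (T Q) = σ (aeval f Q) := by
    intro Q
    induction Q using MvPolynomial.induction_on with
    | C a => simp [hT, hστ]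
    | add p q hp hq => simp [hp, hq]
    | mul_X p j hp =>
      rw [map_mul, map_mul, map_mul, map_mul, hp, aeval_X, hT, twistTranslate_X, map_sub, aeval_X,
        algHom_C, ← hR j, sub_sub_cancel]
  have hex : ∃ Q : MvPolynomial I k, Q ≠ 0 ∧ aeval f Q = 0 := by
    rw [algebraicIndependent_iff] at hdep
    push Not at hdep
    obtain ⟨p, h1, h2⟩ := hdep
    exact ⟨p, h2, h1⟩
  -- an invariant relation
  obtain ⟨Q, hQ0, hQf, hQT⟩ : ∃ Q : MvPolynomial I k, Q ≠ 0 ∧ aeval f Q = 0 ∧ T Q = Q := by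
    have hwf : WellFounded (fun P Q : MvPolynomial I k =>
        m.toSyn (m.degree P) < m.toSyn (m.degree Q)) :=
      InvImage.wf (fun P => m.toSyn (m.degree P)) wellFounded_lt
    obtain ⟨Q, ⟨hQ0, hQf⟩, hmin⟩ := hwf.has_min {Q | Q ≠ 0 ∧ aeval f Q = 0} hex
    have hlc : m.leadingCoeff Q ≠ 0 := m.leadingCoeff_ne_zero_iff.2 hQ0
    set P := C (m.leadingCoeff Q)⁻¹ * Q with hP
    have hPdeg : m.degree P = m.degree Q := by
      rw [hP, m.degree_mul (by simpa using hlc) hQ0, m.degree_C, zero_add]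
    have hP0 : P ≠ 0 := mul_ne_zero (by simpa using hlc) hQ0
    have hPf : aeval f P = 0 := by rw [hP, map_mul, hQf, mul_zero]
    have hPc : P.coeff (m.degree P) = 1 := by
      rw [hPdeg, hP, coeff_C_mul]
      exact inv_mul_cancel₀ hlc
    refine ⟨P, hP0, hPf, ?_⟩
    by_contra hne
    have hne' : T P - P ≠ 0 := sub_ne_zero.2 hne
    refine hmin (T P - P) ⟨hne', by rw [map_sub, haeval, hPf, map_zero, sub_zero]⟩ ?_
    rw [← hPdeg]
    by_contra hlt
    have hle := not_lt.1 hlt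
    have h1 : (T P - P).coeff (m.degree (T P - P)) ≠ 0 := m.coeff_degree_ne_zero_iff.2 hne'
    apply h1
    rw [coeff_sub, hT, coeff_twistTranslate m τ R P _ (by rw [← hT]; exact hle), ← hT]
    rcases hle.eq_or_lt with h | h
    · rw [← m.toSyn.injective h, hPc, map_one, sub_self]
    · rw [m.coeff_eq_zero_of_lt h, map_zero, sub_self]
  -- an invariant nonconstant polynomial of minimal degree
  have hnonconst : Q.totalDegree ≠ 0 := by
    intro h
    rw [totalDegree_eq_zero_iff_eq_C.1 h, algHom_C] at hQf
    rw [totalDegree_eq_zero_iff_eq_C.1 h, map_eq_zero_iff _ hinjk |>.1 hQf, C_0] at hQ0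
    exact hQ0 rfl
  obtain ⟨Q', ⟨hd, hQ'T⟩, hmin⟩ :=
    (InvImage.wf (fun P : MvPolynomial I k => P.totalDegree) wellFounded_lt).has_min
      {P | P.totalDegree ≠ 0 ∧ T P = P} ⟨Q, hnonconst, hQT⟩
  have hder : ∀ i, ∃ x : k, pderiv i Q' = C x ∧ τ x = x := by
    intro i
    have hinv : T (pderiv i Q') = pderiv i Q' := by
      rw [hT, ← pderiv_twistTranslate, ← hT, hQ'T]
    have h0 : (pderiv i Q').totalDegree = 0 := by
      by_contra h
      exact hmin _ ⟨h, hinv⟩ (totalDegree_pderiv_lt hd i)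
    refine ⟨_, totalDegree_eq_zero_iff_eq_C.1 h0, ?_⟩
    rw [totalDegree_eq_zero_iff_eq_C.1 h0, hT, twistTranslate_C] at hinv
    exact C_injective _ _ hinv
  choose x hx hτx using hder
  have hcx : ∀ i, ∃ c : F, x i = algebraMap F k c := by
    intro i
    obtain ⟨c, hc⟩ := hfix (algebraMap k L (x i)) (by rw [hστ, hτx])
    refine ⟨c, hinjk ?_⟩
    rw [hc, ← IsScalarTower.algebraMap_apply]
  choose c hc using hcx
  obtain ⟨g, hg⟩ : ∃ g, Q' - ∑ i, C (x i) * X i = C g := by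
    apply exists_eq_C_of_pderiv_eq_zero
    intro i
    rw [map_sub, map_sum, hx]
    simp_rw [pderiv_C_mul, pderiv_X]
    rw [Finset.sum_eq_single i]
    · simp
    · intro j _ hj
      simp [Pi.single_eq_of_ne hj]
    · simp
  have hQ'eq : Q' = ∑ i, C (x i) * X i + C g := by rw [← hg]; ring
  refine ⟨c, ?_, ?_⟩
  · rintro rfl
    apply hd
    have : Q' = C g := by
      rw [hQ'eq]
      simp [hc]
    rw [this, totalDegree_C]
  · obtain ⟨e, he⟩ := hfix (aeval f Q') (by rw [← haeval, hQ'T])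
    refine ⟨algebraMap F k e - g, ?_⟩
    rw [map_sub, ← IsScalarTower.algebraMap_apply, ← he, hQ'eq, map_add, map_sum, algHom_C]
    simp [hc, ← IsScalarTower.algebraMap_apply]

end DifferenceField

section RationalSeries

open PowerSeries HahnSeries

/-- Multiplication by a positive natural number as an order embedding of `ℤ`. -/
def mulIntHom (q : ℕ) : ℤ →+ ℤ := AddMonoidHom.mulLeft (q : ℤ)

lemma mulIntHom_apply (q : ℕ) (n : ℤ) : mulIntHom q n = q * n := rfl

lemma algebraMap_laurentSeries (c : ℂ) :
    algebraMap ℂ (LaurentSeries ℂ) c = HahnSeries.C c := by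
  rw [HahnSeries.algebraMap_apply', PowerSeries.algebraMap_apply, Algebra.algebraMap_self_apply,
    HahnSeries.ofPowerSeries_C]

lemma mulIntHom_injective {q : ℕ} (hq : 0 < q) : Function.Injective (mulIntHom q) := by
  intro a b h
  rw [mulIntHom_apply, mulIntHom_apply] at h
  exact mul_left_cancel₀ (by exact_mod_cast hq.ne') h

lemma mulIntHom_le_iff {q : ℕ} (hq : 0 < q) (a b : ℤ) :
    mulIntHom q a ≤ mulIntHom q b ↔ a ≤ b := by
  rw [mulIntHom_apply, mulIntHom_apply]
  exact mul_le_mul_iff_right₀ (by exact_mod_cast hq)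

/-- The substitution `X ↦ X ^ q` on Laurent series. -/
def expandLaurent (q : ℕ) (hq : 0 < q) : LaurentSeries ℂ →ₐ[ℂ] LaurentSeries ℂ where
  toRingHom := HahnSeries.embDomainRingHom (mulIntHom q) (mulIntHom_injective hq)
    (mulIntHom_le_iff hq)
  commutes' c := by
    rw [algebraMap_laurentSeries]
    exact HahnSeries.embDomainRingHom_C

lemma expandLaurent_coeff_mul (q : ℕ) (hq : 0 < q) (x : LaurentSeries ℂ) (n : ℤ) :
    (expandLaurent q hq x).coeff (q * n) = x.coeff n :=
  HahnSeries.embDomain_coeff (Γ := ℤ) (Γ' := ℤ) (a := n)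

lemma expandLaurent_coeff_of_not_dvd (q : ℕ) (hq : 0 < q) (x : LaurentSeries ℂ) (n : ℤ)
    (hn : ¬ (q : ℤ) ∣ n) : (expandLaurent q hq x).coeff n = 0 := by
  change (HahnSeries.embDomain _ x).coeff n = 0
  apply HahnSeries.embDomain_of_notMem_range
  rintro ⟨m, hm⟩
  exact hn ⟨m, hm.symm⟩

lemma exists_eq_algebraMap_of_expandLaurent_eq {q : ℕ} (hq : 2 ≤ q) {x : LaurentSeries ℂ}
    (hx : expandLaurent q (by omega) x = x) : ∃ c : ℂ, x = algebraMap ℂ (LaurentSeries ℂ) c := by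
  have key : ∀ N : ℕ, ∀ n : ℤ, n.natAbs ≤ N → n ≠ 0 → x.coeff n = 0 := by
    intro N
    induction N with
    | zero => intro n h1 h2; omega
    | succ N ih =>
      intro n h1 h2
      rw [← hx]
      by_cases hd : (q : ℤ) ∣ n
      · obtain ⟨m, rfl⟩ := hd
        rw [expandLaurent_coeff_mul]
        have hm : m ≠ 0 := right_ne_zero_of_mul h2
        apply ih m _ hm
        rw [Int.natAbs_mul, Int.natAbs_natCast] at h1
        have : 0 < m.natAbs := Int.natAbs_pos.2 hm
        nlinarith
      · exact expandLaurent_coeff_of_not_dvd _ _ _ _ hd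
  refine ⟨x.coeff 0, ?_⟩
  ext n
  rw [algebraMap_laurentSeries, HahnSeries.C_apply, HahnSeries.coeff_single]
  split_ifs with h
  · rw [h]
  · exact key _ n le_rfl h

/-- A power series over `ℂ` is rational. -/
def IsRationalSeries (f : ℂ⟦X⟧) : Prop :=
  ∃ P Q : Polynomial ℂ, P ≠ 0 ∧ (P : ℂ⟦X⟧) * f = Q

theorem algebraicIndependent_of_mahler {J : Type*} [Fintype J] {q : ℕ} (hq : 2 ≤ q)
    (f R : J → ℂ⟦X⟧)
    (hfR : ∀ i n, coeff n (f i) - (if q ∣ n then coeff (n / q) (f i) else 0) = coeff n (R i))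
    (hR : ∀ i, IsRationalSeries (R i))
    (hlin : ∀ c : J → ℂ, c ≠ 0 → ¬ IsRationalSeries (∑ i, c i • f i)) :
    AlgebraicIndependent ℂ (Sum.elim f (fun _ : Unit => (X : ℂ⟦X⟧))) := by
  classical
  let ι : ℂ⟦X⟧ →ₐ[ℂ] LaurentSeries ℂ :=
    { toRingHom := HahnSeries.ofPowerSeries ℤ ℂ, commutes' := fun _ => rfl }
  have hι : Function.Injective ι := HahnSeries.ofPowerSeries_injective
  have hιcoeff : ∀ (g : ℂ⟦X⟧) (n : ℕ), (ι g).coeff n = coeff n g := fun g n =>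
    HahnSeries.ofPowerSeries_apply_coeff g n
  have hιneg : ∀ (g : ℂ⟦X⟧) (n : ℤ), n < 0 → (ι g).coeff n = 0 := by
    intro g n hn
    change (HahnSeries.ofPowerSeries ℤ ℂ g).coeff n = 0
    rw [HahnSeries.ofPowerSeries_apply]
    apply HahnSeries.embDomain_of_notMem_range
    rintro ⟨m, hm⟩
    simp at hm
    omega
  have hq0 : 0 < q := by omega
  let σ := expandLaurent q hq0
  let S : Set (LaurentSeries ℂ) := Set.range (fun _ : Unit => ι X)
  let k := IntermediateField.adjoin ℂ S
  have hιX : ι X ∈ k := IntermediateField.subset_adjoin _ _ ⟨(), rfl⟩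
  have hιX0 : σ (ι X) = ι X ^ q := by
    change HahnSeries.embDomain _ (HahnSeries.ofPowerSeries ℤ ℂ X) =
      (HahnSeries.ofPowerSeries ℤ ℂ X) ^ q
    rw [HahnSeries.ofPowerSeries_X, HahnSeries.embDomain_single, HahnSeries.single_pow]
    have : mulIntHom q 1 = q := by rw [mulIntHom_apply, mul_one]
    simp [this]
  have hσk : k ≤ k.comap σ := by
    apply IntermediateField.adjoin_le_iff.2
    rintro _ ⟨_, rfl⟩
    change σ (ι X) ∈ k
    rw [hιX0]
    exact pow_mem hιX q
  have haev : ∀ P : Polynomial ℂ, Polynomial.aeval (ι X) P = ι P := by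
    intro P
    rw [Polynomial.aeval_algHom_apply]
    congr 1
    induction P using Polynomial.induction_on' with
    | add p q hp hq => simp [hp, hq]
    | monomial n a =>
      rw [Polynomial.coe_monomial, Polynomial.aeval_monomial, PowerSeries.monomial_eq_mk,
        PowerSeries.algebraMap_apply, PowerSeries.X_pow_eq]
      ext m
      simp [PowerSeries.coeff_monomial]
  have hpoly : ∀ P : Polynomial ℂ, ι P ∈ k := by
    intro P
    rw [← haev]
    exact IntermediateField.algebra_adjoin_le_adjoin ℂ S
      (Algebra.adjoin_mono (Set.singleton_subset_iff.2 (Set.mem_range_self ()))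
        (Polynomial.aeval_mem_adjoin_singleton ℂ (ι X)))
  have hrat : ∀ g : ℂ⟦X⟧, IsRationalSeries g → ι g ∈ k := by
    rintro g ⟨P, Q, hP, hPQ⟩
    have h0 : ι P ≠ 0 := by
      rw [Ne, map_eq_zero_iff _ hι]
      exact_mod_cast hP
    have : ι g = ι Q / ι P := by
      rw [eq_div_iff h0, ← hPQ, map_mul, mul_comm]
    rw [this]
    exact div_mem (hpoly Q) (hpoly P)
  have hrat' : ∀ g : ℂ⟦X⟧, ι g ∈ k → IsRationalSeries g := by
    intro g hg
    have hS : S = {ι X} := by simp [S]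
    have hg' : ι g ∈ IntermediateField.adjoin ℂ {ι X} := by rw [← hS]; exact hg
    obtain ⟨Q, P, hQP⟩ := (IntermediateField.mem_adjoin_simple_iff ℂ _).1 hg'
    rw [haev, haev] at hQP
    by_cases hP : P = 0
    · refine ⟨1, 0, one_ne_zero, ?_⟩
      rw [hP] at hQP
      simp only [Polynomial.coe_zero, map_zero, div_zero] at hQP
      rw [(map_eq_zero_iff _ hι).1 hQP]; simp
    · refine ⟨P, Q, hP, hι ?_⟩
      have h0 : ι P ≠ 0 := by
        rw [Ne, map_eq_zero_iff _ hι]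
        exact_mod_cast hP
      rw [map_mul, hQP, mul_div_cancel₀ _ h0]
  have hfσ : ∀ i, ι (f i) - σ (ι (f i)) = ι (R i) := by
    intro i
    ext n
    rw [HahnSeries.coeff_sub]
    by_cases hn : 0 ≤ n
    · lift n to ℕ using hn
      rw [hιcoeff, hιcoeff, ← hfR]
      congr 1
      split_ifs with hd
      · obtain ⟨m, rfl⟩ := hd
        rw [Nat.mul_div_cancel_left _ hq0, ← hιcoeff]
        push_cast
        exact expandLaurent_coeff_mul q hq0 _ m
      · exact expandLaurent_coeff_of_not_dvd q hq0 _ _ (by exact_mod_cast hd)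
    · rw [hιneg _ _ (not_le.1 hn), hιneg _ _ (not_le.1 hn), zero_sub, neg_eq_zero]
      by_cases hd : (q : ℤ) ∣ n
      · obtain ⟨m, rfl⟩ := hd
        refine (expandLaurent_coeff_mul q hq0 _ m).trans (hιneg _ _ ?_)
        by_contra hm
        exact hn (mul_nonneg (by positivity) (not_lt.1 hm))
      · exact expandLaurent_coeff_of_not_dvd q hq0 _ _ hd
  let τ : k →+* k := (σ : LaurentSeries ℂ →+* LaurentSeries ℂ).restrict k k hσk
  have hind : AlgebraicIndependent k (fun i => ι (f i)) := by
    by_contra hdep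
    obtain ⟨c, hc, g, hg⟩ := exists_linear_relation_of_difference_relation (F := ℂ) τ
      (σ : LaurentSeries ℂ →+* LaurentSeries ℂ) (fun x => rfl)
      (fun x hx => exists_eq_algebraMap_of_expandLaurent_eq hq hx) (fun i => ι (f i))
      (fun i => ⟨ι (R i), hrat _ (hR i)⟩) hfσ hdep
    refine hlin c hc (hrat' _ ?_)
    rw [map_sum]
    have hs : ∀ i, ι (c i • f i) = algebraMap ℂ (LaurentSeries ℂ) (c i) * ι (f i) := by
      intro i
      rw [Algebra.smul_def, map_mul, AlgHom.commutes]
    rw [Finset.sum_congr rfl fun i _ => hs i, hg]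
    exact g.2
  have hX : AlgebraicIndependent ℂ (fun _ : Unit => ι X) := by
    rw [algebraicIndependent_unique_type_iff, transcendental_iff]
    intro P hP
    rw [haev, map_eq_zero_iff _ hι] at hP
    exact_mod_cast hP
  have hL : AlgebraicIndependent ℂ (Sum.elim (fun i => ι (f i)) (fun _ : Unit => ι X)) :=
    hX.sumElim_of_tower (S := k) (by
      rintro _ ⟨_, rfl⟩
      exact ⟨⟨ι X, hιX⟩, rfl⟩) hind
  refine AlgebraicIndependent.of_comp ι ?_
  convert! hL using 1
  ext (_ | _) <;> rfl

end RationalSeries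

section LinearRecurrence

open Polynomial

/-- The shift operator on complex sequences. -/
def seqShift : Module.End ℂ (ℕ → ℂ) where
  toFun f n := f (n + 1)
  map_add' _ _ := rfl
  map_smul' _ _ := rfl

/-- The sequence vanishes from some point on. -/
def EventuallyZero (f : ℕ → ℂ) : Prop := ∀ᶠ n in Filter.atTop, f n = 0

/-- The sequence satisfies a linear recurrence with constant coefficients from some point on. -/
def IsRec (f : ℕ → ℂ) : Prop := ∃ B : ℂ[X], B ≠ 0 ∧ EventuallyZero (aeval seqShift B f)

lemma seqShift_pow_apply (k : ℕ) (f : ℕ → ℂ) (n : ℕ) : (seqShift ^ k) f n = f (n + k) := by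
  induction k generalizing f n with
  | zero => rfl
  | succ k ih => rw [pow_succ', Module.End.mul_apply]; change (seqShift ^ k) f (n + 1) = _
                 rw [ih]; congr 1; ring

lemma aeval_seqShift_apply (B : ℂ[X]) (f : ℕ → ℂ) (n : ℕ) :
    aeval seqShift B f n = B.sum fun i a => a * f (n + i) := by
  rw [aeval_endomorphism, Polynomial.sum, Polynomial.sum, Finset.sum_apply]
  simp [seqShift_pow_apply]

lemma aeval_seqShift_geom (B : ℂ[X]) (x : ℂ) (n : ℕ) :
    aeval seqShift B (fun t => x ^ t) n = B.eval x * x ^ n := by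
  rw [aeval_seqShift_apply, eval_eq_sum, Polynomial.sum, Polynomial.sum, Finset.sum_mul]
  refine Finset.sum_congr rfl fun i _ => ?_
  ring

lemma EventuallyZero.aeval {f : ℕ → ℂ} (hf : EventuallyZero f) (B : ℂ[X]) :
    EventuallyZero (aeval seqShift B f) := by
  obtain ⟨N, hN⟩ := Filter.eventually_atTop.1 hf
  refine Filter.eventually_atTop.2 ⟨N, fun n hn => ?_⟩
  rw [aeval_seqShift_apply, Polynomial.sum]
  exact Finset.sum_eq_zero fun i _ => by rw [hN _ (by omega), mul_zero]

lemma EventuallyZero.mul_aeval {f : ℕ → ℂ} {q : ℂ[X]} (hf : EventuallyZero (Polynomial.aeval seqShift q f))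
    (p : ℂ[X]) : EventuallyZero (Polynomial.aeval seqShift (p * q) f) := by
  rw [map_mul]
  exact hf.aeval p

lemma IsRec.of_isRationalSeries {f : ℕ → ℂ} (hf : IsRationalSeries (PowerSeries.mk f)) :
    IsRec f := by
  obtain ⟨P, Q, hP, hPQ⟩ := hf
  refine ⟨P.reflect P.natDegree, by simpa [reflect_eq_zero_iff] using hP, ?_⟩
  refine Filter.eventually_atTop.2 ⟨Q.natDegree + 1, fun n hn => ?_⟩
  rw [aeval_seqShift_apply, sum_over_range' (n := P.natDegree + 1) _ (by simp)
    (by have := natDegree_reflect_le (p := P) (N := P.natDegree); simp at this; omega)]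
  have h := congrArg (PowerSeries.coeff (n + P.natDegree)) hPQ
  rw [Polynomial.coeff_coe, coeff_eq_zero_of_natDegree_lt (by omega), PowerSeries.coeff_mul,
    Finset.Nat.sum_antidiagonal_eq_sum_range_succ_mk] at h
  rw [← h, ← Finset.sum_range_reflect]
  rw [← Finset.sum_subset (Finset.range_mono (show P.natDegree + 1 ≤ n + P.natDegree + 1 by omega))]
  · refine Finset.sum_congr rfl fun i hi => ?_
    have hi' : i ≤ P.natDegree := by simpa [Nat.lt_succ_iff] using hi
    rw [coeff_reflect, Polynomial.coeff_coe, PowerSeries.coeff_mk, revAt_le (by omega)]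
    congr 2 <;> omega
  · intro i _ hi
    rw [Polynomial.coeff_coe, coeff_eq_zero_of_natDegree_lt (by simpa using hi), zero_mul]

lemma IsRec.subsequence {f : ℕ → ℂ} {B : ℂ[X]} (hB : B ≠ 0)
    (hf : EventuallyZero (aeval seqShift B f)) {D : ℕ} (hD : 0 < D) (r : ℕ) :
    EventuallyZero (aeval seqShift (B.roots.map fun ρ => X - C (ρ ^ D)).prod
      (fun t => f (r + D * t))) := by
  set q : ℂ[X] := (B.roots.map fun ρ => X - C (ρ ^ D)).prod with hq
  have hdvd : B ∣ expand ℂ D q := by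
    have h1 : C B.leadingCoeff * (B.roots.map fun a => X - C a).prod = B :=
      (IsAlgClosed.splits B).eq_prod_roots.symm
    have hu : IsUnit (C B.leadingCoeff) :=
      isUnit_C.2 (isUnit_iff_ne_zero.2 (leadingCoeff_ne_zero.2 hB))
    rw [← h1, hu.mul_left_dvd, hq, map_multiset_prod, Multiset.map_map]
    apply Multiset.prod_dvd_prod_of_dvd
    intro ρ _
    simp only [Function.comp, map_sub, expand_X, expand_C, map_pow]
    exact sub_dvd_pow_sub_pow _ _ _
  obtain ⟨g, hg⟩ := hdvd
  have h2 : EventuallyZero (aeval seqShift (expand ℂ D q) f) := by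
    rw [hg, mul_comm]; exact hf.mul_aeval g
  obtain ⟨N, hN⟩ := Filter.eventually_atTop.1 h2
  refine Filter.eventually_atTop.2 ⟨N, fun t ht => ?_⟩
  have h3 := hN (r + D * t) (by nlinarith)
  rw [expand_aeval, aeval_endomorphism, Polynomial.sum, Finset.sum_apply] at h3
  rw [aeval_seqShift_apply, Polynomial.sum, ← h3]
  refine Finset.sum_congr rfl fun i _ => ?_
  rw [← pow_mul, Pi.smul_apply, seqShift_pow_apply, smul_eq_mul]
  congr 2; ring

lemma sum_mul_eval_eq_zero_of_eventuallyZero {ι : Type*} (s : Finset ι) (G Φ : ι → ℂ)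
    {g : ℕ → ℂ} {q : ℂ[X]} {t₀ : ℕ} (hg : ∀ t, t₀ ≤ t → g t = ∑ x ∈ s, G x * Φ x ^ t)
    (hq : EventuallyZero (aeval seqShift q g)) {z : ℂ} (hz : z ≠ 0) :
    (∑ x ∈ s with Φ x = z, G x) * q.eval z = 0 := by
  classical
  set g' : ℕ → ℂ := ∑ x ∈ s, G x • fun t => Φ x ^ t with hg'
  have h1 : EventuallyZero (g - g') := Filter.eventually_atTop.2 ⟨t₀, fun t ht => by
    simp [hg', hg t ht]⟩
  set p : ℂ[X] := ∏ y ∈ (s.image Φ).erase z, (X - C y) with hp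
  have h2 : EventuallyZero (aeval seqShift (p * q) g') := by
    have e : g' = g - (g - g') := by abel
    rw [e, map_sub]
    have ha := hq.mul_aeval p
    have hb := h1.aeval (p * q)
    filter_upwards [ha, hb] with t hat hbt
    rw [Pi.sub_apply, hat, hbt, sub_zero]
  obtain ⟨t, ht⟩ := h2.exists
  have h3 : aeval seqShift (p * q) g' t = ∑ x ∈ s, G x * ((p * q).eval (Φ x) * Φ x ^ t) := by
    rw [hg', map_sum, Finset.sum_apply]
    refine Finset.sum_congr rfl fun x _ => ?_
    rw [map_smul, Pi.smul_apply, aeval_seqShift_geom, smul_eq_mul]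
  rw [h3] at ht
  have h4 : ∑ x ∈ s, G x * ((p * q).eval (Φ x) * Φ x ^ t) =
      ∑ x ∈ s with Φ x = z, G x * ((p * q).eval z * z ^ t) := by
    rw [Finset.sum_filter]
    refine Finset.sum_congr rfl fun x hx => ?_
    split_ifs with h
    · rw [h]
    · have : p.eval (Φ x) = 0 := by
        rw [hp, eval_prod]
        exact Finset.prod_eq_zero (Finset.mem_erase.2 ⟨h, Finset.mem_image_of_mem _ hx⟩) (by simp)
      rw [eval_mul, this]; simp
  rw [h4, ← Finset.sum_mul] at ht
  have hpz : p.eval z ≠ 0 := by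
    rw [hp, eval_prod, Finset.prod_ne_zero_iff]
    intro y hy
    simpa [sub_eq_zero] using (Finset.ne_of_mem_erase hy).symm
  rw [eval_mul] at ht
  have h5 : (∑ x ∈ s with Φ x = z, G x) * eval z q * (eval z p * z ^ t) = 0 := by
    rw [← ht]; ring
  exact (mul_eq_zero.1 h5).resolve_right (mul_ne_zero hpz (pow_ne_zero _ hz))

lemma eventually_periodic_of_isRec {f : ℕ → ℂ} {B : ℂ[X]} (hB : B ≠ 0)
    (hf : EventuallyZero (aeval seqShift B f)) {T : ℕ} (hT : 0 < T)
    (h : ∀ x s, 1 ≤ x → 1 ≤ s → s ≤ B.natDegree → f (T * (x + 1) + s) = f (T * x + s)) :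
    ∃ N, ∀ n, N ≤ n → f (n + T) = f n := by
  obtain ⟨N, hN⟩ := Filter.eventually_atTop.1 hf
  refine ⟨T * (N + 1) + 1, ?_⟩
  intro n
  induction n using Nat.strong_induction_on with
  | _ n ih =>
  intro hn
  by_cases hs : n ≤ T * (N + 1) + B.natDegree
  · obtain ⟨s, rfl⟩ := Nat.exists_eq_add_of_le (show T * (N + 1) ≤ n by omega)
    have := h (N + 1) s (by omega) (by omega) (by omega)
    rw [← this]; congr 1; ring
  · obtain ⟨m, rfl⟩ := Nat.exists_eq_add_of_le' (show B.natDegree ≤ n by omega)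
    have hm : N ≤ m := by
      have : N + 1 ≤ T * (N + 1) := Nat.le_mul_of_pos_left _ hT
      omega
    have h1 := hN m hm
    have h2 := hN (m + T) (by omega)
    rw [aeval_seqShift_apply, sum_over_range _ (by simp), Finset.sum_range_succ] at h1 h2
    have h3 : ∑ i ∈ Finset.range B.natDegree, B.coeff i * f (m + T + i) =
        ∑ i ∈ Finset.range B.natDegree, B.coeff i * f (m + i) := by
      refine Finset.sum_congr rfl fun i hi => ?_
      rw [← ih (m + i) (by have := Finset.mem_range.1 hi; omega) (by omega)]
      congr 2; ring
    rw [h3] at h2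
    have h4 : B.coeff B.natDegree * f (m + T + B.natDegree) =
        B.coeff B.natDegree * f (m + B.natDegree) := by
      linear_combination h2 - h1
    have h5 := mul_left_cancel₀ (leadingCoeff_ne_zero.2 hB) h4
    rw [← h5]; congr 1; ring

end LinearRecurrence

section MahlerCoefficients

open Polynomial

lemma not_dvd_four_mul_add {d s t : ℕ} (hs : ¬ d ∣ s) : ¬ d ∣ 4 * d * t + s := by
  rwa [Nat.dvd_add_right ⟨4 * t, by ring⟩]

/-- Every odd residue class modulo `4` has a representative prime to `d` (in the weak sense). -/
lemma exists_residue {d m : ℕ} (hd : 2 ≤ d) (hm : m % 2 = 1) :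
    ∃ s, ¬ d ∣ s ∧ s % 4 = m % 4 := by
  have h4 : m % 4 = 1 ∨ m % 4 = 3 := by omega
  rcases h4 with h | h
  · exact ⟨1, by rw [Nat.dvd_one]; omega, by omega⟩
  · refine ⟨4 * d * 1 - 1, ?_, by omega⟩
    intro hdvd
    have h1 : d ∣ 4 * d * 1 := ⟨4, by ring⟩
    have := (Nat.dvd_sub_iff_right (show 4 * d * 1 - 1 ≤ 4 * d * 1 by omega) h1).2 hdvd
    rw [show 4 * d * 1 - (4 * d * 1 - 1) = 1 by omega, Nat.dvd_one] at this
    omega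

variable {d : ℕ} {S : Finset ℤ} {v : ℤ → ℕ → ℕ → ℂ} {A : ℕ → ℕ → ℂ} {lam : ℂ} {f : ℕ → ℂ}
  {T : ℕ}

lemma eventually_pow_ne (hd : 2 ≤ d) {x ρ : ℂ} (hx0 : x ≠ 0) (hx1 : ‖x‖ ≠ 1) :
    ∀ᶠ M in Filter.atTop, x ≠ ρ ^ (4 * d ^ (M + 1)) := by
  by_cases h : ∃ M, x = ρ ^ (4 * d ^ (M + 1))
  · obtain ⟨M, hM⟩ := h
    filter_upwards [Filter.eventually_gt_atTop M] with M' hM' h'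
    have e : ρ ^ (4 * d ^ (M' + 1)) = x ^ d ^ (M' - M) := by
      rw [hM, ← pow_mul, mul_assoc, ← pow_add]; congr 3; omega
    have h2 : 2 ≤ d ^ (M' - M) := by
      calc 2 ≤ d := hd
        _ = d ^ 1 := (pow_one d).symm
        _ ≤ _ := Nat.pow_le_pow_right (by omega) (by omega)
    have h3 : ‖x‖ = ‖x‖ ^ d ^ (M' - M) := by
      rw [← norm_pow, ← e, ← h']
    have h4 : ‖x‖ ^ (d ^ (M' - M) - 1) = 1 := by
      have : ‖x‖ ^ (d ^ (M' - M) - 1) * ‖x‖ = 1 * ‖x‖ := by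
        rw [← pow_succ, one_mul]
        conv_rhs => rw [h3]
        congr 1; omega
      exact mul_right_cancel₀ (norm_ne_zero_iff.2 hx0) this
    exact hx1 ((pow_eq_one_iff_of_nonneg (norm_nonneg x) (by omega)).1 h4)
  · push Not at h
    exact Filter.Eventually.of_forall h

/-- The coefficients at exponentials of nonzero frequency of a recurrent sequence vanish. -/
lemma coeff_eq_zero_of_isRec_of_ne_zero (hd : 2 ≤ d) (hT : 0 < T)
    (hv_mod : ∀ ℓ n m m', m % 4 = m' % 4 → v ℓ n m = v ℓ n m')
    (hv_even : ∀ ℓ n m, m % 2 = 0 → v ℓ n m = 0)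
    (hv_per : ∀ ℓ n m, v ℓ (n + T) m = v ℓ n m)
    (hlam0 : 0 < ‖lam‖) (hlam1 : ‖lam‖ < 1)
    (hf : ∀ M m, ¬ d ∣ m → f (m * d ^ M) =
      (∑ n ∈ Finset.range (M + 1), ∑ ℓ ∈ S,
        v ℓ n (m * d ^ (M - n)) * lam ^ (ℓ * (m * d ^ (M - n) : ℕ))) +
      if m < d then A m M else 0)
    (hrec : IsRec f) : ∀ ℓ ∈ S, ℓ ≠ 0 → ∀ n m, v ℓ n m = 0 := by
  classical
  by_contra hcon
  push Not at hcon
  obtain ⟨B, hB, hBf⟩ := hrec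
  have hlam : lam ≠ 0 := norm_pos_iff.1 hlam0
  obtain ⟨ℓ₀, ⟨hℓS, hℓ0, n₀, m₀, hv0⟩, hmin⟩ :=
    (InvImage.wf (fun ℓ : ℤ => ℓ.natAbs) wellFounded_lt).has_min
      {ℓ : ℤ | ℓ ∈ S ∧ ℓ ≠ 0 ∧ ∃ n m, v ℓ n m ≠ 0} hcon
  have hm₀ : m₀ % 2 = 1 := by
    by_contra h
    exact hv0 (hv_even _ _ _ (by omega))
  obtain ⟨s, hds, hs4⟩ := exists_residue hd hm₀
  have hs0 : s ≠ 0 := by rintro rfl; simp at hds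
  set z : ℂ := lam ^ ((4 * d : ℕ) * ℓ₀) with hz
  have hz0 : z ≠ 0 := zpow_ne_zero _ hlam
  have hzinj : ∀ a b : ℤ, lam ^ a = lam ^ b → a = b := by
    intro a b hab
    have := congrArg norm hab
    rw [norm_zpow, norm_zpow] at this
    exact zpow_right_injective₀ hlam0 hlam1.ne this
  have hz1 : ‖z‖ ≠ 1 := by
    rw [hz, norm_zpow]
    intro h
    have : ((4 * d : ℕ) : ℤ) * ℓ₀ = 0 :=
      zpow_right_injective₀ hlam0 hlam1.ne (h.trans (zpow_zero _).symm)
    rcases mul_eq_zero.1 this with h | h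
    · have : 4 * d = 0 := by exact_mod_cast h
      omega
    · exact hℓ0 h
  have hev : ∀ᶠ M in Filter.atTop, ∀ ρ ∈ B.roots.toFinset, z ≠ ρ ^ (4 * d ^ (M + 1)) :=
    (Filter.eventually_all_finset _).2 fun ρ _ => eventually_pow_ne hd hz0 hz1
  obtain ⟨M₁, hM₁⟩ := Filter.eventually_atTop.1 hev
  have hperj : ∀ j, v ℓ₀ (n₀ + T * j) m₀ ≠ 0 := by
    intro j
    induction j with
    | zero => simpa using hv0
    | succ j ih => rw [mul_add, mul_one, ← add_assoc, hv_per]; exact ih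
  set M := n₀ + T * M₁ with hM
  have hMM₁ : M₁ ≤ M := by nlinarith
  have hvM : v ℓ₀ M s ≠ 0 := by rw [hv_mod _ _ _ _ hs4]; exact hperj M₁
  have hsub := IsRec.subsequence hB hBf (D := 4 * d ^ (M + 1)) (by positivity) (s * d ^ M)
  have key := sum_mul_eval_eq_zero_of_eventuallyZero (Finset.range (M + 1) ×ˢ S)
    (fun x => v x.2 x.1 (s * d ^ (M - x.1)) * lam ^ (x.2 * (s * d ^ (M - x.1) : ℕ)))
    (fun x => lam ^ (x.2 * (4 * d * d ^ (M - x.1) : ℕ))) (t₀ := 1) ?_ hsub hz0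
  · rw [mul_eq_zero] at key
    rcases key with key | key
    · rw [Finset.sum_eq_single (M, ℓ₀)] at key
      · simp only [Nat.sub_self, pow_zero, mul_one] at key
        rcases mul_eq_zero.1 key with h | h
        · exact hvM h
        · exact zpow_ne_zero _ hlam h
      · rintro ⟨n, ℓ⟩ hx hne
        rw [Finset.mem_filter, Finset.mem_product, Finset.mem_range] at hx
        obtain ⟨⟨hnM, hℓ⟩, hΦ⟩ := hx
        simp only at hnM hℓ hΦ ⊢
        have he := hzinj _ _ hΦ
        have he' : ℓ * (d : ℤ) ^ (M - n) = ℓ₀ := by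
          have h4d : ((4 * d : ℕ) : ℤ) ≠ 0 := by
            have : 4 * d ≠ 0 := by omega
            exact_mod_cast this
          apply mul_left_cancel₀ h4d
          rw [← he]; push_cast; ring
        have hℓne : ℓ ≠ 0 := by rintro rfl; simp at he'; exact hℓ0 he'.symm
        by_cases hn : n = M
        · subst hn
          simp at he'
          exact absurd (by rw [he']) hne
        · have hbad : ¬ ∃ a b, v ℓ a b ≠ 0 := by
            intro hex
            refine hmin ℓ ⟨hℓ, hℓne, hex⟩ ?_
            change ℓ.natAbs < ℓ₀.natAbs
            rw [← he', Int.natAbs_mul, Int.natAbs_pow, Int.natAbs_natCast]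
            have h1 : 0 < ℓ.natAbs := Int.natAbs_pos.2 hℓne
            have h2 : 1 < d ^ (M - n) := Nat.one_lt_pow (by omega) (by omega)
            nlinarith
          push Not at hbad
          rw [hbad, zero_mul]
      · intro h
        exfalso
        apply h
        rw [Finset.mem_filter, Finset.mem_product]
        refine ⟨⟨by simp, hℓS⟩, ?_⟩
        simp only [Nat.sub_self, pow_zero, mul_one, hz]
        congr 1; ring
    · rw [eval_multiset_prod, Multiset.prod_eq_zero_iff, Multiset.map_map] at key
      obtain ⟨ρ, hρ, h⟩ := Multiset.mem_map.1 key
      simp only [Function.comp, eval_sub, eval_X, eval_C, sub_eq_zero] at h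
      exact hM₁ M hMM₁ ρ (Multiset.mem_toFinset.2 hρ) h
  · intro t ht
    have e : s * d ^ M + 4 * d ^ (M + 1) * t = (4 * d * t + s) * d ^ M := by ring
    rw [e, hf M _ (not_dvd_four_mul_add hds), if_neg (by nlinarith), add_zero,
      Finset.sum_product]
    refine Finset.sum_congr rfl fun n _ => Finset.sum_congr rfl fun ℓ _ => ?_
    have h1 : (4 * d * t + s) * d ^ (M - n) % 4 = s * d ^ (M - n) % 4 := by
      rw [add_mul, show 4 * d * t * d ^ (M - n) = 4 * (d * t * d ^ (M - n)) by ring,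
        Nat.mul_add_mod]
    have h2 : lam ^ (ℓ * ((4 * d * t + s) * d ^ (M - n) : ℕ)) =
        lam ^ (ℓ * (s * d ^ (M - n) : ℕ)) * (lam ^ (ℓ * (4 * d * d ^ (M - n) : ℕ))) ^ t := by
      rw [← zpow_natCast, ← zpow_mul, ← zpow_add₀ hlam]
      congr 1
      push_cast; ring
    dsimp only
    rw [hv_mod _ _ _ _ h1, h2, ← mul_assoc (v ℓ n _)]

end MahlerCoefficients

section MahlerCoefficientsZero

open Polynomial

variable {d : ℕ} {w A : ℕ → ℕ → ℂ} {f : ℕ → ℂ} {T : ℕ}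

/-- The coefficients at frequency zero of a recurrent sequence vanish, up to one constant which
may only be nonzero for `d = 2`. -/
lemma coeff_eq_const_of_isRec (hd : 2 ≤ d) (hT : 0 < T)
    (hw_mod : ∀ n m m', m % 4 = m' % 4 → w n m = w n m')
    (hw_even : ∀ n m, m % 2 = 0 → w n m = 0)
    (hw_per : ∀ n m, w (n + T) m = w n m)
    (hA_per : ∀ μ n, A μ (n + T) = A μ n)
    (hf : ∀ M m, ¬ d ∣ m → f (m * d ^ M) =
      (∑ n ∈ Finset.range (M + 1), w n (m * d ^ (M - n))) + if m < d then A m M else 0)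
    (hrec : IsRec f) :
    (∀ μ n, 1 ≤ μ → μ < d → A μ n = 0) ∧
      ∃ κ, (∀ n m, m % 2 = 1 → w n m = κ) ∧ (d ≠ 2 → κ = 0) := by
  obtain ⟨B, hB, hBf⟩ := hrec
  set G : ℕ → ℕ → ℂ := fun M m => ∑ n ∈ Finset.range (M + 1), w n (m * d ^ (M - n)) with hG
  have hG_mod : ∀ M m m', m % 4 = m' % 4 → G M m = G M m' := by
    intro M m m' h
    refine Finset.sum_congr rfl fun n _ => hw_mod _ _ _ ?_
    exact Nat.ModEq.mul_right (n := 4) _ h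
  have hfG : ∀ M m, ¬ d ∣ m → d ≤ m → f (m * d ^ M) = G M m := by
    intro M m h1 h2
    rw [hf M m h1, if_neg (by omega), add_zero]
  obtain ⟨K, hK⟩ : ∃ K, B.natDegree < d ^ K := ⟨B.natDegree, Nat.lt_pow_self (by omega)⟩
  have hT' : 0 < 4 * d ^ K := by positivity
  obtain ⟨N, hN⟩ := eventually_periodic_of_isRec hB hBf hT' (by
    intro x s hx hs hsΔ
    obtain ⟨e, m', hm', rfl⟩ := Nat.exists_eq_pow_mul_and_not_dvd (n := s) (by omega) d (by omega)
    have he : e < K := by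
      by_contra h
      have h1 : d ^ K ≤ d ^ e := Nat.pow_le_pow_right (by omega) (by omega)
      have h2 : 0 < m' := Nat.pos_of_ne_zero (by rintro rfl; simp at hm')
      nlinarith
    obtain ⟨t, rfl⟩ : ∃ t, K = e + t + 1 := ⟨K - e - 1, by omega⟩
    have key : ∀ x, 1 ≤ x → f (4 * d ^ (e + t + 1) * x + d ^ e * m') = G e m' := by
      intro x hx
      have e1 : 4 * d ^ (e + t + 1) * x + d ^ e * m' = (4 * d * (d ^ t * x) + m') * d ^ e := by ring
      have h3 : 1 ≤ d ^ t * x := Nat.mul_pos (by positivity) hx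
      rw [e1, hfG _ _ (not_dvd_four_mul_add hm') (by nlinarith)]
      exact hG_mod _ _ _ (by rw [mul_assoc, Nat.mul_add_mod])
    rw [key x hx, key (x + 1) (by omega)])
  have hNi : ∀ i n, N ≤ n → f (n + 4 * d ^ K * i) = f n := by
    intro i n hn
    induction i with
    | zero => simp
    | succ i ih => rw [mul_add, mul_one, ← add_assoc, hN _ (by omega), ih]
  have hperj : ∀ j n m, w (n + T * j) m = w n m := by
    intro j n m
    induction j with
    | zero => simp
    | succ j ih => rw [mul_add, mul_one, ← add_assoc, hw_per]; exact ih
  have hperA : ∀ j μ n, A μ (n + T * j) = A μ n := by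
    intro j n m
    induction j with
    | zero => simp
    | succ j ih => rw [mul_add, mul_one, ← add_assoc, hA_per]; exact ih
  have hpowle : ∀ M, M ≤ d ^ M := fun M => (Nat.lt_pow_self (by omega)).le
  refine ⟨?_, ?_⟩
  · intro μ n h1 h2
    have hdμ : ¬ d ∣ μ := fun h => by have := Nat.le_of_dvd (by omega) h; omega
    set M := n + T * N with hM
    have hMN : N ≤ M := by nlinarith
    have h3 := hNi (d ^ (M + 1)) (μ * d ^ M) (by have := hpowle M; nlinarith)
    have e1 : μ * d ^ M + 4 * d ^ K * d ^ (M + 1) = (4 * d * d ^ K + μ) * d ^ M := by ring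
    have hpos : 0 < d ^ K := by positivity
    rw [e1, hfG _ _ (not_dvd_four_mul_add hdμ) (by nlinarith), hf _ _ hdμ, if_pos h2,
      hG_mod M _ μ (by rw [mul_assoc, Nat.mul_add_mod])] at h3
    rw [← hperA N μ n, ← hM]
    exact left_eq_add.1 h3
  · rcases Nat.even_or_odd d with hev | hodd
    · have hG_eq : ∀ M m, G M m = w M m := by
        intro M m
        rw [hG]
        simp only
        rw [Finset.sum_range_succ, Finset.sum_eq_zero, zero_add, Nat.sub_self, pow_zero, mul_one]
        intro n hn
        apply hw_even
        rw [Finset.mem_range] at hn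
        exact Nat.even_iff.1 ((hev.pow_of_ne_zero (by omega)).mul_left m)
      have key : ∀ n m n' m', ¬ d ∣ m → ¬ d ∣ m' → w n m = w n' m' := by
        have aux : ∀ n m, ¬ d ∣ m → w n m = f (4 * d ^ K * (N + 1)) := by
          intro n m hm
          set M := n + T * (K + 2 + N) with hM
          have hMN : K + 2 + N ≤ M := by nlinarith
          rw [← hperj (K + 2 + N), ← hM, ← hw_mod M (4 * d * (N + 1) + m) m
            (by rw [mul_assoc, Nat.mul_add_mod]), ← hG_eq,
            ← hfG M _ (not_dvd_four_mul_add hm) (by nlinarith)]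
          obtain ⟨t, ht⟩ : ∃ t, M = K + 2 + t := ⟨M - K - 2, by omega⟩
          obtain ⟨u, hu⟩ := hev
          have h4 : d ^ 2 = 4 * u ^ 2 := by rw [hu]; ring
          have hu1 : 1 ≤ u := by omega
          have e1 : (4 * d * (N + 1) + m) * d ^ M =
              4 * d ^ K * (u ^ 2 * d ^ t * (4 * d * (N + 1) + m)) := by
            rw [ht, pow_add, pow_add, h4]; ring
          have hge : N + 1 ≤ u ^ 2 * d ^ t * (4 * d * (N + 1) + m) := by
            have : 1 ≤ u ^ 2 * d ^ t := Nat.mul_pos (by positivity) (by positivity)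
            have h9 : N + 1 ≤ 4 * d * (N + 1) + m := by nlinarith
            exact h9.trans (Nat.le_mul_of_pos_left _ this)
          obtain ⟨i, hi⟩ := Nat.exists_eq_add_of_le hge
          rw [e1, hi, mul_add, hNi]
          have : 1 ≤ d ^ K := Nat.one_le_pow _ _ (by omega)
          nlinarith
        intro n m n' m' h1 h2
        rw [aux n m h1, aux n' m' h2]
      have h1 : ¬ d ∣ 1 := by rw [Nat.dvd_one]; omega
      refine ⟨w 0 1, fun n m hm => ?_, fun hd2 => ?_⟩
      · obtain ⟨s, hs, hs4⟩ := exists_residue hd hm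
        rw [← hw_mod n s m hs4]
        exact key _ _ _ _ hs h1
      · have h2 : ¬ d ∣ 2 := fun h => by have := Nat.le_of_dvd (by omega) h; omega
        rw [key 0 1 0 2 h1 h2, hw_even _ _ rfl]
    · refine ⟨0, ?_, fun _ => rfl⟩
      have hd4 : ¬ d ∣ 4 := by
        intro h
        have hle := Nat.le_of_dvd (by omega) h
        interval_cases d
        · exact absurd hodd (by decide)
        · revert h; decide
        · exact absurd hodd (by decide)
      have hGK : ∀ M, K + 1 ≤ M → ∀ m, m % 2 = 1 → G M m = G K (d ^ (M - K) * m) := by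
        intro M hM m hm
        obtain ⟨t, rfl⟩ : ∃ t, M = K + t + 1 := ⟨M - K - 1, by omega⟩
        obtain ⟨s, hs, hs4⟩ := exists_residue hd hm
        have h5 : (4 * d * (N + 1) + s) % 4 = m % 4 := by rw [mul_assoc, Nat.mul_add_mod, hs4]
        have hpos : 1 ≤ d ^ (K + t + 1) := Nat.one_le_pow _ _ (by omega)
        have h9 : N ≤ 4 * d * (N + 1) + s := by nlinarith
        have h6 := hN ((4 * d * (N + 1) + s) * d ^ (K + t + 1))
          (h9.trans (Nat.le_mul_of_pos_right _ hpos))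
        rw [hfG _ _ (not_dvd_four_mul_add hs) (by nlinarith), hG_mod _ _ _ h5] at h6
        rw [← h6]
        have e1 : (4 * d * (N + 1) + s) * d ^ (K + t + 1) + 4 * d ^ K =
            (d * (d ^ t * (4 * d * (N + 1) + s)) + 4) * d ^ K := by ring
        rw [e1, hfG]
        · apply hG_mod
          rw [Nat.add_mod_right, show K + t + 1 - K = t + 1 by omega,
            show d * (d ^ t * (4 * d * (N + 1) + s)) = d ^ (t + 1) * (4 * d * (N + 1) + s) by ring]
          exact Nat.ModEq.mul_left (n := 4) _ h5
        · rwa [Nat.dvd_add_right ⟨_, rfl⟩]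
        · have : 1 ≤ d ^ t * (4 * d * (N + 1) + s) := Nat.mul_pos (by positivity) (by nlinarith)
          nlinarith
      intro n m hm
      set M := n + T * (K + 2) with hM
      have hMK : K + 2 ≤ M := by nlinarith
      rw [← hperj (K + 2), ← hM]
      obtain ⟨t, ht⟩ : ∃ t, M = K + 1 + t + 1 := ⟨M - K - 2, by omega⟩
      rw [ht]
      have h7 : G (K + 1 + t + 1) m = G (K + 1 + t) (d * m) + w (K + 1 + t + 1) m := by
        rw [hG]
        simp only
        rw [Finset.sum_range_succ, Nat.sub_self, pow_zero, mul_one]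
        congr 1
        refine Finset.sum_congr rfl fun n hn => ?_
        rw [Finset.mem_range] at hn
        rw [show K + 1 + t + 1 - n = (K + 1 + t - n) + 1 by omega, pow_succ]
        congr 1; ring
      rw [hGK _ (by omega) m hm, hGK _ (by omega) (d * m)
        (by rw [Nat.mul_mod, Nat.odd_iff.1 hodd, hm]),
        show K + 1 + t + 1 - K = (K + 1 + t - K) + 1 by omega, pow_succ, mul_assoc] at h7
      exact left_eq_add.1 h7

end MahlerCoefficientsZero

section PeriodicSequences

open Polynomial

variable {b : ℕ → ℂ} {p : ℕ} {J : Finset ℕ} {coef : ℕ → ℂ}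

/-- The dilates of a nonzero periodic sequence are linearly independent. -/
lemma coef_eq_zero_of_sum_dilate_eq_zero (hp : 0 < p) (hb : Function.Periodic b p) (hb0 : b ≠ 0)
    (hJ : ∀ j ∈ J, 1 ≤ j)
    (h : ∀ n, ∑ j ∈ J, coef j * (if j ∣ n then b (n / j) else 0) = 0) :
    ∀ j ∈ J, coef j = 0 := by
  classical
  by_contra hcon
  push Not at hcon
  have hex : ∃ j, j ∈ J ∧ coef j ≠ 0 := hcon
  obtain ⟨hj0, hcj0⟩ := Nat.find_spec hex
  set j₀ := Nat.find hex
  have hexh : ∃ h, 1 ≤ h ∧ b h ≠ 0 := by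
    obtain ⟨h, hh⟩ := Function.ne_iff.1 hb0
    exact ⟨h + p, by omega, by rw [hb]; exact hh⟩
  obtain ⟨hh1, hbh⟩ := Nat.find_spec hexh
  set m := Nat.find hexh
  have hj1 := hJ _ hj0
  have hs := h (j₀ * m)
  rw [Finset.sum_eq_single_of_mem j₀ hj0, if_pos (dvd_mul_right _ _),
    Nat.mul_div_cancel_left _ hj1] at hs
  · exact (mul_ne_zero hcj0 hbh) hs
  · intro j hj hne
    by_cases hc : coef j = 0
    · rw [hc, zero_mul]
    have hlt : j₀ < j := lt_of_le_of_ne (Nat.find_min' hex ⟨hj, hc⟩) hne.symm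
    split_ifs with hd
    · obtain ⟨c, hcc⟩ := hd
      rw [hcc, Nat.mul_div_cancel_left _ (hJ j hj)]
      have hc1 : 1 ≤ c := by
        rcases Nat.eq_zero_or_pos c with rfl | h
        · rw [mul_zero] at hcc
          have : 0 < j₀ * m := Nat.mul_pos hj1 hh1
          omega
        · exact h
      have hcm : c < m := by
        by_contra hge
        push Not at hge
        have : j₀ * m < j * c := by nlinarith
        omega
      have := Nat.find_min hexh hcm
      push Not at this
      rw [this hc1, mul_zero]
    · rw [mul_zero]

lemma exists_root_of_unity_sum_ne_zero (hp : 0 < p) (hb : Function.Periodic b p)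
    (hconst : ¬ ∃ v, ∀ h, b h = v) :
    ∃ ζ : ℂ, ζ ^ p = 1 ∧ ζ ≠ 1 ∧ ∑ m ∈ Finset.range p, b m * ζ ^ m ≠ 0 := by
  classical
  by_contra hcon
  push Not at hcon
  set S : ℂ[X] := ∑ m ∈ Finset.range p, C (b m) * X ^ m with hS
  have hSeval : ∀ x, S.eval x = ∑ m ∈ Finset.range p, b m * x ^ m := by
    intro x; simp [hS, eval_finsetSum]
  have hScoeff : ∀ n, S.coeff n = if n < p then b n else 0 := by
    intro n
    simp [hS, finsetSum_coeff, coeff_C_mul, coeff_X_pow]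
  have hSdeg : S.natDegree < p := by
    rw [Nat.lt_iff_le_pred hp]
    refine natDegree_sum_le_of_forall_le _ _ fun m hm => ?_
    rw [Finset.mem_range] at hm
    exact (natDegree_C_mul_X_pow_le _ _).trans (by omega)
  set R : ℂ[X] := (X - 1) * S - C (b (p - 1)) * (X ^ p - 1) with hR
  have hR0 : R = 0 := by
    refine eq_zero_of_natDegree_lt_card_of_eval_eq_zero' R
      (nthRootsFinset p (1 : ℂ)) ?_ ?_
    · intro x hx
      rw [mem_nthRootsFinset hp] at hx
      by_cases h1 : x = 1
      · simp [hR, h1]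
      · rw [hR]
        simp only [eval_sub, eval_mul, eval_X, eval_one, eval_C, eval_pow, hx, hSeval,
          hcon x hx h1]
        ring
    · rw [(Complex.isPrimitiveRoot_exp p hp.ne').card_nthRootsFinset]
      rw [Nat.lt_iff_le_pred hp, natDegree_le_iff_coeff_eq_zero]
      intro n hn
      obtain ⟨n, rfl⟩ : ∃ n', n = n' + 1 := ⟨n - 1, by omega⟩
      rw [hR, sub_mul, one_mul, coeff_sub, coeff_sub, coeff_X_mul, coeff_C_mul, coeff_sub,
        coeff_X_pow, coeff_one, hScoeff, hScoeff]
      rcases Nat.lt_or_ge (n + 1) p with h | h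
      · omega
      · rw [if_neg (show ¬ n + 1 < p by omega)]
        rcases Nat.lt_or_ge n p with h' | h'
        · have : n = p - 1 := by omega
          rw [if_pos h', if_pos (by omega), this]; simp
        · rw [if_neg (by omega), if_neg (by omega)]; simp
  apply hconst
  have hstep : ∀ n, n + 1 < p → b (n + 1) = b n := by
    intro n hn
    have := congrArg (fun P => coeff P (n + 1)) hR0
    simp only [hR, sub_mul, one_mul, coeff_sub, coeff_X_mul, coeff_C_mul, coeff_X_pow, coeff_one,
      hScoeff, coeff_zero] at this
    rw [if_pos (by omega), if_pos hn, if_neg (by omega)] at this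
    simp at this
    exact (sub_eq_zero.1 this).symm
  have hall : ∀ n, n < p → b n = b 0 := by
    intro n
    induction n with
    | zero => intro _; rfl
    | succ n ih => intro hn; rw [hstep n hn, ih (by omega)]
  refine ⟨b 0, fun n => ?_⟩
  rw [← hb.map_mod_nat n]
  exact hall _ (Nat.mod_lt _ hp)

lemma exists_primitiveRoot_pow_eq {o j : ℕ} (ho : 0 < o) (hj : 0 < j) {ζ : ℂ}
    (hζ : IsPrimitiveRoot ζ o) : ∃ w : ℂ, IsPrimitiveRoot w (o * j) ∧ w ^ j = ζ := by
  have hoj : o * j ≠ 0 := by positivity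
  have hη := Complex.isPrimitiveRoot_exp (o * j) hoj
  set η := Complex.exp (2 * Real.pi * Complex.I / (o * j : ℕ))
  have hη' : IsPrimitiveRoot (η ^ j) o := hη.pow (Nat.pos_of_ne_zero hoj) (mul_comm _ _)
  have : NeZero o := ⟨ho.ne'⟩
  have : NeZero (o * j) := ⟨hoj⟩
  obtain ⟨a, _, hac, haζ⟩ := hη'.isPrimitiveRoot_iff.1 hζ
  obtain ⟨u, hu⟩ := ZMod.unitsMap_surjective (Dvd.intro j rfl : o ∣ o * j)
    (ZMod.unitOfCoprime a hac)
  have hval : (u : ZMod (o * j)).val ≡ a [MOD o] := by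
    rw [← ZMod.natCast_eq_natCast_iff]
    have h1 := congrArg (fun x : (ZMod o)ˣ => (x : ZMod o)) hu
    simp only [ZMod.unitsMap_val, ZMod.coe_unitOfCoprime] at h1
    rw [← h1, ZMod.natCast_val]
  refine ⟨η ^ (u : ZMod (o * j)).val, hη.pow_of_coprime _ (ZMod.val_coe_unit_coprime u), ?_⟩
  rw [← haζ, ← pow_mul, mul_comm, pow_mul]
  rw [← pow_mod_orderOf, ← hη'.eq_orderOf, hval, hη'.eq_orderOf, pow_mod_orderOf]

lemma sum_range_mul_periodic (hb : Function.Periodic b p) (x : ℂ) (t : ℕ) :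
    ∑ m ∈ Finset.range (p * t), b m * x ^ m =
      (∑ m ∈ Finset.range p, b m * x ^ m) * ∑ i ∈ Finset.range t, (x ^ p) ^ i := by
  induction t with
  | zero => simp
  | succ t ih =>
    rw [mul_add, mul_one, Finset.sum_range_add, ih, Finset.sum_range_succ, mul_add,
      Finset.sum_mul _ _ ((x ^ p) ^ t)]
    congr 1
    refine Finset.sum_congr rfl fun m _ => ?_
    rw [add_comm (p * t) m, show b (m + p * t) = b m by rw [mul_comm p t]; exact (hb.nat_mul t) m,
      pow_add, ← pow_mul]
    ring

lemma sum_range_dilate (g : ℕ → ℂ) {j : ℕ} (hj : 0 < j) (t : ℕ) :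
    ∑ n ∈ Finset.range (j * t), (if j ∣ n then g n else 0) =
      ∑ m ∈ Finset.range t, g (j * m) := by
  induction t with
  | zero => simp
  | succ t ih =>
    rw [mul_add, mul_one, Finset.sum_range_add, ih, Finset.sum_range_succ]
    congr 1
    rw [Finset.sum_eq_single_of_mem 0 (by simpa using hj)]
    · simp
    · intro m hm hm0
      rw [Finset.mem_range] at hm
      rw [if_neg]
      rw [Nat.dvd_add_right (dvd_mul_right _ _)]
      exact Nat.not_dvd_of_pos_of_lt (by omega) hm

/-- The dilates of a nonconstant periodic sequence are linearly independent modulo constants. -/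
lemma coef_eq_zero_of_sum_dilate_eq_const (hp : 0 < p) (hb : Function.Periodic b p)
    (hconst : ¬ ∃ v, ∀ h, b h = v) (hJ : ∀ j ∈ J, 1 ≤ j) {κ : ℂ}
    (h : ∀ n, ∑ j ∈ J, coef j * (if j ∣ n then b (n / j) else 0) = κ) :
    ∀ j ∈ J, coef j = 0 := by
  classical
  by_contra hcon
  push Not at hcon
  obtain ⟨J₀, hJ₀, hmax⟩ := Finset.exists_max_image (J.filter fun j => coef j ≠ 0) id
    (by obtain ⟨j, hj, hc⟩ := hcon; exact ⟨j, by simp [hj, hc]⟩)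
  rw [Finset.mem_filter] at hJ₀
  set S : ℂ → ℂ := fun x => ∑ m ∈ Finset.range p, b m * x ^ m with hS
  obtain ⟨ζ, hζ, hζmax⟩ := Finset.exists_max_image
    ((nthRootsFinset p (1 : ℂ)).filter fun ζ => ζ ≠ 1 ∧ S ζ ≠ 0) orderOf (by
      obtain ⟨ζ, h1, h2, h3⟩ := exists_root_of_unity_sum_ne_zero hp hb hconst
      exact ⟨ζ, by rw [Finset.mem_filter, mem_nthRootsFinset hp]; exact ⟨h1, h2, h3⟩⟩)
  simp only [Finset.mem_filter, mem_nthRootsFinset hp] at hζ hζmax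
  obtain ⟨hζp, hζ1, hSζ⟩ := hζ
  have hJ1 := hJ _ hJ₀.1
  have ho : 0 < orderOf ζ := orderOf_pos_iff.2 (isOfFinOrder_iff_pow_eq_one.2 ⟨p, hp, hζp⟩)
  obtain ⟨w, hw, hwζ⟩ := exists_primitiveRoot_pow_eq ho hJ1 (IsPrimitiveRoot.orderOf ζ)
  have hw1 : w ≠ 1 := by rintro rfl; rw [one_pow] at hwζ; exact hζ1 hwζ.symm
  set Q := ∏ j ∈ J, j with hQ
  have hQ0 : 0 < Q := Finset.prod_pos fun j hj => hJ j hj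
  have hQdvd : ∀ j ∈ J, ∃ t, 0 < t ∧ p * Q = j * (p * t) := by
    intro j hj
    obtain ⟨t, ht⟩ := Finset.dvd_prod_of_mem (fun j => j) hj
    change Q = j * t at ht
    refine ⟨t, Nat.pos_of_ne_zero (by rintro rfl; omega), ?_⟩
    rw [ht]; ring
  have hwT : w ^ (p * Q) = 1 := by
    obtain ⟨t, _, ht⟩ := hQdvd J₀ hJ₀.1
    rw [ht, pow_mul, hwζ, pow_mul, hζp, one_pow]
  have hzero : ∑ j ∈ J, coef j * ∑ n ∈ Finset.range (p * Q),
      (if j ∣ n then b (n / j) * w ^ n else 0) = 0 := by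
    have h1 : ∑ n ∈ Finset.range (p * Q), κ * w ^ n = 0 := by
      rw [← Finset.mul_sum, geom_sum_eq hw1, hwT]; simp
    simp_rw [Finset.mul_sum]
    rw [Finset.sum_comm]
    refine Eq.trans ?_ h1
    refine Finset.sum_congr rfl fun n _ => ?_
    rw [← h n, Finset.sum_mul]
    refine Finset.sum_congr rfl fun j _ => ?_
    split_ifs <;> ring
  rw [Finset.sum_eq_single_of_mem J₀ hJ₀.1] at hzero
  · obtain ⟨t, ht0, ht⟩ := hQdvd J₀ hJ₀.1
    rw [ht, sum_range_dilate (fun n => b (n / J₀) * w ^ n) hJ1] at hzero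
    simp only [Nat.mul_div_cancel_left _ hJ1, pow_mul, hwζ] at hzero
    rw [sum_range_mul_periodic hb, hζp] at hzero
    simp only [one_pow, Finset.sum_const, Finset.card_range, nsmul_eq_mul, mul_one] at hzero
    exact mul_ne_zero hJ₀.2 (mul_ne_zero hSζ (by exact_mod_cast ht0.ne')) hzero
  · intro j hj hne
    by_cases hc : coef j = 0
    · rw [hc, zero_mul]
    have hlt : j < J₀ := lt_of_le_of_ne (hmax j (by simp [hj, hc])) hne
    obtain ⟨t, ht0, ht⟩ := hQdvd j hj
    have hj1 := hJ j hj
    have hx : (w ^ j) ^ (p * t) = 1 := by rw [← pow_mul, ← ht, hwT]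
    rw [ht, sum_range_dilate (fun n => b (n / j) * w ^ n) hj1]
    simp only [Nat.mul_div_cancel_left _ hj1, pow_mul w]
    rw [sum_range_mul_periodic hb]
    by_cases hxp : (w ^ j) ^ p = 1
    · have hS0 : S (w ^ j) = 0 := by
        by_contra hS0
        have hord : orderOf ζ < orderOf (w ^ j) := by
          have h1 : 0 < orderOf (w ^ j) :=
            orderOf_pos_iff.2 (isOfFinOrder_iff_pow_eq_one.2 ⟨p, hp, hxp⟩)
          have h2 : orderOf ζ * J₀ ∣ j * orderOf (w ^ j) := by
            apply hw.dvd_of_pow_eq_one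
            rw [pow_mul, pow_orderOf_eq_one]
          have h3 := Nat.le_of_dvd (Nat.mul_pos hj1 h1) h2
          by_contra hle
          push Not at hle
          have : j * orderOf (w ^ j) < orderOf ζ * J₀ := by nlinarith
          omega
        have hne1 : w ^ j ≠ 1 := by
          intro h1; rw [h1, orderOf_one] at hord; omega
        have := hζmax (w ^ j) ⟨hxp, hne1, hS0⟩
        omega
      change coef j * (S (w ^ j) * _) = 0
      rw [hS0, zero_mul, mul_zero]
    · rw [geom_sum_eq hxp, ← pow_mul, hx]
      simp

end PeriodicSequences

section MahlerIndependence

/-- The `n`-th coefficient of `∑ h, β h * g (X ^ (r ^ h))`, where `g = ∑ m, ρ m * X ^ m` has no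
constant term. -/
def mahlerCoeff {F : Type*} [Field F] (β ρ : ℕ → F) (r n : ℕ) : F :=
  ∑ h ∈ Finset.range n, if r ^ h ∣ n then β h * ρ (n / r ^ h) else 0

/-- The function supported on odd integers which is `ε ^ ((m - 1) / 2)` there. -/
def oddChar {F : Type*} [Field F] (ε : F) (m : ℕ) : F := if m % 2 = 1 then ε ^ (m / 2) else 0

lemma oddChar_of_mod_eq {ε : ℂ} (hε : ε ^ 2 = 1) {m m' : ℕ} (h : m % 4 = m' % 4) :
    oddChar ε m = oddChar ε m' := by
  have key : ∀ m, oddChar ε m = oddChar ε (m % 4) := by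
    intro m
    unfold oddChar
    rw [show m % 4 % 2 = m % 2 by omega]
    congr 1
    rw [show m / 2 = 2 * (m / 4) + m % 4 / 2 by omega, pow_add, pow_mul, hε, one_pow, one_mul]
  rw [key m, key m', h]

lemma oddChar_even (ε : ℂ) {m : ℕ} (h : m % 2 = 0) : oddChar ε m = 0 := if_neg (by omega)

lemma mahlerCoeff_mul_pow {F : Type*} [Field F] (β ρ : ℕ → F) {d j : ℕ} (hd : 2 ≤ d) (hj : 1 ≤ j)
    {m : ℕ} (hm : ¬ d ∣ m) (M : ℕ) :
    mahlerCoeff β ρ (d ^ j) (m * d ^ M) =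
      ∑ n ∈ Finset.range (M + 1), if j ∣ n then β (n / j) * ρ (m * d ^ (M - n)) else 0 := by
  have hdvd : ∀ h, (d ^ j) ^ h ∣ m * d ^ M ↔ j * h ≤ M := by
    intro h
    rw [← pow_mul]
    constructor
    · intro hdv
      by_contra hlt
      push Not at hlt
      apply hm
      have h1 : d ^ (M + 1) ∣ m * d ^ M := (pow_dvd_pow d hlt).trans hdv
      rw [pow_succ, mul_comm] at h1
      exact Nat.dvd_of_mul_dvd_mul_right (by positivity) h1
    · intro hle
      exact (pow_dvd_pow d hle).mul_left m
  have hm0 : 0 < m := Nat.pos_of_ne_zero (by rintro rfl; simp at hm)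
  unfold mahlerCoeff
  rw [← Finset.sum_filter, ← Finset.sum_filter]
  symm
  refine Finset.sum_nbij' (fun n => n / j) (fun h => j * h) ?_ ?_ ?_ ?_ ?_
  · intro n hn
    rw [Finset.mem_filter, Finset.mem_range] at hn
    obtain ⟨hn, c, rfl⟩ := hn
    rw [Finset.mem_filter, Finset.mem_range, Nat.mul_div_cancel_left _ hj, hdvd]
    refine ⟨?_, by omega⟩
    have h1 : M < d ^ M := Nat.lt_pow_self (by omega)
    nlinarith
  · intro h hh
    rw [Finset.mem_filter, Finset.mem_range, hdvd] at hh
    rw [Finset.mem_filter, Finset.mem_range]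
    exact ⟨by omega, dvd_mul_right _ _⟩
  · intro n hn
    rw [Finset.mem_filter] at hn
    exact Nat.mul_div_cancel' hn.2
  · intro h _
    exact Nat.mul_div_cancel_left _ hj
  · intro n hn
    rw [Finset.mem_filter, Finset.mem_range] at hn
    obtain ⟨hn, c, rfl⟩ := hn
    rw [Nat.mul_div_cancel_left _ hj, ← pow_mul]
    congr 2
    rw [Nat.eq_div_iff_mul_eq_left (by positivity) ((pow_dvd_pow d (by omega)).mul_left m),
      mul_assoc, ← pow_add]
    congr 2; omega

variable {d : ℕ} {a b c : ℕ → ℂ} {pa pb pc : ℕ} {J : Finset ℕ} {S : Finset ℤ} {lam s : ℂ}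
  {eps : ℤ → ℂ} {cQ : ℕ → ℕ → ℂ} {cF cL : ℤ → ℕ → ℂ}

lemma sum_ite_mul_mahlerCoeff_delta (hd : 2 ≤ d) (hJ : ∀ j ∈ J, 1 ≤ j) {m : ℕ} (hm : ¬ d ∣ m)
    (M : ℕ) :
    ∑ μ ∈ Finset.Ico 1 d, ∑ j ∈ J,
      cQ μ j * mahlerCoeff a (fun n => if n = μ then 1 else 0) (d ^ j) (m * d ^ M) =
    if m < d then ∑ j ∈ J, cQ m j * (if j ∣ M then a (M / j) else 0) else 0 := by
  have h1 : ∀ μ ∈ Finset.Ico 1 d, ∑ j ∈ J,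
      cQ μ j * mahlerCoeff a (fun n => if n = μ then 1 else 0) (d ^ j) (m * d ^ M) =
      if m = μ then ∑ j ∈ J, cQ μ j * (if j ∣ M then a (M / j) else 0) else 0 := by
    intro μ hμ
    rw [Finset.mem_Ico] at hμ
    have h2 : ∀ j ∈ J, mahlerCoeff a (fun n => if n = μ then 1 else 0) (d ^ j) (m * d ^ M) =
        if m = μ then (if j ∣ M then a (M / j) else 0) else 0 := by
      intro j hj
      rw [mahlerCoeff_mul_pow _ _ hd (hJ j hj) hm, Finset.sum_eq_single_of_mem M (by simp)]
      · simp only [Nat.sub_self, pow_zero, mul_one]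
        split_ifs <;> simp
      · intro n hn hne
        rw [Finset.mem_range] at hn
        have hne' : m * d ^ (M - n) ≠ μ := by
          intro h
          have : d ∣ μ := by
            rw [← h]
            exact (dvd_pow_self d (by omega)).mul_left m
          have := Nat.le_of_dvd (by omega) this
          omega
        rw [if_neg hne', mul_zero, ite_self]
    rw [Finset.sum_congr rfl fun j hj => by rw [h2 j hj]]
    split_ifs <;> simp
  rw [Finset.sum_congr rfl h1, Finset.sum_ite_eq]
  have hm0 : m ≠ 0 := by rintro rfl; simp at hm
  refine if_congr ?_ rfl rfl
  rw [Finset.mem_Ico]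
  omega

/-- Linear independence, modulo linearly recurrent sequences, of the coefficient sequences attached
to a fixed base `d`. -/
theorem coef_eq_zero_of_isRec (hd : 2 ≤ d)
    (hpa : 0 < pa) (ha : Function.Periodic a pa) (ha0 : a ≠ 0)
    (hpb : 0 < pb) (hb : Function.Periodic b pb) (hb' : ¬ ∃ v, ∀ h, b h = v)
    (hpc : 0 < pc) (hc : Function.Periodic c pc) (hc0 : c ≠ 0)
    (hJ : ∀ j ∈ J, 1 ≤ j) (hs : s ≠ 0) (heps : ∀ ℓ, eps ℓ ^ 2 = 1) (heps2 : d = 2 → eps 0 = 1)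
    (hlam0 : 0 < ‖lam‖) (hlam1 : ‖lam‖ < 1)
    (hrec : IsRec fun n =>
      (∑ μ ∈ Finset.Ico 1 d, ∑ j ∈ J,
        cQ μ j * mahlerCoeff a (fun n => if n = μ then 1 else 0) (d ^ j) n) +
      ∑ ℓ ∈ S, ∑ j ∈ J,
        (cF ℓ j * mahlerCoeff b (fun m => s * oddChar (eps ℓ) m * lam ^ (ℓ * (m : ℕ))) (d ^ j) n +
          cL ℓ j * mahlerCoeff c (fun m => oddChar (-eps ℓ) m * lam ^ (ℓ * (m : ℕ))) (d ^ j) n)) :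
    (∀ μ ∈ Finset.Ico 1 d, ∀ j ∈ J, cQ μ j = 0) ∧
      (∀ ℓ ∈ S, ∀ j ∈ J, cF ℓ j = 0 ∧ cL ℓ j = 0) := by
  classical
  have hb0 : b ≠ 0 := by rintro rfl; exact hb' ⟨0, fun _ => rfl⟩
  set A : ℕ → ℕ → ℂ := fun μ n => ∑ j ∈ J, cQ μ j * (if j ∣ n then a (n / j) else 0) with hA
  set VF : ℤ → ℕ → ℂ := fun ℓ n => ∑ j ∈ J, s * cF ℓ j * (if j ∣ n then b (n / j) else 0) with hVF
  set VL : ℤ → ℕ → ℂ := fun ℓ n => ∑ j ∈ J, cL ℓ j * (if j ∣ n then c (n / j) else 0) with hVL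
  set v : ℤ → ℕ → ℕ → ℂ := fun ℓ n m =>
    VF ℓ n * oddChar (eps ℓ) m + VL ℓ n * oddChar (-eps ℓ) m with hv
  set f : ℕ → ℂ := _ with hfdef
  change IsRec f at hrec
  have heps' : ∀ ℓ, (-eps ℓ) ^ 2 = 1 := fun ℓ => by rw [neg_sq, heps]
  have hv_mod : ∀ ℓ n m m', m % 4 = m' % 4 → v ℓ n m = v ℓ n m' := by
    intro ℓ n m m' h
    simp only [hv, oddChar_of_mod_eq (heps ℓ) h, oddChar_of_mod_eq (heps' ℓ) h]
  have hv_even : ∀ ℓ n m, m % 2 = 0 → v ℓ n m = 0 := by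
    intro ℓ n m h
    simp only [hv, oddChar_even _ h]; ring
  set T := pa * pb * pc * ∏ j ∈ J, j with hT
  have hT0 : 0 < T := by
    have : 0 < ∏ j ∈ J, j := Finset.prod_pos fun j hj => hJ j hj
    positivity
  have hdil : ∀ (β : ℕ → ℂ) (p : ℕ), Function.Periodic β p → p ∣ pa * pb * pc → ∀ j ∈ J, ∀ n,
      (if j ∣ n + T then β ((n + T) / j) else 0) = if j ∣ n then β (n / j) else 0 := by
    intro β p hβ hp j hj n
    obtain ⟨t, ht⟩ := Finset.dvd_prod_of_mem (fun j => j) hj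
    obtain ⟨u, hu⟩ := hp
    have e : T = j * (u * t * p) := by rw [hT, ht, hu]; ring
    simp only [e, Nat.dvd_add_left (Dvd.intro (u * t * p) rfl : j ∣ j * (u * t * p))]
    congr 1
    rw [Nat.add_mul_div_left _ _ (hJ j hj)]
    exact hβ.nat_mul (u * t) _
  have hA_per : ∀ μ n, A μ (n + T) = A μ n := by
    intro μ n
    refine Finset.sum_congr rfl fun j hj => ?_
    rw [hdil a pa ha ⟨pb * pc, by ring⟩ j hj]
  have hVF_per : ∀ ℓ n, VF ℓ (n + T) = VF ℓ n := by
    intro μ n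
    refine Finset.sum_congr rfl fun j hj => ?_
    rw [hdil b pb hb ⟨pa * pc, by ring⟩ j hj]
  have hVL_per : ∀ ℓ n, VL ℓ (n + T) = VL ℓ n := by
    intro μ n
    refine Finset.sum_congr rfl fun j hj => ?_
    rw [hdil c pc hc ⟨pa * pb, by ring⟩ j hj]
  have hv_per : ∀ ℓ n m, v ℓ (n + T) m = v ℓ n m := by
    intro ℓ n m; simp only [hv, hVF_per, hVL_per]
  have hf : ∀ M m, ¬ d ∣ m → f (m * d ^ M) =
      (∑ n ∈ Finset.range (M + 1), ∑ ℓ ∈ S,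
        v ℓ n (m * d ^ (M - n)) * lam ^ (ℓ * (m * d ^ (M - n) : ℕ))) +
      if m < d then A m M else 0 := by
    intro M m hm
    rw [hfdef]
    simp only
    rw [sum_ite_mul_mahlerCoeff_delta hd hJ hm, add_comm]
    congr 1
    conv_rhs => rw [Finset.sum_comm]
    refine Finset.sum_congr rfl fun ℓ _ => ?_
    have h1 : ∀ j ∈ J, cF ℓ j * mahlerCoeff b (fun m => s * oddChar (eps ℓ) m * lam ^ (ℓ * (m : ℕ)))
          (d ^ j) (m * d ^ M) +
        cL ℓ j * mahlerCoeff c (fun m => oddChar (-eps ℓ) m * lam ^ (ℓ * (m : ℕ))) (d ^ j)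
          (m * d ^ M) = ∑ n ∈ Finset.range (M + 1),
        (s * cF ℓ j * (if j ∣ n then b (n / j) else 0) * oddChar (eps ℓ) (m * d ^ (M - n)) +
        cL ℓ j * (if j ∣ n then c (n / j) else 0) * oddChar (-eps ℓ) (m * d ^ (M - n))) *
          lam ^ (ℓ * (m * d ^ (M - n) : ℕ)) := by
      intro j hj
      rw [mahlerCoeff_mul_pow _ _ hd (hJ j hj) hm, mahlerCoeff_mul_pow _ _ hd (hJ j hj) hm,
        Finset.mul_sum, Finset.mul_sum, ← Finset.sum_add_distrib]
      refine Finset.sum_congr rfl fun n _ => ?_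
      split_ifs <;> ring
    rw [Finset.sum_congr rfl h1, Finset.sum_comm]
    refine Finset.sum_congr rfl fun n _ => ?_
    rw [← Finset.sum_mul, Finset.sum_add_distrib, ← Finset.sum_mul, ← Finset.sum_mul]
  have hvne := coeff_eq_zero_of_isRec_of_ne_zero (A := A) hd hT0 hv_mod hv_even hv_per hlam0 hlam1
    hf hrec
  obtain ⟨hA0, κ, hκ, hκ2⟩ := coeff_eq_const_of_isRec (A := A) (f := f)
    (w := fun n m => if 0 ∈ S then v 0 n m else 0) hd hT0
    (fun n m m' h => by simp only [hv_mod 0 n m m' h])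
    (fun n m h => by simp only [hv_even 0 n m h, ite_self])
    (fun n m => by simp only [hv_per]) hA_per
    (by
      intro M m hm
      rw [hf M m hm]
      congr 1
      refine Finset.sum_congr rfl fun n _ => ?_
      rw [← Finset.sum_filter_add_sum_filter_not S (fun ℓ => ℓ = 0)]
      rw [Finset.sum_eq_zero (s := S.filter fun ℓ => ¬ ℓ = 0), add_zero]
      · rw [Finset.filter_eq']
        split_ifs <;> simp
      · intro ℓ hℓ
        rw [Finset.mem_filter] at hℓ
        rw [hvne ℓ hℓ.1 hℓ.2, zero_mul]) hrec
  have hv1 : ∀ ℓ n, v ℓ n 1 = VF ℓ n + VL ℓ n := by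
    intro ℓ n; simp [hv, oddChar]
  have hv3 : ∀ ℓ n, v ℓ n 3 = eps ℓ * (VF ℓ n - VL ℓ n) := by
    intro ℓ n; simp [hv, oddChar]; ring
  have heps0 : ∀ ℓ, eps ℓ ≠ 0 := by
    intro ℓ h; have := heps ℓ; rw [h] at this; norm_num at this
  have hVFcase : ∀ ℓ, (∀ n, VF ℓ n = 0) → ∀ j ∈ J, cF ℓ j = 0 := by
    intro ℓ h j hj
    exact (mul_eq_zero.1 (coef_eq_zero_of_sum_dilate_eq_zero hpb hb hb0 hJ h j hj)).resolve_left hs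
  have hVLcase : ∀ ℓ, (∀ n, VL ℓ n = 0) → ∀ j ∈ J, cL ℓ j = 0 := fun ℓ h j hj =>
    coef_eq_zero_of_sum_dilate_eq_zero hpc hc hc0 hJ h j hj
  refine ⟨?_, ?_⟩
  · intro μ hμ j hj
    rw [Finset.mem_Ico] at hμ
    exact coef_eq_zero_of_sum_dilate_eq_zero hpa ha ha0 hJ (fun n => hA0 μ n hμ.1 hμ.2) j hj
  · intro ℓ hℓ
    have hcomb : ∀ n, v ℓ n 1 = 0 → v ℓ n 3 = 0 → VF ℓ n = 0 ∧ VL ℓ n = 0 := by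
      intro n h1 h3
      rw [hv1] at h1
      rw [hv3] at h3
      have h3 := (mul_eq_zero.1 h3).resolve_left (heps0 ℓ)
      constructor
      · linear_combination (h1 + h3) / 2
      · linear_combination (h1 - h3) / 2
    by_cases hℓ0 : ℓ = 0
    · subst hℓ0
      have hκ1 : ∀ n, v 0 n 1 = κ := fun n => by simpa [hℓ] using hκ n 1 rfl
      have hκ3 : ∀ n, v 0 n 3 = κ := fun n => by simpa [hℓ] using hκ n 3 rfl
      by_cases hd2 : d = 2
      · have he := heps2 hd2
        have hVL0 : ∀ n, VL 0 n = 0 := by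
          intro n
          have h1 := hκ1 n
          have h3 := hκ3 n
          rw [hv1] at h1
          rw [hv3, he] at h3
          linear_combination (h1 - h3) / 2
        have hVFκ : ∀ n, VF 0 n = κ := by
          intro n
          have h1 := hκ1 n
          rwa [hv1, hVL0, add_zero] at h1
        intro j hj
        exact ⟨(mul_eq_zero.1 (coef_eq_zero_of_sum_dilate_eq_const hpb hb hb' hJ hVFκ j
          hj)).resolve_left hs, hVLcase 0 hVL0 j hj⟩
      · have hκ0 := hκ2 hd2
        have h := fun n => hcomb n (by rw [hκ1, hκ0]) (by rw [hκ3, hκ0])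
        exact fun j hj => ⟨hVFcase 0 (fun n => (h n).1) j hj, hVLcase 0 (fun n => (h n).2) j hj⟩
    · have h := fun n => hcomb n (hvne ℓ hℓ hℓ0 n 1) (hvne ℓ hℓ hℓ0 n 3)
      exact fun j hj => ⟨hVFcase ℓ (fun n => (h n).1) j hj, hVLcase ℓ (fun n => (h n).2) j hj⟩

end MahlerIndependence

section MahlerAlgebraicIndependence

open PowerSeries

lemma IsRationalSeries.add {f g : ℂ⟦X⟧} (hf : IsRationalSeries f) (hg : IsRationalSeries g) :
    IsRationalSeries (f + g) := by
  obtain ⟨P, Q, hP, hPQ⟩ := hf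
  obtain ⟨P', Q', hP', hPQ'⟩ := hg
  refine ⟨P * P', P' * Q + P * Q', mul_ne_zero hP hP', ?_⟩
  rw [Polynomial.coe_add, Polynomial.coe_mul, Polynomial.coe_mul, Polynomial.coe_mul, ← hPQ,
    ← hPQ']
  ring

lemma IsRationalSeries.smul {f : ℂ⟦X⟧} (hf : IsRationalSeries f) (c : ℂ) :
    IsRationalSeries (c • f) := by
  obtain ⟨P, Q, hP, hPQ⟩ := hf
  refine ⟨P, c • Q, hP, ?_⟩
  rw [mul_smul_comm, hPQ, Polynomial.coe_smul]

lemma IsRationalSeries.sum {ι : Type*} {s : Finset ι} {f : ι → ℂ⟦X⟧}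
    (hf : ∀ i ∈ s, IsRationalSeries (f i)) : IsRationalSeries (∑ i ∈ s, f i) :=
  Finset.sum_induction f IsRationalSeries (fun _ _ => IsRationalSeries.add)
    ⟨1, 0, one_ne_zero, by simp⟩ hf

lemma isRationalSeries_mk_of_mul_eq {u : ℕ → ℂ} {D : ℕ} (hD : 0 < D) {c : ℂ}
    (hu : ∀ n, u (n + D) = c * u n) : IsRationalSeries (PowerSeries.mk u) := by
  refine ⟨1 - Polynomial.C c * Polynomial.X ^ D, trunc D (PowerSeries.mk u), ?_, ?_⟩
  · intro h
    have := congrArg (Polynomial.eval 0) h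
    simp [hD.ne'] at this
  · ext n
    rw [Polynomial.coe_sub, Polynomial.coe_one, Polynomial.coe_mul, Polynomial.coe_pow,
      Polynomial.coe_X, Polynomial.coe_C, sub_mul, one_mul, map_sub, mul_assoc, coeff_C_mul,
      Polynomial.coeff_coe, coeff_trunc, coeff_mk]
    rw [coeff_X_pow_mul', coeff_mk]
    rcases Nat.lt_or_ge n D with h | h
    · rw [if_neg (by omega), if_pos h]; simp
    · obtain ⟨m, rfl⟩ := Nat.exists_eq_add_of_le' h
      rw [if_pos h, if_neg (by omega), hu, Nat.add_sub_cancel, sub_self]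

lemma isRationalSeries_mk_of_finite {u : ℕ → ℂ} {N : ℕ} (hu : ∀ n, N ≤ n → u n = 0) :
    IsRationalSeries (PowerSeries.mk u) := by
  refine ⟨1, trunc N (PowerSeries.mk u), one_ne_zero, ?_⟩
  ext n
  rw [Polynomial.coe_one, one_mul, Polynomial.coeff_coe, coeff_trunc, coeff_mk]
  split_ifs with h
  · rfl
  · exact hu n (by omega)

lemma mahlerCoeff_zero {F : Type*} [Field F] (β ρ : ℕ → F) (r : ℕ) : mahlerCoeff β ρ r 0 = 0 := rfl

lemma mahlerCoeff_eq_sum_range {F : Type*} [Field F] (β ρ : ℕ → F) {r n N : ℕ} (hr : 2 ≤ r)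
    (hn : 0 < n) (hN : n ≤ N) :
    mahlerCoeff β ρ r n = ∑ h ∈ Finset.range N, if r ^ h ∣ n then β h * ρ (n / r ^ h) else 0 := by
  refine Finset.sum_subset (Finset.range_mono hN) fun h _ hh => ?_
  rw [Finset.mem_range] at hh
  rw [if_neg]
  intro hd
  have h1 := Nat.le_of_dvd hn hd
  have h2 : h < r ^ h := Nat.lt_pow_self (by omega)
  omega

/-- The functional equation `f(X) = f(X ^ (r ^ H)) + R(X)`, with `R` a truncation, on
coefficients. -/
lemma mahlerCoeff_sub {F : Type*} [Field F] {β ρ : ℕ → F} {r H : ℕ} (hr : 2 ≤ r)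
    (hβ : Function.Periodic β H) (hρ : ρ 0 = 0) (n : ℕ) :
    mahlerCoeff β ρ r n - (if r ^ H ∣ n then mahlerCoeff β ρ r (n / r ^ H) else 0) =
      ∑ h ∈ Finset.range H, if r ^ h ∣ n then β h * ρ (n / r ^ h) else 0 := by
  rcases Nat.eq_zero_or_pos n with rfl | hn
  · simp [mahlerCoeff_zero, hρ]
  have hrpos : 0 < r ^ H := by positivity
  rw [mahlerCoeff_eq_sum_range β ρ hr hn (Nat.le_add_left n H), Finset.sum_range_add, add_sub_assoc,
    add_eq_left, sub_eq_zero]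
  split_ifs with hd
  · obtain ⟨n', rfl⟩ := hd
    have hn' : 0 < n' := Nat.pos_of_mul_pos_left hn
    rw [Nat.mul_div_cancel_left _ hrpos, mahlerCoeff_eq_sum_range β ρ hr hn'
      (Nat.le_mul_of_pos_left n' hrpos)]
    refine Finset.sum_congr rfl fun h _ => ?_
    rw [pow_add]
    simp only [Nat.mul_dvd_mul_iff_left hrpos, Nat.mul_div_mul_left _ _ hrpos, add_comm H h, hβ h]
  · refine Finset.sum_eq_zero fun h _ => ?_
    rw [if_neg]
    intro h'
    exact hd ((pow_dvd_pow r (Nat.le_add_right H h)).trans h')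

/-- The three kinds of series: powers of `α` (indexed by an exponent `μ`), Fibonacci reciprocals
and Lucas reciprocals (both indexed by an offset `ℓ`). -/
abbrev SumKind := ℕ ⊕ (ℤ ⊕ ℤ)

/-- The numerators of the series of a given kind. -/
def kindSeq {F : Type*} (a b c : ℕ → F) : SumKind → ℕ → F :=
  Sum.elim (fun _ => a) (Sum.elim (fun _ => b) (fun _ => c))

/-- The Taylor coefficients of the rational function attached to a given kind. -/
def kindRho {F : Type*} [Field F] (lam s : F) (eps : ℤ → F) : SumKind → ℕ → F :=
  Sum.elim (fun μ m => if m = μ then 1 else 0)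
    (Sum.elim (fun ℓ m => s * oddChar (eps ℓ) m * lam ^ (ℓ * (m : ℕ)))
      (fun ℓ m => oddChar (-eps ℓ) m * lam ^ (ℓ * (m : ℕ))))

lemma oddChar_add_two {F : Type*} [Field F] (ε : F) (m : ℕ) :
    oddChar ε (m + 2) = ε * oddChar ε m := by
  unfold oddChar
  rw [Nat.add_mod_right, Nat.add_div_right _ (by norm_num), pow_succ']
  split_ifs <;> simp

lemma isRationalSeries_dilate {ρ : ℕ → ℂ} {R : ℕ} (hR : 0 < R)
    (h : (∃ c, ∀ m, ρ (m + 2) = c * ρ m) ∨ ∃ N, ∀ m, N ≤ m → ρ m = 0) :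
    IsRationalSeries (PowerSeries.mk fun n => if R ∣ n then ρ (n / R) else 0) := by
  rcases h with ⟨c, hc⟩ | ⟨N, hN⟩
  · refine isRationalSeries_mk_of_mul_eq (D := R * 2) (by omega) (c := c) fun n => ?_
    simp only [Nat.dvd_add_left (Dvd.intro 2 rfl : R ∣ R * 2), Nat.add_mul_div_left _ _ hR, hc]
    split_ifs <;> simp
  · refine isRationalSeries_mk_of_finite (N := R * N) fun n hn => ?_
    rw [hN _ ((Nat.le_div_iff_mul_le hR).2 (by rwa [mul_comm])), ite_self]

lemma kindRho_rational {lam s : ℂ} (hlam : lam ≠ 0) (eps : ℤ → ℂ) (κ : SumKind) :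
    (∃ c, ∀ m, kindRho lam s eps κ (m + 2) = c * kindRho lam s eps κ m) ∨
      ∃ N, ∀ m, N ≤ m → kindRho lam s eps κ m = 0 := by
  rcases κ with μ | ℓ | ℓ
  · exact Or.inr ⟨μ + 1, fun m hm => if_neg (by omega)⟩
  · refine Or.inl ⟨eps ℓ * lam ^ (ℓ * 2), fun m => ?_⟩
    change s * oddChar _ _ * _ = _ * (s * oddChar _ _ * _)
    rw [oddChar_add_two, Nat.cast_add, mul_add, zpow_add₀ hlam]
    push_cast; ring
  · refine Or.inl ⟨-eps ℓ * lam ^ (ℓ * 2), fun m => ?_⟩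
    change oddChar _ _ * _ = _ * (oddChar _ _ * _)
    rw [oddChar_add_two, Nat.cast_add, mul_add, zpow_add₀ hlam]
    push_cast; ring

variable {d : ℕ} {a b c : ℕ → ℂ} {pa pb pc : ℕ} {lam s : ℂ} {eps : ℤ → ℂ} {ι : Type*}

/-- Algebraic independence of the generating series attached to a fixed base `d`. -/
theorem algebraicIndependent_mk_mahlerCoeff [Fintype ι] (hd : 2 ≤ d)
    (hpa : 0 < pa) (ha : Function.Periodic a pa) (ha0 : a ≠ 0)
    (hpb : 0 < pb) (hb : Function.Periodic b pb) (hb' : ¬ ∃ v, ∀ h, b h = v)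
    (hpc : 0 < pc) (hc : Function.Periodic c pc) (hc0 : c ≠ 0)
    (hs : s ≠ 0) (heps : ∀ ℓ, eps ℓ ^ 2 = 1) (heps2 : d = 2 → eps 0 = 1)
    (hlam0 : 0 < ‖lam‖) (hlam1 : ‖lam‖ < 1)
    (κ : ι → SumKind) (jj : ι → ℕ) (hinj : Function.Injective fun i => (κ i, jj i))
    (hjj : ∀ i, 1 ≤ jj i) (hμ : ∀ i μ, κ i = Sum.inl μ → 1 ≤ μ ∧ μ < d) :
    AlgebraicIndependent ℂ (Sum.elim
      (fun i => PowerSeries.mk (mahlerCoeff (kindSeq a b c (κ i)) (kindRho lam s eps (κ i))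
        (d ^ jj i)))
      (fun _ : Unit => (X : ℂ⟦X⟧))) := by
  classical
  set P := pa * pb * pc * ∏ i, jj i with hP
  have hprod : 0 < ∏ i, jj i := Finset.prod_pos fun i _ => hjj i
  have hP0 : 0 < P := by positivity
  have hlam : lam ≠ 0 := norm_pos_iff.1 hlam0
  have hr2 : ∀ i, 2 ≤ d ^ jj i := fun i => hd.trans (Nat.le_self_pow (by have := hjj i; omega) d)
  have hper : ∀ i, ∃ H, jj i * H = P ∧ Function.Periodic (kindSeq a b c (κ i)) H := by
    intro i
    obtain ⟨t, ht⟩ := Finset.dvd_prod_of_mem jj (Finset.mem_univ i)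
    refine ⟨pa * pb * pc * t, by rw [hP, ht]; ring, ?_⟩
    rcases κ i with μ | ℓ | ℓ
    · rw [show pa * pb * pc * t = (pb * pc * t) * pa by ring]; exact ha.nat_mul (pb * pc * t)
    · rw [show pa * pb * pc * t = (pa * pc * t) * pb by ring]; exact hb.nat_mul (pa * pc * t)
    · rw [show pa * pb * pc * t = (pa * pb * t) * pc by ring]; exact hc.nat_mul (pa * pb * t)
  choose H hH hHper using hper
  have hρ0 : ∀ i, kindRho lam s eps (κ i) 0 = 0 := by
    intro i
    rcases h : κ i with μ | ℓ | ℓ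
    · exact if_neg (by have := (hμ i μ h).1; omega)
    · simp [kindRho, oddChar]
    · simp [kindRho, oddChar]
  refine algebraicIndependent_of_mahler (q := d ^ P)
    (hd.trans (Nat.le_self_pow hP0.ne' d)) _
    (fun i => PowerSeries.mk fun n => ∑ h ∈ Finset.range (H i), if (d ^ jj i) ^ h ∣ n then
      kindSeq a b c (κ i) h * kindRho lam s eps (κ i) (n / (d ^ jj i) ^ h) else 0) ?_ ?_ ?_
  · intro i n
    simp only [coeff_mk]
    rw [← hH i, pow_mul]
    exact mahlerCoeff_sub (hr2 i) (hHper i) (hρ0 i) n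
  · intro i
    have e : (PowerSeries.mk fun n => ∑ h ∈ Finset.range (H i), if (d ^ jj i) ^ h ∣ n then
        kindSeq a b c (κ i) h * kindRho lam s eps (κ i) (n / (d ^ jj i) ^ h) else 0) =
        ∑ h ∈ Finset.range (H i), kindSeq a b c (κ i) h • PowerSeries.mk fun n =>
          if (d ^ jj i) ^ h ∣ n then kindRho lam s eps (κ i) (n / (d ^ jj i) ^ h) else 0 := by
      ext n
      simp only [map_sum, coeff_mk, coeff_smul, smul_eq_mul, mul_ite, mul_zero]
    rw [e]
    refine IsRationalSeries.sum fun h _ => IsRationalSeries.smul ?_ _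
    exact isRationalSeries_dilate (by positivity) (kindRho_rational hlam eps (κ i))
  · intro x hx hrat
    apply hx
    set g : SumKind × ℕ → ℕ → ℂ := fun y => mahlerCoeff (kindSeq a b c y.1)
      (kindRho lam s eps y.1) (d ^ y.2) with hg
    set e : ι → SumKind × ℕ := fun i => (κ i, jj i) with he
    set C : SumKind × ℕ → ℂ := Function.extend e x 0 with hC
    set J : Finset ℕ := Finset.univ.image jj with hJ
    set S : Finset ℤ := (Finset.univ.image κ).biUnion fun y =>
      Sum.elim (fun _ => ∅) (Sum.elim (fun ℓ => {ℓ}) (fun ℓ => {ℓ})) y with hS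
    set rect : Finset (SumKind × ℕ) := ((Finset.Ico 1 d).disjSum (S.disjSum S)) ×ˢ J with hrect
    have hmem : ∀ i, e i ∈ rect := by
      intro i
      rw [hrect, Finset.mem_product]
      refine ⟨?_, Finset.mem_image_of_mem _ (Finset.mem_univ i)⟩
      have hi : κ i ∈ Finset.univ.image κ := Finset.mem_image_of_mem _ (Finset.mem_univ i)
      change κ i ∈ _
      rcases h : κ i with μ | ℓ | ℓ
      · rw [Finset.inl_mem_disjSum, Finset.mem_Ico]; exact hμ i μ h
      · rw [Finset.inr_mem_disjSum, Finset.inl_mem_disjSum, hS, Finset.mem_biUnion]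
        exact ⟨_, hi, by rw [h]; simp⟩
      · rw [Finset.inr_mem_disjSum, Finset.inr_mem_disjSum, hS, Finset.mem_biUnion]
        exact ⟨_, hi, by rw [h]; simp⟩
    have hsum : ∀ n, ∑ i, x i * g (e i) n = ∑ y ∈ rect, C y * g y n := by
      intro n
      have h1 : ∑ i, x i * g (e i) n = ∑ y ∈ Finset.univ.image e, C y * g y n := by
        rw [Finset.sum_image fun i _ j _ h => hinj h]
        refine Finset.sum_congr rfl fun i _ => ?_
        rw [hC, hinj.extend_apply]
      rw [h1]
      refine Finset.sum_subset ?_ ?_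
      · intro y hy
        obtain ⟨i, _, rfl⟩ := Finset.mem_image.1 hy
        exact hmem i
      · intro y _ hy
        rw [hC, Function.extend_apply', Pi.zero_apply, zero_mul]
        rintro ⟨i, rfl⟩
        exact hy (Finset.mem_image_of_mem _ (Finset.mem_univ i))
    have hrec : IsRec fun n => ∑ y ∈ rect, C y * g y n := by
      apply IsRec.of_isRationalSeries
      convert hrat using 1
      ext n
      rw [coeff_mk, ← hsum, map_sum]
      refine Finset.sum_congr rfl fun i _ => ?_
      rw [coeff_smul, coeff_mk, smul_eq_mul]
    have hJ1 : ∀ j ∈ J, 1 ≤ j := by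
      intro j hj
      obtain ⟨i, _, rfl⟩ := Finset.mem_image.1 hj
      exact hjj i
    obtain ⟨hQ, hFL⟩ := coef_eq_zero_of_isRec (J := J) (S := S)
      (cQ := fun μ j => C (Sum.inl μ, j)) (cF := fun ℓ j => C (Sum.inr (Sum.inl ℓ), j))
      (cL := fun ℓ j => C (Sum.inr (Sum.inr ℓ), j)) hd hpa ha ha0 hpb hb hb' hpc hc hc0 hJ1 hs
      heps heps2 hlam0 hlam1 (by
        convert hrec using 2 with n
        rw [hrect, Finset.sum_product, Finset.sum_disjSum, Finset.sum_disjSum]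
        congr 1
        rw [← Finset.sum_add_distrib]
        refine Finset.sum_congr rfl fun ℓ _ => ?_
        rw [← Finset.sum_add_distrib]
        rfl)
    have hC0 : ∀ y ∈ rect, C y = 0 := by
      rintro ⟨y, j⟩ hy
      rw [hrect, Finset.mem_product] at hy
      obtain ⟨hy, hj⟩ := hy
      rcases y with μ | ℓ | ℓ
      · rw [Finset.inl_mem_disjSum] at hy
        exact hQ μ hy j hj
      · rw [Finset.inr_mem_disjSum, Finset.inl_mem_disjSum] at hy
        exact (hFL ℓ hy j hj).1
      · rw [Finset.inr_mem_disjSum, Finset.inr_mem_disjSum] at hy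
        exact (hFL ℓ hy j hj).2
    funext i
    have := hC0 _ (hmem i)
    rwa [hC, hinj.extend_apply] at this

end MahlerAlgebraicIndependence

section GenericExponents

open Filter Topology

variable {D : Type*} [Fintype D]

/-- Limit points of the vectors `(e_δ log d_δ - t)_δ` as `t → ∞`, with `e_δ ∈ P ℕ`. -/
def exponentLimits (d : D → ℕ) (P : ℕ) : Set (D → ℝ) :=
  {x | ∀ ε > 0, ∀ B : ℝ, ∃ t ≥ B, ∃ e : D → ℕ, ∀ δ, P ∣ e δ ∧ |e δ * Real.log (d δ) - t - x δ| < ε}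

lemma isClosed_exponentLimits (d : D → ℕ) (P : ℕ) : IsClosed (exponentLimits d P) := by
  rw [← isSeqClosed_iff_isClosed]
  intro u x hu hx ε hε B
  have h1 := Metric.tendsto_nhds.1 hx (ε / 2) (half_pos hε)
  obtain ⟨n, hn⟩ := h1.exists
  obtain ⟨t, ht, e, he⟩ := hu n (ε / 2) (half_pos hε) B
  refine ⟨t, ht, e, fun δ => ⟨(he δ).1, ?_⟩⟩
  have h2 := (dist_le_pi_dist (u n) x δ).trans_lt hn
  rw [Real.dist_eq] at h2
  have h3 := (he δ).2
  calc |e δ * Real.log (d δ) - t - x δ|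
      = |(e δ * Real.log (d δ) - t - u n δ) + (u n δ - x δ)| := by congr 1; ring
    _ ≤ _ := abs_add_le _ _
    _ < ε := by linarith

omit [Fintype D] in
lemma add_mem_exponentLimits {d : D → ℕ} {P : ℕ} {x : D → ℝ} (hx : x ∈ exponentLimits d P)
    {a : D → ℕ} (ha : ∀ δ, P ∣ a δ) {s : ℝ} (hs : 0 ≤ s) :
    (x + fun δ => a δ * Real.log (d δ) - s) ∈ exponentLimits d P := by
  intro ε hε B
  obtain ⟨t, ht, e, he⟩ := hx ε hε B
  refine ⟨t + s, by linarith, fun δ => e δ + a δ, fun δ => ⟨dvd_add (he δ).1 (ha δ), ?_⟩⟩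
  convert (he δ).2 using 2
  rw [Pi.add_apply]
  push_cast; ring

/-- The largest multiple of `P` with `e * log d ≤ n`. -/
def floorExponent (d P n : ℕ) : ℕ := P * ⌊(n : ℝ) / (P * Real.log d)⌋₊

lemma exists_tendsto_floorExponent {d : D → ℕ} (hd : ∀ δ, 2 ≤ d δ) {P : ℕ} (hP : 0 < P) :
    ∃ (x : D → ℝ) (ν : ℕ → ℕ), StrictMono ν ∧
      Tendsto (fun j δ => (floorExponent (d δ) P (ν j) : ℝ) * Real.log (d δ) - ν j) atTop
        (𝓝 x) := by
  have hlog : ∀ δ, 0 < Real.log (d δ) := fun δ => Real.log_pos (by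
    have := hd δ; exact_mod_cast (by omega : 1 < d δ))
  have hmem : ∀ n : ℕ, (fun δ => (floorExponent (d δ) P n : ℝ) * Real.log (d δ) - n) ∈
      Set.pi Set.univ fun δ => Set.Icc (-(P * Real.log (d δ))) 0 := by
    intro n δ _
    have hpos : 0 < P * Real.log (d δ) := mul_pos (by exact_mod_cast hP) (hlog δ)
    have h1 := Nat.floor_le (a := (n : ℝ) / (P * Real.log (d δ))) (by positivity)
    have h2 := Nat.lt_floor_add_one ((n : ℝ) / (P * Real.log (d δ)))
    rw [le_div_iff₀ hpos] at h1
    rw [div_lt_iff₀ hpos] at h2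
    simp only [floorExponent, Nat.cast_mul, Set.mem_Icc]
    constructor <;> nlinarith
  obtain ⟨x, _, ν, hν, hx⟩ := (isCompact_univ_pi fun δ => isCompact_Icc).tendsto_subseq hmem
  exact ⟨x, ν, hν, hx⟩

lemma nonempty_exponentLimits {d : D → ℕ} (hd : ∀ δ, 2 ≤ d δ) {P : ℕ} (hP : 0 < P) :
    (exponentLimits d P).Nonempty := by
  obtain ⟨x, ν, hν, hx⟩ := exists_tendsto_floorExponent hd hP
  refine ⟨x, fun ε hε B => ?_⟩
  obtain ⟨j, hj1, hj2⟩ := ((Metric.tendsto_nhds.1 hx ε hε).and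
    ((tendsto_natCast_atTop_atTop.comp hν.tendsto_atTop).eventually_ge_atTop B)).exists
  refine ⟨ν j, hj2, fun δ => floorExponent (d δ) P (ν j), fun δ => ⟨dvd_mul_right _ _, ?_⟩⟩
  exact (dist_le_pi_dist _ x δ).trans_lt hj1

/-- Arbitrarily small shifts with pairwise distinct coordinates. -/
lemma exists_small_shift {d : D → ℕ} (hd : ∀ δ, 2 ≤ d δ)
    (hind : ∀ δ δ', δ ≠ δ' → ∀ a b : ℕ, 0 < a → 0 < b → d δ ^ a ≠ d δ' ^ b)
    {P : ℕ} (hP : 0 < P) {η : ℝ} (hη : 0 < η) :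
    ∃ (a : D → ℕ) (s : ℝ), (∀ δ, P ∣ a δ) ∧ 0 ≤ s ∧
      (∀ δ, |a δ * Real.log (d δ) - s| < η) ∧
      Function.Injective fun δ => a δ * Real.log (d δ) - s := by
  obtain ⟨x, ν, hν, hx⟩ := exists_tendsto_floorExponent hd hP
  obtain ⟨N, hN⟩ := Metric.cauchySeq_iff.1 hx.cauchySeq (min η 1) (lt_min hη one_pos)
  have h1 := hN (N + 1) (Nat.le_succ N) N le_rfl
  have hlt : ν N < ν (N + 1) := hν (Nat.lt_succ_self N)
  have hmono : ∀ δ, floorExponent (d δ) P (ν N) ≤ floorExponent (d δ) P (ν (N + 1)) := by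
    intro δ
    refine Nat.mul_le_mul_left P (Nat.floor_mono ?_)
    gcongr
  set a : D → ℕ := fun δ => floorExponent (d δ) P (ν (N + 1)) - floorExponent (d δ) P (ν N) with ha
  have hacast : ∀ δ, (a δ : ℝ) =
      floorExponent (d δ) P (ν (N + 1)) - floorExponent (d δ) P (ν N) := fun δ =>
    Nat.cast_sub (hmono δ)
  set s : ℝ := (ν (N + 1) : ℝ) - ν N with hs
  have hs1 : 1 ≤ s := by
    have : (ν N : ℝ) + 1 ≤ ν (N + 1) := by exact_mod_cast hlt
    linarith
  have hsmall : ∀ δ, |a δ * Real.log (d δ) - s| < min η 1 := by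
    intro δ
    refine lt_of_eq_of_lt ?_ ((dist_le_pi_dist _ _ δ).trans_lt h1)
    rw [Real.dist_eq, hacast]
    congr 1; ring
  have hapos : ∀ δ, 0 < a δ := by
    intro δ
    by_contra h
    have h0 : a δ = 0 := by omega
    have := (hsmall δ).trans_le (min_le_right _ _)
    rw [h0, Nat.cast_zero, zero_mul, zero_sub, abs_neg, abs_of_pos (by linarith)] at this
    linarith
  refine ⟨a, s, fun δ => Nat.dvd_sub (dvd_mul_right _ _) (dvd_mul_right _ _), by linarith,
    fun δ => (hsmall δ).trans_le (min_le_left _ _), fun δ δ' h => ?_⟩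
  by_contra hne
  apply hind δ δ' hne (a δ) (a δ') (hapos δ) (hapos δ')
  have h2 : (a δ : ℝ) * Real.log (d δ) = a δ' * Real.log (d δ') := by
    simpa using h
  rw [← Real.log_pow, ← Real.log_pow] at h2
  have hp : ∀ δ, (0 : ℝ) < (d δ : ℝ) ^ a δ := fun δ => by have := hd δ; positivity
  have h3 := Real.log_injOn_pos (hp δ) (hp δ') h2
  exact_mod_cast h3

lemma eq_zero_of_forall_sum_mul_pow_eq_zero {c v : D → ℝ} (hv : Function.Injective v)
    (h : ∀ i < Fintype.card D, ∑ δ, c δ * v δ ^ i = 0) : c = 0 := by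
  set E := Fintype.equivFin D
  have h1 : (fun k => c (E.symm k)) = 0 := by
    refine Matrix.eq_zero_of_forall_pow_sum_mul_pow_eq_zero (f := fun k => v (E.symm k))
      (hv.comp E.symm.injective) fun i => ?_
    rw [← h i i.2]
    exact Fintype.sum_equiv E.symm _ _ fun _ => rfl
  funext δ
  simpa using congrFun h1 (E δ)

/-- Simultaneous approximation: there are exponents `e_δ`, divisible by `P`, such that the powers
`d_δ ^ e_δ` have limiting ratios which are linearly independent over `ℤ`. -/
theorem exists_generic_exponents {d : D → ℕ} (hd : ∀ δ, 2 ≤ d δ)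
    (hind : ∀ δ δ', δ ≠ δ' → ∀ a b : ℕ, 0 < a → 0 < b → d δ ^ a ≠ d δ' ^ b)
    {P : ℕ} (hP : 0 < P) :
    ∃ (e : ℕ → D → ℕ) (T : ℕ → ℝ) (θ : D → ℝ), Tendsto T atTop atTop ∧ (∀ δ, 0 < θ δ) ∧
      (∀ c : D → ℤ, ∑ δ, c δ * θ δ = 0 → c = 0) ∧ (∀ j δ, P ∣ e j δ) ∧
      ∀ δ, Tendsto (fun j => (d δ : ℝ) ^ e j δ / T j) atTop (𝓝 (θ δ)) := by
  set L := exponentLimits d P with hL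
  have hLne : Nonempty L := (nonempty_exponentLimits hd hP).to_subtype
  have hLc : CompleteSpace L := (isClosed_exponentLimits d P).completeSpace_coe
  set U : {c : D → ℤ // c ≠ 0} → Set L := fun c => {x | ∑ δ, c.1 δ * Real.exp (x.1 δ) ≠ 0} with hU
  have hUo : ∀ c, IsOpen (U c) := by
    intro c
    exact isOpen_ne_fun (continuous_finsetSum _ fun δ _ => continuous_const.mul
      (Real.continuous_exp.comp ((continuous_apply δ).comp continuous_subtype_val)))
      continuous_const
  have hUd : ∀ c, Dense (U c) := by
    intro c
    rw [Metric.dense_iff]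
    intro x r hr
    set n := Fintype.card D with hn
    obtain ⟨a, s, haP, hs, hsmall, hinj⟩ := exists_small_shift hd hind hP
      (η := r / (n + 1)) (by positivity)
    set y : D → ℝ := fun δ => a δ * Real.log (d δ) - s with hy
    have hmem : ∀ i : ℕ, x.1 + (i : ℝ) • y ∈ L := by
      intro i
      induction i with
      | zero => simp
      | succ i ih =>
        have := add_mem_exponentLimits ih haP hs
        convert this using 1
        rw [Nat.cast_succ, add_smul, one_smul, add_assoc]
    by_contra hcon
    apply c.2
    have h0 : ∀ i < n, ∑ δ, (c.1 δ * Real.exp (x.1 δ)) * Real.exp (y δ) ^ i = 0 := by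
      intro i hi
      by_contra h
      apply hcon
      refine ⟨⟨_, hmem i⟩, ?_, ?_⟩
      · rw [Metric.mem_ball, Subtype.dist_eq, dist_pi_lt_iff hr]
        intro δ
        rw [Real.dist_eq]
        change |x.1 δ + i * y δ - x.1 δ| < r
        rw [add_sub_cancel_left, abs_mul, Nat.abs_cast]
        have h1 := hsmall δ
        have h2 : (i : ℝ) ≤ n := by exact_mod_cast hi.le
        rw [lt_div_iff₀ (by positivity)] at h1
        have h3 : 0 ≤ |y δ| := abs_nonneg _
        change |y δ| * (n + 1) < r at h1
        nlinarith
      · change ∑ δ, (c.1 δ : ℝ) * Real.exp (x.1 δ + i * y δ) ≠ 0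
        simpa only [Real.exp_add, Real.exp_nat_mul, mul_assoc] using h
    have hc := eq_zero_of_forall_sum_mul_pow_eq_zero
      (Real.exp_injective.comp hinj) h0
    funext δ
    have := congrFun hc δ
    simpa [Real.exp_ne_zero] using this
  obtain ⟨x, hx⟩ := (dense_iInter_of_isOpen hUo hUd).nonempty
  rw [Set.mem_iInter] at hx
  have hex : ∀ j : ℕ, ∃ t ≥ (j : ℝ), ∃ e : D → ℕ, ∀ δ, P ∣ e δ ∧
      |e δ * Real.log (d δ) - t - x.1 δ| < 1 / (j + 1) := fun j =>
    x.2 (1 / (j + 1)) (by positivity) j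
  choose t ht e he using hex
  refine ⟨e, fun j => Real.exp (t j), fun δ => Real.exp (x.1 δ),
    Real.tendsto_exp_atTop.comp (tendsto_atTop_mono ht tendsto_natCast_atTop_atTop),
    fun δ => Real.exp_pos _, fun c hc => ?_, fun j δ => (he j δ).1, fun δ => ?_⟩
  · by_contra h
    exact hx ⟨c, h⟩ hc
  · have h1 : Tendsto (fun j => (e j δ : ℝ) * Real.log (d δ) - t j) atTop (𝓝 (x.1 δ)) := by
      rw [tendsto_iff_dist_tendsto_zero]
      exact squeeze_zero (fun _ => dist_nonneg) (fun j => (he j δ).2.le)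
        tendsto_one_div_add_atTop_nhds_zero_nat
    refine ((Real.continuous_exp.tendsto _).comp h1).congr fun j => ?_
    have hdp : (0 : ℝ) < d δ := by have := hd δ; positivity
    rw [Function.comp, Real.exp_sub, Real.exp_nat_mul, Real.exp_log hdp]

end GenericExponents

section CrossVanishing

open PowerSeries Finset

section Blocks

variable {D I : Type*} [Fintype D] [Fintype I] [DecidableEq D] {R S : Type*} [CommSemiring R]
  [CommSemiring S] (π : I → D)

/-- The part of the monomial with exponent `β` which involves the variables lying over `δ`. -/
def blockMonomial (x : R) (f : I → R) (δ : D) (β : D ⊕ I →₀ ℕ) : R :=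
  x ^ β (.inl δ) * ∏ i with π i = δ, f i ^ β (.inr i)

omit [Fintype D] in
lemma map_blockMonomial (φ : R →+* S) (x : R) (f : I → R) (δ : D) (β : D ⊕ I →₀ ℕ) :
    φ (blockMonomial π x f δ β) = blockMonomial π (φ x) (fun i => φ (f i)) δ β := by
  simp [blockMonomial]

lemma eval_eq_sum_prod_blockMonomial (P : MvPolynomial (D ⊕ I) R) (y : D → R) (u : I → R) :
    MvPolynomial.eval (Sum.elim y u) P =
      ∑ β ∈ P.support, P.coeff β * ∏ δ, blockMonomial π (y δ) u δ β := by
  rw [MvPolynomial.eval_eq']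
  refine Finset.sum_congr rfl fun β _ => ?_
  congr 1
  simp only [blockMonomial, Finset.prod_mul_distrib, Fintype.prod_sum_type, Sum.elim_inl,
    Sum.elim_inr]
  congr 1
  exact (Finset.prod_fiberwise univ π _).symm

/-- The coefficients of the formal power series in the variables `z δ` obtained by substituting
`z δ` and `f i (z (π i))` into `P`. -/
def crossCoeff (f : I → ℂ⟦X⟧) (P : MvPolynomial (D ⊕ I) ℂ) (l : D → ℕ) : ℂ :=
  ∑ β ∈ P.support, P.coeff β * ∏ δ, coeff (l δ) (blockMonomial π X f δ β)

end Blocks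

lemma exists_finsupp_dual {B : Type*} [DecidableEq B] {h : B → ℕ → ℂ} (hh : LinearIndependent ℂ h)
    (s : Finset B) (b : B) :
    ∃ w : ℕ →₀ ℂ, ∀ b' ∈ s, ∑ n ∈ w.support, w n * h b' n = if b' = b then 1 else 0 := by
  set Φ : (ℕ →₀ ℂ) →ₗ[ℂ] (s → ℂ) :=
    LinearMap.pi fun b' => Finsupp.linearCombination ℂ (h b'.1) with hΦ
  have hsurj : LinearMap.range Φ = ⊤ := by
    by_contra hne
    obtain ⟨ψ, hψ, hle⟩ := Submodule.exists_le_ker_of_lt_top _ (lt_top_iff_ne_top.2 hne)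
    apply hψ
    have h1 : ∀ n, ∑ b' : s, ψ (Pi.single b' 1) * h b' n = 0 := by
      intro n
      have h2 : ψ (Φ (Finsupp.single n 1)) = 0 := hle ⟨_, rfl⟩
      rw [LinearMap.pi_apply_eq_sum_univ ψ] at h2
      rw [← h2]
      refine Finset.sum_congr rfl fun b' _ => ?_
      simp only [hΦ, LinearMap.pi_apply, Finsupp.linearCombination_single, smul_eq_mul, one_mul,
        mul_comm (h b' n)]
      congr 2
      ext c
      simp [Pi.single_apply, eq_comm]
    have h3 := Fintype.linearIndependent_iff.1 (hh.comp (fun b' : s => b'.1)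
      Subtype.val_injective) (fun b' => ψ (Pi.single b' 1)) (by
        funext n
        simpa using h1 n)
    refine LinearMap.pi_ext' fun b' => LinearMap.ext_ring ?_
    simpa using h3 b'
  obtain ⟨w, hw⟩ := LinearMap.range_eq_top.1 hsurj fun b' => if b'.1 = b then 1 else 0
  refine ⟨w, fun b' hb' => ?_⟩
  have := congrFun hw ⟨b', hb'⟩
  simpa [hΦ, Finsupp.linearCombination_apply, Finsupp.sum] using this

section Nonvanishing

variable {D I : Type*} [Fintype D] [Fintype I] [DecidableEq D] {π : I → D}
  {f : I → ℂ⟦X⟧}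

/-- The exponents of the variables lying over `δ`. -/
def blockExponent (π : I → D) (δ : D) (β : D ⊕ I →₀ ℕ) : {i // π i = δ} ⊕ Unit →₀ ℕ :=
  Finsupp.equivFunOnFinite.symm (Sum.elim (fun i => β (.inr i.1)) fun _ => β (.inl δ))

omit [Fintype D] in
lemma blockMonomial_eq_prod_pow (δ : D) (β : D ⊕ I →₀ ℕ) :
    blockMonomial π X f δ β = (blockExponent π δ β).prod fun v n =>
      (Sum.elim (fun i : {i // π i = δ} => f i) (fun _ : Unit => X) v) ^ n := by
  rw [Finsupp.prod_fintype _ _ (by simp), Fintype.prod_sum_type]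
  simp only [blockExponent, blockMonomial, Finsupp.equivFunOnFinite_symm_apply_apply, Sum.elim_inl,
    Sum.elim_inr, univ_unique, prod_singleton, mul_comm]
  congr 1
  exact (Finset.prod_subtype _ (by simp) (fun i => f i ^ β (.inr i)))

theorem exists_crossCoeff_ne_zero
    (hf : ∀ δ, AlgebraicIndependent ℂ
      (Sum.elim (fun i : {i // π i = δ} => f i) (fun _ : Unit => (X : ℂ⟦X⟧))))
    {P : MvPolynomial (D ⊕ I) ℂ} (hP : P ≠ 0) : ∃ l, crossCoeff π f P l ≠ 0 := by
  by_contra! hcon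
  obtain ⟨β₀, hβ₀⟩ := MvPolynomial.ne_zero_iff.1 hP
  have hlin : ∀ δ, LinearIndependent ℂ
      (fun (e : {i // π i = δ} ⊕ Unit →₀ ℕ) (n : ℕ) => coeff n (e.prod fun v n =>
        (Sum.elim (fun i : {i // π i = δ} => f i) (fun _ : Unit => (X : ℂ⟦X⟧)) v) ^ n)) := by
    intro δ
    have h1 := (MvPolynomial.basisMonomials ({i // π i = δ} ⊕ Unit) ℂ).linearIndependent.map'
      (MvPolynomial.aeval (R := ℂ) (Sum.elim (fun i : {i // π i = δ} => f i)
        (fun _ : Unit => (X : ℂ⟦X⟧)))).toLinearMap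
      (LinearMap.ker_eq_bot.2 (hf δ))
    have h2 := h1.map' (LinearMap.pi fun n => PowerSeries.coeff (R := ℂ) n)
      (LinearMap.ker_eq_bot.2 fun x y hxy => PowerSeries.ext fun n => congrFun hxy n)
    refine Eq.mp (congrArg (fun v => LinearIndependent ℂ v) ?_) h2
    funext e n
    simp [MvPolynomial.aeval_monomial]
  choose w hw using fun δ => exists_finsupp_dual (hlin δ) (P.support.image (blockExponent π δ))
    (blockExponent π δ β₀)
  apply hβ₀
  have h0 : ∑ l ∈ Fintype.piFinset fun δ => (w δ).support,
      (∏ δ, w δ (l δ)) * crossCoeff π f P l = 0 := by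
    simp [hcon]
  rw [← h0]
  simp only [crossCoeff, Finset.mul_sum]
  rw [Finset.sum_comm]
  have h1 : ∀ β ∈ P.support, ∑ l ∈ Fintype.piFinset fun δ => (w δ).support,
      (∏ δ, w δ (l δ)) * (P.coeff β * ∏ δ, coeff (l δ) (blockMonomial π X f δ β)) =
      if β = β₀ then P.coeff β else 0 := by
    intro β hβ
    have h2 : ∏ δ, ∑ n ∈ (w δ).support, w δ n * coeff n (blockMonomial π X f δ β) =
        if β = β₀ then 1 else 0 := by
      have h3 : ∀ δ, ∑ n ∈ (w δ).support, w δ n * coeff n (blockMonomial π X f δ β) =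
          if blockExponent π δ β = blockExponent π δ β₀ then 1 else 0 := by
        intro δ
        rw [← hw δ _ (Finset.mem_image_of_mem _ hβ), blockMonomial_eq_prod_pow]
      simp only [h3]
      split_ifs with h
      · simp [h]
      · obtain ⟨δ, hδ⟩ : ∃ δ, blockExponent π δ β ≠ blockExponent π δ β₀ := by
          by_contra! h4
          apply h
          ext v
          rcases v with δ | i
          · simpa [blockExponent] using DFunLike.congr_fun (h4 δ) (.inr ())
          · simpa [blockExponent] using DFunLike.congr_fun (h4 (π i)) (.inl ⟨i, rfl⟩)
        exact Finset.prod_eq_zero (Finset.mem_univ δ) (if_neg hδ)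
    rw [Finset.prod_univ_sum] at h2
    calc _ = P.coeff β * ∑ l ∈ Fintype.piFinset fun δ => (w δ).support,
          ∏ δ, w δ (l δ) * coeff (l δ) (blockMonomial π X f δ β) := by
          rw [Finset.mul_sum]
          refine Finset.sum_congr rfl fun l _ => ?_
          rw [Finset.prod_mul_distrib]; ring
      _ = _ := by rw [h2]; split_ifs <;> simp
  rw [Finset.sum_congr rfl h1]
  simp [hβ₀]

end Nonvanishing

end CrossVanishing

section CrossSubstitution

open PowerSeries Finset Filter Topology

lemma exists_norm_eval_sub_le {V : Type*} (P : MvPolynomial V ℂ) (R : ℝ) :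
    ∃ C, 0 ≤ C ∧ ∀ (x y : V → ℂ) (w : ℝ), (∀ v, ‖x v‖ ≤ R) → (∀ v, ‖y v‖ ≤ R) →
      (∀ v, ‖x v - y v‖ ≤ w) → 0 ≤ w → ‖MvPolynomial.eval y P‖ ≤ C ∧
        ‖MvPolynomial.eval x P - MvPolynomial.eval y P‖ ≤ C * w := by
  induction P using MvPolynomial.induction_on with
  | C a => exact ⟨‖a‖, norm_nonneg a, fun x y w _ _ _ hw => by simpa using by positivity⟩
  | add p q hp hq =>
    obtain ⟨C, hC, h⟩ := hp
    obtain ⟨C', hC', h'⟩ := hq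
    refine ⟨C + C', by positivity, fun x y w hx hy hxy hw => ?_⟩
    obtain ⟨h1, h2⟩ := h x y w hx hy hxy hw
    obtain ⟨h3, h4⟩ := h' x y w hx hy hxy hw
    refine ⟨by simpa using norm_add_le_of_le h1 h3, ?_⟩
    rw [map_add, map_add, add_sub_add_comm, add_mul]
    exact norm_add_le_of_le h2 h4
  | mul_X p v hp =>
    obtain ⟨C, hC, h⟩ := hp
    refine ⟨C * (|R| + 1), by positivity, fun x y w hx hy hxy hw => ?_⟩
    obtain ⟨h1, h2⟩ := h x y w hx hy hxy hw
    have hxR := (hx v).trans (le_abs_self R)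
    have hyR := (hy v).trans (le_abs_self R)
    simp only [map_mul, MvPolynomial.eval_X]
    constructor
    · rw [norm_mul]
      exact mul_le_mul h1 (hyR.trans (by linarith)) (norm_nonneg _) hC
    · rw [show MvPolynomial.eval x p * x v - MvPolynomial.eval y p * y v =
        (MvPolynomial.eval x p - MvPolynomial.eval y p) * x v +
          MvPolynomial.eval y p * (x v - y v) by ring]
      refine (norm_add_le _ _).trans ?_
      rw [norm_mul, norm_mul]
      have h3 := mul_le_mul h2 hxR (norm_nonneg _) (by positivity)
      have h4 := mul_le_mul h1 (hxy v) (norm_nonneg _) hC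
      linarith

lemma tendsto_pow_div_pow_zero {a : ℝ} (h0 : 0 < a) (h1 : a < 1) {E E' : ℕ → ℕ} {T : ℕ → ℝ}
    (hT : Tendsto T atTop atTop) {e e' : ℝ} (hE : Tendsto (fun j => (E j : ℝ) / T j) atTop (𝓝 e))
    (hE' : Tendsto (fun j => (E' j : ℝ) / T j) atTop (𝓝 e')) (hlt : e' < e) :
    Tendsto (fun j => a ^ E j / a ^ E' j) atTop (𝓝 0) := by
  have h2 : Tendsto (fun j => T j * ((E j : ℝ) / T j - (E' j : ℝ) / T j)) atTop atTop :=
    hT.atTop_mul_pos (sub_pos.2 hlt) (hE.sub hE')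
  refine ((tendsto_rpow_atTop_of_base_lt_one a (by linarith) h1).comp h2).congr' ?_
  filter_upwards [hT.eventually_gt_atTop 0] with j hj
  rw [Function.comp, ← sub_div, mul_div_cancel₀ _ hj.ne', Real.rpow_sub h0, Real.rpow_natCast,
    Real.rpow_natCast]

section

variable {D I : Type*} [Fintype D] [Fintype I] [DecidableEq D] {π : I → D} {f : I → ℂ⟦X⟧}

omit [Fintype D] in
lemma coeff_blockMonomial_trunc {M n : ℕ} (hn : n < M) (δ : D) (β : D ⊕ I →₀ ℕ) :
    (blockMonomial π Polynomial.X (fun i => trunc M (f i)) δ β).coeff n =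
      coeff n (blockMonomial π X f δ β) := by
  rw [← Polynomial.coeff_coe]
  have h1 : ∀ i, Ideal.Quotient.mk (Ideal.span {(X : ℂ⟦X⟧) ^ M}) (trunc M (f i) : ℂ⟦X⟧) =
      Ideal.Quotient.mk (Ideal.span {(X : ℂ⟦X⟧) ^ M}) (f i) := by
    intro i
    rw [Ideal.Quotient.mk_eq_mk_iff_sub_mem, Ideal.mem_span_singleton, X_pow_dvd_iff]
    intro m hm
    rw [map_sub, coeff_coe_trunc_of_lt hm, sub_self]
  have h2 := map_blockMonomial π (Polynomial.coeToPowerSeries.ringHom (R := ℂ)) Polynomial.X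
    (fun i => trunc M (f i)) δ β
  simp only [Polynomial.coeToPowerSeries.ringHom_apply, Polynomial.coe_X] at h2
  have h3 : (X : ℂ⟦X⟧) ^ M ∣
      (blockMonomial π Polynomial.X (fun i => trunc M (f i)) δ β : Polynomial ℂ) -
        blockMonomial π X f δ β := by
    rw [← Ideal.mem_span_singleton, ← Ideal.Quotient.mk_eq_mk_iff_sub_mem, h2, map_blockMonomial,
      map_blockMonomial]
    simp only [h1]
  rw [← sub_eq_zero, ← map_sub]
  exact X_pow_dvd_iff.1 h3 n hn

lemma exists_expansion (π : I → D) (f : I → ℂ⟦X⟧) (P : MvPolynomial (D ⊕ I) ℂ) (M : ℕ) :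
    ∃ (Λ : Finset (D → ℕ)) (g : (D → ℕ) → ℂ), (∀ y : D → ℂ,
      MvPolynomial.eval (Sum.elim y fun i => ∑ n ∈ range M, coeff n (f i) * y (π i) ^ n) P =
        ∑ l ∈ Λ, g l * ∏ δ, y δ ^ l δ) ∧
      ∀ l : D → ℕ, (∀ δ, l δ < M) → l ∈ Λ ∧ g l = crossCoeff π f P l := by
  set q : D → (D ⊕ I →₀ ℕ) → Polynomial ℂ :=
    fun δ β => blockMonomial π Polynomial.X (fun i => trunc M (f i)) δ β with hq
  obtain ⟨R, hRM, hR⟩ : ∃ R, M ≤ R ∧ ∀ δ, ∀ β ∈ P.support, (q δ β).natDegree < R := by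
    refine ⟨M + ∑ δ, ∑ β ∈ P.support, ((q δ β).natDegree + 1), by omega, fun δ β hβ => ?_⟩
    have h1 := Finset.single_le_sum (f := fun δ => ∑ β ∈ P.support, ((q δ β).natDegree + 1))
      (fun _ _ => Nat.zero_le _) (Finset.mem_univ δ)
    have h2 := Finset.single_le_sum (f := fun β => (q δ β).natDegree + 1)
      (fun _ _ => Nat.zero_le _) hβ
    omega
  refine ⟨Fintype.piFinset fun _ => range R,
    fun l => ∑ β ∈ P.support, P.coeff β * ∏ δ, (q δ β).coeff (l δ), fun y => ?_, fun l hl => ⟨?_, ?_⟩⟩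
  · rw [eval_eq_sum_prod_blockMonomial π]
    simp only [Finset.sum_mul]
    rw [Finset.sum_comm]
    refine Finset.sum_congr rfl fun β hβ => ?_
    have h1 : ∀ δ, blockMonomial π (y δ) (fun i => ∑ n ∈ range M, coeff n (f i) * y (π i) ^ n) δ β =
        ∑ n ∈ range R, (q δ β).coeff n * y δ ^ n := by
      intro δ
      rw [← Polynomial.eval_eq_sum_range' (hR δ β hβ), hq]
      have h2 := map_blockMonomial π (Polynomial.evalRingHom (y δ)) Polynomial.X
        (fun i => trunc M (f i)) δ β
      simp only [Polynomial.coe_evalRingHom, Polynomial.eval_X] at h2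
      rw [h2]
      unfold blockMonomial
      congr 1
      refine Finset.prod_congr rfl fun i hi => ?_
      dsimp only
      rw [(Finset.mem_filter.1 hi).2, Polynomial.eval, eval₂_trunc_eq_sum_range]
      simp
    simp only [h1]
    rw [Finset.prod_univ_sum, Finset.mul_sum]
    refine Finset.sum_congr rfl fun l _ => ?_
    rw [Finset.prod_mul_distrib, mul_assoc]
  · simp only [Fintype.mem_piFinset, Finset.mem_range]
    exact fun δ => (hl δ).trans_le hRM
  · simp only [crossCoeff, hq, coeff_blockMonomial_trunc (hl _)]

end

end CrossSubstitution

section CrossIndependence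

open PowerSeries Finset Filter Topology

variable {D I : Type*} [Fintype D] [Fintype I] [DecidableEq D] {π : I → D} {f : I → ℂ⟦X⟧}

omit [DecidableEq D] in
lemma exists_min_weight {θ : D → ℝ} (hθ : ∀ δ, 0 < θ δ)
    (hind : ∀ c : D → ℤ, ∑ δ, c δ * θ δ = 0 → c = 0) {p : (D → ℕ) → Prop} (hp : ∃ l, p l) :
    ∃ l, p l ∧ ∀ l', p l' → l' ≠ l → ∑ δ, l δ * θ δ < ∑ δ, l' δ * θ δ := by
  obtain ⟨l₁, hl₁⟩ := hp
  set W : (D → ℕ) → ℝ := fun l => ∑ δ, l δ * θ δ with hW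
  have hfin : {l | p l ∧ W l ≤ W l₁}.Finite := by
    refine (Set.Finite.pi' fun δ => Set.finite_Iic ⌊W l₁ / θ δ⌋₊).subset fun l hl δ => ?_
    rw [Set.mem_Iic]
    refine Nat.le_floor ((le_div_iff₀ (hθ δ)).2 (le_trans ?_ hl.2))
    exact Finset.single_le_sum (f := fun δ => (l δ : ℝ) * θ δ)
      (fun δ _ => mul_nonneg (Nat.cast_nonneg _) (hθ δ).le) (Finset.mem_univ δ)
  obtain ⟨l, hl, hmin⟩ := Set.exists_min_image _ W hfin ⟨l₁, hl₁, le_rfl⟩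
  refine ⟨l, hl.1, fun l' hl' hne => ?_⟩
  change W l < W l'
  have hle : W l ≤ W l' := by
    by_contra! h
    exact absurd (hmin l' ⟨hl', h.le.trans hl.2⟩) (not_le.2 h)
  refine lt_of_le_of_ne hle fun h => hne ?_
  have h1 := hind (fun δ => (l' δ : ℤ) - l δ) (by
    simp only [Int.cast_sub, Int.cast_natCast, sub_mul, Finset.sum_sub_distrib]
    exact sub_eq_zero.2 h.symm)
  funext δ
  have := congrFun h1 δ
  simp only [Pi.zero_apply] at this
  omega

theorem eventually_eval_ne_zero
    (hf : ∀ δ, AlgebraicIndependent ℂ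
      (Sum.elim (fun i : {i // π i = δ} => f i) (fun _ : Unit => (X : ℂ⟦X⟧))))
    {P : MvPolynomial (D ⊕ I) ℂ} (hP : P ≠ 0) {α : ℂ} (hα0 : 0 < ‖α‖) (hα1 : ‖α‖ < 1)
    {N : ℕ → D → ℕ} {T : ℕ → ℝ} {θ : D → ℝ} (hT : Tendsto T atTop atTop) (hθ : ∀ δ, 0 < θ δ)
    (hind : ∀ c : D → ℤ, ∑ δ, c δ * θ δ = 0 → c = 0)
    (hN : ∀ δ, Tendsto (fun j => (N j δ : ℝ) / T j) atTop (𝓝 (θ δ))) {u : ℕ → I → ℂ}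
    (hu : ∀ i M, ∃ C, ∀ᶠ j in atTop,
      ‖u j i - ∑ n ∈ range M, coeff n (f i) * (α ^ N j (π i)) ^ n‖ ≤
        C * (‖α‖ ^ N j (π i)) ^ M) :
    ∀ᶠ j in atTop, MvPolynomial.eval (Sum.elim (fun δ => α ^ N j δ) (u j)) P ≠ 0 := by
  obtain ⟨l₀, hl₀, hmin⟩ := exists_min_weight hθ hind (exists_crossCoeff_ne_zero hf hP)
  set W : (D → ℕ) → ℝ := fun l => ∑ δ, l δ * θ δ with hW
  have hterm : ∀ (l : D → ℕ) δ, (l δ : ℝ) * θ δ ≤ W l := fun l δ =>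
    Finset.single_le_sum (f := fun δ => (l δ : ℝ) * θ δ)
      (fun δ _ => mul_nonneg (Nat.cast_nonneg _) (hθ δ).le) (Finset.mem_univ δ)
  obtain ⟨M, hM⟩ : ∃ M : ℕ, ∀ δ, W l₀ < M * θ δ := by
    have h1 : ∀ᶠ M : ℕ in atTop, ∀ δ, W l₀ < M * θ δ := by
      rw [eventually_all]
      exact fun δ => (tendsto_natCast_atTop_atTop.atTop_mul_const (hθ δ)).eventually_gt_atTop _
    exact h1.exists
  obtain ⟨Λ, g, hg, hgM⟩ := exists_expansion π f P M
  have hbox : ∀ δ, l₀ δ < M := fun δ => by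
    have := (hterm l₀ δ).trans_lt (hM δ)
    exact_mod_cast lt_of_mul_lt_mul_right this (hθ δ).le
  set m : (D → ℕ) → ℕ → ℂ := fun l j => ∏ δ, (α ^ N j δ) ^ l δ with hm
  have hmnorm : ∀ l j, ‖m l j‖ = ‖α‖ ^ (∑ δ, l δ * N j δ) := by
    intro l j
    simp only [hm, norm_pow, ← pow_mul, Finset.prod_pow_eq_pow_sum, mul_comm]
  have hm0 : ∀ l j, m l j ≠ 0 := fun l j => by
    rw [← norm_pos_iff, hmnorm]; positivity
  have hWt : ∀ l : D → ℕ, Tendsto (fun j => ((∑ δ, l δ * N j δ : ℕ) : ℝ) / T j) atTop (𝓝 (W l)) := by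
    intro l
    have := tendsto_finsetSum Finset.univ fun δ _ => (hN δ).const_mul (l δ : ℝ)
    refine this.congr fun j => ?_
    rw [Nat.cast_sum, Finset.sum_div]
    exact Finset.sum_congr rfl fun δ _ => by rw [Nat.cast_mul, mul_div_assoc]
  -- the truncated point
  set v : ℕ → I → ℂ := fun j i => ∑ n ∈ range M, coeff n (f i) * (α ^ N j (π i)) ^ n with hv
  set ev : (I → ℂ) → ℕ → ℂ := fun z j =>
    MvPolynomial.eval (Sum.elim (fun δ => α ^ N j δ) z) P with hev
  have hmain : Tendsto (fun j => ev (v j) j / m l₀ j) atTop (𝓝 (g l₀)) := by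
    have h1 : ∀ j, ev (v j) j / m l₀ j = ∑ l ∈ Λ, g l * m l j / m l₀ j := fun j => by
      rw [hev]
      dsimp only
      rw [hg, Finset.sum_div]
    simp only [h1]
    have h2 : ∀ l ∈ Λ, Tendsto (fun j => g l * m l j / m l₀ j) atTop
        (𝓝 (if l = l₀ then g l₀ else 0)) := by
      intro l _
      split_ifs with h
      · subst h
        refine tendsto_const_nhds.congr fun j => ?_
        rw [mul_div_cancel_right₀ _ (hm0 l j)]
      · by_cases hgl : g l = 0
        · simp [hgl]
        have hlt : W l₀ < W l := by
          by_cases hb : ∀ δ, l δ < M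
          · exact hmin l (by rwa [← (hgM l hb).2]) h
          · push Not at hb
            obtain ⟨δ, hδ⟩ := hb
            refine (hM δ).trans_le (le_trans ?_ (hterm l δ))
            exact mul_le_mul_of_nonneg_right (by exact_mod_cast hδ) (hθ δ).le
        have h3 := (tendsto_pow_div_pow_zero hα0 hα1 hT (hWt l) (hWt l₀) hlt).const_mul ‖g l‖
        rw [mul_zero] at h3
        rw [tendsto_zero_iff_norm_tendsto_zero]
        refine h3.congr fun j => ?_
        rw [norm_div, norm_mul, hmnorm, hmnorm, mul_div_assoc]
    have h3 := tendsto_finsetSum Λ h2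
    rwa [Finset.sum_ite_eq' Λ l₀, if_pos (hgM l₀ hbox).1] at h3
  choose C hC using fun i => hu i M
  choose C0 hC0 using fun i => hu i 0
  set R : ℝ := 1 + ∑ i, (|C0 i| + ∑ n ∈ range M, ‖coeff n (f i)‖) with hR
  have hle1 : ∀ n : ℕ, ‖α‖ ^ n ≤ 1 := fun n => pow_le_one₀ hα0.le hα1.le
  have hRi : ∀ i, |C0 i| + ∑ n ∈ range M, ‖coeff n (f i)‖ ≤ R := fun i => by
    have := Finset.single_le_sum (f := fun i => |C0 i| + ∑ n ∈ range M, ‖coeff n (f i)‖)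
      (fun i _ => by positivity) (Finset.mem_univ i)
    linarith
  have hR1 : 1 ≤ R := by
    have : 0 ≤ ∑ i, (|C0 i| + ∑ n ∈ range M, ‖coeff n (f i)‖) := by positivity
    linarith
  obtain ⟨K, hK0, hK⟩ := exists_norm_eval_sub_le P R
  set w : ℕ → ℝ := fun j => ∑ i, |C i| * (‖α‖ ^ N j (π i)) ^ M with hw
  have herr : ∀ᶠ j in atTop, ‖ev (u j) j - ev (v j) j‖ ≤ K * w j := by
    filter_upwards [eventually_all.2 hC, eventually_all.2 hC0] with j hj hj0
    have hwi : ∀ i, |C i| * (‖α‖ ^ N j (π i)) ^ M ≤ w j := fun i =>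
      Finset.single_le_sum (f := fun i => |C i| * (‖α‖ ^ N j (π i)) ^ M)
        (fun i _ => by positivity) (Finset.mem_univ i)
    have hw0 : 0 ≤ w j := by positivity
    refine (hK _ _ (w j) ?_ ?_ ?_ hw0).2
    · rintro (δ | i)
      · simpa using (hle1 _).trans hR1
      · have h1 := hj0 i
        simp only [range_zero, sum_empty, sub_zero, pow_zero, mul_one] at h1
        have h2 : 0 ≤ ∑ n ∈ range M, ‖coeff n (f i)‖ := by positivity
        have := hRi i
        have := le_abs_self (C0 i)
        simp only [Sum.elim_inr]
        linarith
    · rintro (δ | i)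
      · simpa using (hle1 _).trans hR1
      · have h2 : ‖v j i‖ ≤ ∑ n ∈ range M, ‖coeff n (f i)‖ := by
          refine norm_sum_le_of_le _ fun n _ => ?_
          rw [norm_mul, norm_pow, norm_pow]
          exact mul_le_of_le_one_right (norm_nonneg _) (pow_le_one₀ (by positivity) (hle1 _))
        have := hRi i
        have := abs_nonneg (C0 i)
        simp only [Sum.elim_inr]
        linarith
    · rintro (δ | i)
      · simpa using hw0
      · simp only [Sum.elim_inr]
        refine (hj i).trans (le_trans ?_ (hwi i))
        exact mul_le_mul_of_nonneg_right (le_abs_self _) (by positivity)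
  have herr0 : Tendsto (fun j => (ev (u j) j - ev (v j) j) / m l₀ j) atTop (𝓝 0) := by
    have h1 : Tendsto (fun j => K * (w j / ‖m l₀ j‖)) atTop (𝓝 0) := by
      have h2 : ∀ i, Tendsto (fun j => |C i| * ((‖α‖ ^ N j (π i)) ^ M / ‖m l₀ j‖)) atTop
          (𝓝 (|C i| * 0)) := by
        intro i
        refine Tendsto.const_mul _ ?_
        simp only [hmnorm, ← pow_mul]
        refine tendsto_pow_div_pow_zero hα0 hα1 hT (e := M * θ (π i)) ?_ (hWt l₀) (hM (π i))
        refine ((hN (π i)).const_mul (M : ℝ)).congr fun j => ?_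
        rw [Nat.cast_mul]; ring
      have h3 := (tendsto_finsetSum Finset.univ fun i _ => h2 i).const_mul K
      simp only [mul_zero, Finset.sum_const_zero] at h3
      refine h3.congr fun j => ?_
      simp only [hw, Finset.sum_div, mul_div_assoc]
    refine squeeze_zero_norm' ?_ h1
    filter_upwards [herr] with j hj
    rw [norm_div, ← mul_div_assoc]
    gcongr
  have hfinal : Tendsto (fun j => ev (u j) j / m l₀ j) atTop (𝓝 (g l₀)) := by
    have h1 := hmain.add herr0
    rw [add_zero] at h1
    refine h1.congr fun j => ?_
    rw [← add_div, add_sub_cancel]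
  have hg0 : g l₀ ≠ 0 := by rwa [(hgM l₀ hbox).2]
  filter_upwards [hfinal.eventually_ne hg0] with j hj h
  exact hj (by rw [hev]; dsimp only; rw [h, zero_div])

end CrossIndependence

section LiouvilleInequality

open Finset

section Liouville

variable {K : Type*} [Field K] [NumberField K]

lemma one_le_norm_mul_pow_finrank (σ₀ : K →+* ℂ) {v : K} (hv : IsIntegral ℤ v) (hv0 : v ≠ 0)
    {H : ℝ} (hH : 1 ≤ H) (h : ∀ σ : K →+* ℂ, ‖σ v‖ ≤ H) :
    1 ≤ ‖σ₀ v‖ * H ^ Module.finrank ℚ K := by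
  obtain ⟨z, hz⟩ := IsIntegrallyClosed.isIntegral_iff.1 (Algebra.isIntegral_norm ℚ hv)
  have hz0 : z ≠ 0 := by
    rintro rfl
    rw [map_zero] at hz
    exact hv0 (Algebra.norm_eq_zero_iff.1 hz.symm)
  have h1 := Algebra.norm_eq_prod_embeddings ℚ ℂ v
  rw [← hz] at h1
  have h2 : (1 : ℝ) ≤ ‖∏ σ : K →ₐ[ℚ] ℂ, σ v‖ := by
    rw [← h1]
    simp only [eq_intCast, map_intCast, Complex.norm_intCast]
    exact_mod_cast Int.one_le_abs hz0
  refine h2.trans ?_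
  classical
  rw [norm_prod, ← Finset.mul_prod_erase _ _ (Finset.mem_univ σ₀.toRatAlgHom)]
  have h3 : ∏ σ ∈ univ.erase σ₀.toRatAlgHom, ‖σ v‖ ≤ H ^ Module.finrank ℚ K := by
    refine (Finset.prod_le_prod (fun _ _ => norm_nonneg _) fun σ _ => h σ.toRingHom).trans ?_
    rw [Finset.prod_const]
    refine pow_le_pow_right₀ hH ?_
    rw [← AlgHom.card ℚ K ℂ]
    exact Finset.card_le_univ _
  exact mul_le_mul_of_nonneg_left h3 (norm_nonneg _)

theorem exists_one_le_norm_eval_mul {V : Type*} [Fintype V] (σ₀ : K →+* ℂ) (P : MvPolynomial V K)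
    {p : ℕ} (hp : ∀ v, P.degreeOf v ≤ p) :
    ∃ C, 1 ≤ C ∧ ∀ (x : V → K) (Q : ℕ) (B : ℝ), 0 < Q → (Q : ℝ) ≤ B →
      (∀ v, IsIntegral ℤ ((Q : K) * x v)) → (∀ (σ : K →+* ℂ) v, ‖σ (x v)‖ ≤ B) →
      MvPolynomial.eval x P ≠ 0 → 1 ≤ ‖σ₀ (MvPolynomial.eval x P)‖ *
        (C * B ^ (2 * (Fintype.card V * p))) ^ (Module.finrank ℚ K + 1) := by
  classical
  obtain ⟨y, hy0, hy⟩ := exists_integral_multiples ℤ ℚ (P.support.image P.coeff)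
  set n := Fintype.card V * p with hn
  have hdeg : ∀ β ∈ P.support, ∑ v, β v ≤ n := fun β hβ => by
    refine (Finset.sum_le_card_nsmul _ _ p fun v _ =>
      ((MvPolynomial.degreeOf_le_iff.1 (hp v)) β hβ)).trans ?_
    simp [hn]
  set A : ℝ := ∑ σ : K →+* ℂ, ∑ β ∈ P.support, ‖σ (P.coeff β)‖ with hA
  have hA0 : 0 ≤ A := by positivity
  have hy1 : (1 : ℝ) ≤ |(y : ℝ)| := by exact_mod_cast Int.one_le_abs hy0
  refine ⟨|(y : ℝ)| * (1 + A), by nlinarith, fun x Q B hQ hQB hintegral hB hne => ?_⟩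
  have hQ1 : (1 : ℝ) ≤ Q := by exact_mod_cast hQ
  have hB1 : 1 ≤ B := hQ1.trans hQB
  set e := MvPolynomial.eval x P with he
  set v : K := (y : K) * (Q : K) ^ n * e with hv
  have hvint : IsIntegral ℤ v := by
    have : v = ∑ β ∈ P.support, (y : K) * P.coeff β * (Q ^ (n - ∑ v, β v) : ℕ) *
        ∏ v, ((Q : K) * x v) ^ β v := by
      rw [hv, he, MvPolynomial.eval_eq', Finset.mul_sum]
      refine Finset.sum_congr rfl fun β hβ => ?_
      simp only [mul_pow, Finset.prod_mul_distrib, Finset.prod_pow_eq_pow_sum, Nat.cast_pow]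
      rw [← Nat.sub_add_cancel (hdeg β hβ), pow_add, Nat.add_sub_cancel]
      ring
    rw [this]
    refine IsIntegral.sum _ fun β hβ => IsIntegral.mul (IsIntegral.mul ?_ ?_) ?_
    · simpa [zsmul_eq_mul] using hy _ (Finset.mem_image_of_mem _ hβ)
    · exact_mod_cast isIntegral_algebraMap (R := ℤ) (A := K) (x := ((Q ^ (n - ∑ v, β v) : ℕ) : ℤ))
    · exact IsIntegral.prod _ fun v _ => (hintegral v).pow _
  have hv0 : v ≠ 0 := by
    refine mul_ne_zero (mul_ne_zero (by exact_mod_cast hy0) (pow_ne_zero _ ?_)) hne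
    exact_mod_cast hQ.ne'
  have hσ : ∀ σ : K →+* ℂ, ‖σ v‖ = |(y : ℝ)| * (Q : ℝ) ^ n * ‖σ e‖ := fun σ => by
    simp [hv]
  have hσe : ∀ σ : K →+* ℂ, ‖σ e‖ ≤ A * B ^ n := by
    intro σ
    have h1 : σ e = ∑ β ∈ P.support, σ (P.coeff β) * ∏ v, σ (x v) ^ β v := by
      rw [he, MvPolynomial.eval_eq']
      simp
    have h2 : ∑ β ∈ P.support, ‖σ (P.coeff β)‖ ≤ A :=
      Finset.single_le_sum (f := fun σ : K →+* ℂ => ∑ β ∈ P.support, ‖σ (P.coeff β)‖)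
        (fun _ _ => by positivity) (Finset.mem_univ σ)
    rw [h1]
    refine le_trans (norm_sum_le_of_le _ (n := fun β => ‖σ (P.coeff β)‖ * B ^ n) fun β hβ => ?_) ?_
    · rw [norm_mul, norm_prod]
      refine mul_le_mul_of_nonneg_left ?_ (norm_nonneg _)
      simp only [norm_pow]
      refine (Finset.prod_le_prod (fun _ _ => by positivity)
        fun v _ => pow_le_pow_left₀ (norm_nonneg _) (hB σ v) (β v)).trans ?_
      rw [Finset.prod_pow_eq_pow_sum]
      exact pow_le_pow_right₀ hB1 (hdeg β hβ)
    · rw [← Finset.sum_mul]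
      exact mul_le_mul_of_nonneg_right h2 (by positivity)
  have hQn : (Q : ℝ) ^ n ≤ B ^ n := pow_le_pow_left₀ (by positivity) hQB n
  have hBn : 1 ≤ B ^ n := one_le_pow₀ hB1
  have hpow : B ^ (2 * n) = B ^ n * B ^ n := by rw [two_mul, pow_add]
  set H := |(y : ℝ)| * (1 + A) * B ^ (2 * n) with hH
  have hyA : 1 ≤ |(y : ℝ)| * (1 + A) := by nlinarith
  have hH1 : 1 ≤ H := one_le_mul_of_one_le_of_one_le hyA (one_le_pow₀ hB1)
  have h1 := one_le_norm_mul_pow_finrank σ₀ hvint hv0 hH1 (by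
    intro σ
    rw [hσ, hH, hpow]
    calc |(y : ℝ)| * (Q : ℝ) ^ n * ‖σ e‖ ≤ |(y : ℝ)| * B ^ n * ((1 + A) * B ^ n) := by
          gcongr
          exact (hσe σ).trans (by gcongr; linarith)
      _ = _ := by ring)
  refine h1.trans ?_
  rw [pow_succ', ← mul_assoc]
  refine mul_le_mul_of_nonneg_right ?_ (by positivity)
  rw [hσ, mul_comm ‖σ₀ e‖, hH, hpow]
  refine mul_le_mul_of_nonneg_right ?_ (norm_nonneg _)
  calc |(y : ℝ)| * (Q : ℝ) ^ n ≤ |(y : ℝ)| * B ^ n := by gcongr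
    _ = |(y : ℝ)| * 1 * (B ^ n * 1) := by ring
    _ ≤ |(y : ℝ)| * (1 + A) * (B ^ n * B ^ n) := by
      gcongr
      linarith

end Liouville

end LiouvilleInequality

section AuxiliaryPolynomial

open Finset

section Auxiliary

variable {K D I : Type*} [Field K] [Fintype D] [Fintype I]

lemma exists_auxiliary_sum (G : MvPolynomial (D ⊕ I) K) {L B p : ℕ}
    (hG : ∀ i, G.degreeOf (.inr i) ≤ L)
    (hp : B ^ Fintype.card D * (L + 1) ^ Fintype.card I ≤ p) :
    ∃ P : Fin (p + 1) → MvPolynomial (D ⊕ I) K, P ≠ 0 ∧ (∀ j v, (P j).degreeOf v ≤ p) ∧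
      ∀ β, (∀ δ, β (.inl δ) < B * (p + 1)) →
        (∑ j, P j * G ^ (j : ℕ)).coeff β = 0 := by
  classical
  set n := Fintype.card D
  set m := Fintype.card I
  set mon : (D ⊕ I → Fin (p + 1)) → (D ⊕ I →₀ ℕ) :=
    fun e => Finsupp.equivFunOnFinite.symm fun v => (e v : ℕ) with hmon
  have hmoninj : Function.Injective mon := fun e e' h => by
    funext v
    exact Fin.ext (by simpa [mon] using DFunLike.congr_fun h v)
  set toP : (Fin (p + 1) × (D ⊕ I → Fin (p + 1)) → K) → Fin (p + 1) → MvPolynomial (D ⊕ I) K :=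
    fun c j => ∑ e, MvPolynomial.monomial (mon e) (c (j, e)) with htoP
  set ex : (D → Fin (B * (p + 1))) × (I → Fin ((L + 1) * p + 1)) → (D ⊕ I →₀ ℕ) :=
    fun e => Finsupp.equivFunOnFinite.symm
      (Sum.elim (fun δ => (e.1 δ : ℕ)) fun i => (e.2 i : ℕ)) with hex
  let Φ : (Fin (p + 1) × (D ⊕ I → Fin (p + 1)) → K) →ₗ[K]
      ((D → Fin (B * (p + 1))) × (I → Fin ((L + 1) * p + 1)) → K) :=
    { toFun := fun c e => (∑ j, toP c j * G ^ (j : ℕ)).coeff (ex e)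
      map_add' := fun c c' => by
        funext e
        simp [htoP, add_mul, Finset.sum_add_distrib]
      map_smul' := fun a c => by
        funext e
        simp only [htoP, Pi.smul_apply, RingHom.id_apply, ← MvPolynomial.smul_monomial,
          ← Finset.smul_sum, smul_mul_assoc, MvPolynomial.coeff_smul] }
  have hker : LinearMap.ker Φ ≠ ⊥ := by
    refine LinearMap.ker_ne_bot_of_finrank_lt ?_
    simp only [Module.finrank_fintype_fun_eq_card, Fintype.card_prod, Fintype.card_fun,
      Fintype.card_fin, Fintype.card_sum]
    change (B * (p + 1)) ^ n * ((L + 1) * p + 1) ^ m < (p + 1) * (p + 1) ^ (n + m)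
    have h1 : (L + 1) * p + 1 ≤ (L + 1) * (p + 1) := by nlinarith
    calc (B * (p + 1)) ^ n * ((L + 1) * p + 1) ^ m
        ≤ (B * (p + 1)) ^ n * ((L + 1) * (p + 1)) ^ m := by gcongr
      _ = B ^ n * (L + 1) ^ m * (p + 1) ^ (n + m) := by rw [mul_pow, mul_pow, pow_add]; ring
      _ ≤ p * (p + 1) ^ (n + m) := by gcongr
      _ < _ := by gcongr; omega
  obtain ⟨c, hc, hc0⟩ := (Submodule.ne_bot_iff _).1 hker
  have hdegP : ∀ j v, (toP c j).degreeOf v ≤ p := by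
    intro j v
    rw [MvPolynomial.degreeOf_le_iff]
    intro β hβ
    obtain ⟨e, _, he⟩ := Finset.mem_biUnion.1 (MvPolynomial.support_sum hβ)
    have := Finset.mem_singleton.1 (MvPolynomial.support_monomial_subset he)
    subst this
    simpa [mon] using Nat.lt_succ_iff.1 (e v).2
  refine ⟨toP c, ?_, hdegP, fun β hβ => ?_⟩
  · intro h
    apply hc0
    funext ⟨j, e⟩
    have h1 := congrArg (MvPolynomial.coeff (mon e)) (congrFun h j)
    simpa [htoP, MvPolynomial.coeff_sum, MvPolynomial.coeff_monomial, hmoninj.eq_iff] using h1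
  · by_cases hi : ∀ i, β (.inr i) < (L + 1) * p + 1
    · have h1 := congrFun (LinearMap.mem_ker.1 hc) (fun δ => ⟨_, hβ δ⟩, fun i => ⟨_, hi i⟩)
      have h2 : ex (fun δ => ⟨_, hβ δ⟩, fun i => ⟨_, hi i⟩) = β := by
        ext v
        rcases v with δ | i <;> simp [ex]
      change MvPolynomial.coeff (ex _) _ = 0 at h1
      rwa [h2] at h1
    · push Not at hi
      obtain ⟨i, hi⟩ := hi
      by_contra h
      have h1 : (∑ j, toP c j * G ^ (j : ℕ)).degreeOf (.inr i) ≤ (L + 1) * p := by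
        refine (MvPolynomial.degreeOf_sum_le _ _ _).trans (Finset.sup_le fun j _ => ?_)
        refine (MvPolynomial.degreeOf_mul_le _ _ _).trans ?_
        have h2 := MvPolynomial.degreeOf_pow_le (.inr i) G j
        have h3 := hdegP j (.inr i)
        have h4 := hG i
        have h5 : (j : ℕ) ≤ p := Nat.lt_succ_iff.1 j.2
        nlinarith
      have := MvPolynomial.degreeOf_le_iff.1 h1 β (MvPolynomial.mem_support_iff.2 h)
      omega

/-- Multiply every variable of the first kind by a new variable `t`. -/
def scaleVars : MvPolynomial (D ⊕ I) K →ₐ[K] MvPolynomial (Option (D ⊕ I)) K :=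
  MvPolynomial.aeval (Sum.elim (fun δ => MvPolynomial.X (some (.inl δ)) * MvPolynomial.X none)
    fun i => MvPolynomial.X (some (.inr i)))

lemma X_pow_dvd_scaleVars {E : MvPolynomial (D ⊕ I) K} {J : ℕ}
    (hE : ∀ β, (∀ δ, β (.inl δ) < J) → E.coeff β = 0) :
    MvPolynomial.X none ^ J ∣ scaleVars E := by
  rw [scaleVars, MvPolynomial.aeval_def, MvPolynomial.eval₂_eq']
  refine Finset.dvd_sum fun β hβ => dvd_mul_of_dvd_right ?_ _
  obtain ⟨δ, hδ⟩ : ∃ δ, J ≤ β (.inl δ) := by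
    by_contra! h
    exact MvPolynomial.mem_support_iff.1 hβ (hE β h)
  refine dvd_trans ?_ (Finset.dvd_prod_of_mem _ (Finset.mem_univ (Sum.inl δ)))
  rw [Sum.elim_inl, mul_pow]
  exact dvd_mul_of_dvd_right (pow_dvd_pow _ hδ) _

lemma exists_auxiliary_polynomial {G : MvPolynomial (D ⊕ I) K} {L B p : ℕ}
    (hG : ∀ i, G.degreeOf (.inr i) ≤ L) (hG0 : ¬ MvPolynomial.X none ∣ scaleVars G)
    (hp : B ^ Fintype.card D * (L + 1) ^ Fintype.card I ≤ p) :
    ∃ P R : MvPolynomial (D ⊕ I) K, P ≠ 0 ∧ (∀ v, P.degreeOf v ≤ p) ∧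
      MvPolynomial.X none ^ (B * (p + 1)) ∣ scaleVars (P + G * R) := by
  classical
  obtain ⟨P, hP0, hdeg, hcoeff⟩ := exists_auxiliary_sum G hG hp
  obtain ⟨j₀, hj₀, hmin⟩ : ∃ j, P j ≠ 0 ∧ ∀ j' < j, P j' = 0 := by
    have h1 : (univ.filter fun j => P j ≠ 0).Nonempty := by
      obtain ⟨j, hj⟩ := Function.ne_iff.1 hP0
      exact ⟨j, by simpa using hj⟩
    refine ⟨_, (Finset.mem_filter.1 (Finset.min'_mem _ h1)).2, fun j' hj' => ?_⟩
    by_contra h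
    exact absurd (Finset.min'_le _ j' (by simpa using h)) (not_le.2 hj')
  refine ⟨P j₀, ∑ j with j₀ < j, P j * G ^ ((j : ℕ) - j₀ - 1), hj₀, hdeg j₀, ?_⟩
  have hE : ∑ j, P j * G ^ (j : ℕ) =
      G ^ (j₀ : ℕ) * (P j₀ + G * ∑ j with j₀ < j, P j * G ^ ((j : ℕ) - j₀ - 1)) := by
    rw [mul_add, Finset.mul_sum, Finset.mul_sum, Finset.sum_filter,
      ← Finset.add_sum_erase _ _ (Finset.mem_univ j₀), mul_comm (P j₀)]
    congr 1
    rw [← Finset.add_sum_erase (a := j₀) _ _ (Finset.mem_univ j₀), if_neg (lt_irrefl _), zero_add]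
    refine Finset.sum_congr rfl fun j hj => ?_
    split_ifs with h
    · have h' : (j₀ : ℕ) < j := h
      rw [show (j : ℕ) = j₀ + (1 + ((j : ℕ) - j₀ - 1)) by omega, pow_add, pow_add,
        show (j₀ : ℕ) + (1 + ((j : ℕ) - j₀ - 1)) - j₀ - 1 = (j : ℕ) - j₀ - 1 by omega]
      ring
    · rw [hmin j (lt_of_le_of_ne (not_lt.1 h) (Finset.ne_of_mem_erase hj)), zero_mul]
  have h1 := X_pow_dvd_scaleVars hcoeff
  rw [hE, map_mul, map_pow] at h1
  have hprime : Prime (MvPolynomial.X none : MvPolynomial (Option (D ⊕ I)) K) :=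
    MvPolynomial.X_prime
  exact hprime.pow_dvd_of_dvd_mul_left _ (fun h => hG0 (hprime.dvd_of_dvd_pow h)) h1

omit [Fintype D] [Fintype I] in
lemma eval_scaleVars (E : MvPolynomial (D ⊕ I) K) (y : D → K) (s : I → K) (t : K) :
    MvPolynomial.eval (fun v => v.elim t (Sum.elim y s)) (scaleVars E) =
      MvPolynomial.eval (Sum.elim (fun δ => y δ * t) s) E := by
  have : (MvPolynomial.aeval (fun v : Option (D ⊕ I) => v.elim t (Sum.elim y s))).comp scaleVars =
      MvPolynomial.aeval (R := K) (Sum.elim (fun δ => y δ * t) s) := by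
    refine MvPolynomial.algHom_ext fun v => ?_
    rcases v with δ | i <;> simp [scaleVars]
  simpa using DFunLike.congr_fun this E

end Auxiliary

end AuxiliaryPolynomial

section Truncation

open Finset Filter Topology

section Substitution

variable {K D I : Type*} [Field K] [CharZero K]

/-- Substitute the truncated functions `s i + ∑ n < M, fc i n * z (π i) ^ n`. -/
def truncSubst (π : I → D) (fc : I → ℕ → K) (M : ℕ) (F : MvPolynomial I ℚ) :
    MvPolynomial (D ⊕ I) K :=
  MvPolynomial.aeval (fun i => MvPolynomial.X (Sum.inr i) +
    ∑ n ∈ range M, MvPolynomial.C (fc i n) * MvPolynomial.X (Sum.inl (π i)) ^ n) F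

lemma exists_degreeOf_truncSubst_le (π : I → D) (fc : I → ℕ → K) (F : MvPolynomial I ℚ) :
    ∃ L, ∀ M i, (truncSubst π fc M F).degreeOf (.inr i) ≤ L := by
  classical
  induction F using MvPolynomial.induction_on with
  | C a => exact ⟨0, fun M i => by
      rw [truncSubst, MvPolynomial.aeval_C, MvPolynomial.algebraMap_apply]; simp⟩
  | add p q hp hq =>
    obtain ⟨L, hL⟩ := hp
    obtain ⟨L', hL'⟩ := hq
    refine ⟨max L L', fun M i => ?_⟩
    rw [truncSubst, map_add]
    exact (MvPolynomial.degreeOf_add_le _ _ _).trans (max_le_max (hL M i) (hL' M i))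
  | mul_X p i' hp =>
    obtain ⟨L, hL⟩ := hp
    refine ⟨L + 1, fun M i => ?_⟩
    rw [truncSubst, map_mul, MvPolynomial.aeval_X]
    refine (MvPolynomial.degreeOf_mul_le _ _ _).trans (add_le_add (hL M i) ?_)
    refine (MvPolynomial.degreeOf_add_le _ _ _).trans (max_le ?_ ?_)
    · rw [MvPolynomial.degreeOf_X]
      split_ifs <;> simp
    · refine (MvPolynomial.degreeOf_sum_le _ _ _).trans (Finset.sup_le fun n _ => ?_)
      refine (MvPolynomial.degreeOf_mul_le _ _ _).trans ?_
      rw [MvPolynomial.degreeOf_X_pow_of_ne _ (by simp)]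
      simp

lemma not_X_dvd_scaleVars_truncSubst (π : I → D) {fc : I → ℕ → K} (hfc : ∀ i, fc i 0 = 0) (M : ℕ)
    {F : MvPolynomial I ℚ} (hF : F ≠ 0) :
    ¬ MvPolynomial.X none ∣ scaleVars (truncSubst π fc M F) := by
  intro h
  set ψ : MvPolynomial (Option (D ⊕ I)) K →ₐ[ℚ] MvPolynomial I K :=
    (MvPolynomial.aeval (R := K) (fun v => v.elim 0 (Sum.elim (fun _ => 0)
      fun i => MvPolynomial.X i))).restrictScalars ℚ with hψ
  have h1 : ψ (scaleVars (truncSubst π fc M F)) = MvPolynomial.map (algebraMap ℚ K) F := by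
    have h2 : (ψ.comp ((scaleVars (K := K) (D := D) (I := I)).restrictScalars ℚ)).comp
        (MvPolynomial.aeval (fun i => MvPolynomial.X (Sum.inr i) +
          ∑ n ∈ range M, MvPolynomial.C (fc i n) * MvPolynomial.X (Sum.inl (π i)) ^ n)) =
        MvPolynomial.mapAlgHom (Algebra.ofId ℚ K) := by
      refine MvPolynomial.algHom_ext fun i => ?_
      simp only [hψ, AlgHom.comp_apply, MvPolynomial.aeval_X, map_add, map_sum, map_mul, map_pow,
        AlgHom.restrictScalars_apply, scaleVars, Sum.elim_inr, Sum.elim_inl, Option.elim_some,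
        Option.elim_none, MvPolynomial.mapAlgHom_apply, MvPolynomial.map_X, mul_zero]
      rw [add_eq_left]
      refine Finset.sum_eq_zero fun n _ => ?_
      rcases n with _ | n
      · simp [hfc]
      · simp
    exact DFunLike.congr_fun h2 F
  have h3 : ψ (MvPolynomial.X none) = 0 := by simp [hψ]
  have h4 := map_dvd ψ h
  rw [h3, zero_dvd_iff, h1] at h4
  exact hF (MvPolynomial.map_injective _ (algebraMap ℚ K).injective (by rw [h4, map_zero]))

lemma eval_map_truncSubst (σ : K →+* ℂ) (π : I → D) (fc : I → ℕ → K) (M : ℕ)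
    (F : MvPolynomial I ℚ) (y : D → ℂ) (s : I → ℂ) :
    MvPolynomial.eval (Sum.elim y s) (MvPolynomial.map σ (truncSubst π fc M F)) =
      MvPolynomial.eval (fun i => s i + ∑ n ∈ range M, σ (fc i n) * y (π i) ^ n)
        (MvPolynomial.map (algebraMap ℚ ℂ) F) := by
  rw [MvPolynomial.eval_map, MvPolynomial.eval_map]
  have : (MvPolynomial.eval₂Hom σ (Sum.elim y s)).comp (MvPolynomial.aeval (R := ℚ)
      (fun i => MvPolynomial.X (Sum.inr i) +
        ∑ n ∈ range M, MvPolynomial.C (fc i n) * MvPolynomial.X (Sum.inl (π i)) ^ n) :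
        MvPolynomial I ℚ →+* MvPolynomial (D ⊕ I) K) =
      MvPolynomial.eval₂Hom (algebraMap ℚ ℂ)
        (fun i => s i + ∑ n ∈ range M, σ (fc i n) * y (π i) ^ n) := by
    refine MvPolynomial.ringHom_ext (fun a => by simp) fun i => by simp
  exact DFunLike.congr_fun this F

omit [CharZero K] in
lemma map_scaleVars (σ : K →+* ℂ) (E : MvPolynomial (D ⊕ I) K) :
    MvPolynomial.map σ (scaleVars E) = scaleVars (MvPolynomial.map σ E) := by
  have : (MvPolynomial.map σ).comp (scaleVars (K := K) (D := D) (I := I) :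
      MvPolynomial (D ⊕ I) K →+* MvPolynomial (Option (D ⊕ I)) K) =
      (scaleVars (K := ℂ) (D := D) (I := I) : MvPolynomial (D ⊕ I) ℂ →+* MvPolynomial (Option (D ⊕ I)) ℂ).comp
        (MvPolynomial.map σ) := by
    refine MvPolynomial.ringHom_ext (fun a => ?_) fun v => ?_
    · simp [scaleVars, MvPolynomial.algebraMap_eq]
    · rcases v with δ | i <;> simp [scaleVars]
  exact DFunLike.congr_fun this E

end Substitution

lemma reflect_ne_zero {D I : Type*} (ω : I → ℂ) {P : MvPolynomial (D ⊕ I) ℂ} (hP : P ≠ 0) :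
    MvPolynomial.aeval (Sum.elim (fun δ => MvPolynomial.X (Sum.inl δ))
      fun i => MvPolynomial.C (ω i) - MvPolynomial.X (Sum.inr i)) P ≠ (0 : MvPolynomial (D ⊕ I) ℂ) := by
  set r : MvPolynomial (D ⊕ I) ℂ →ₐ[ℂ] MvPolynomial (D ⊕ I) ℂ :=
    MvPolynomial.aeval (Sum.elim (fun δ => MvPolynomial.X (Sum.inl δ))
      fun i => MvPolynomial.C (ω i) - MvPolynomial.X (Sum.inr i)) with hr
  have h : r.comp r = AlgHom.id ℂ _ := by
    refine MvPolynomial.algHom_ext fun v => ?_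
    rcases v with δ | i <;> simp [hr, MvPolynomial.algebraMap_eq]
  intro h0
  apply hP
  have := DFunLike.congr_fun h P
  rw [AlgHom.comp_apply, h0, map_zero] at this
  exact this.symm

end Truncation

section AsymptoticGrowth

open Finset Filter Topology

section Growth

variable {D : Type*} [Fintype D] {N : ℕ → D → ℕ} {T : ℕ → ℝ} {θ : D → ℝ}

lemma exists_pow_le_exp_neg {a : ℝ} (ha0 : 0 < a) (ha1 : a < 1) (hT : Tendsto T atTop atTop)
    (hθ : ∀ δ, 0 < θ δ) (hN : ∀ δ, Tendsto (fun j => (N j δ : ℝ) / T j) atTop (𝓝 (θ δ))) :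
    ∃ c > 0, ∀ᶠ j in atTop, ∀ δ, a ^ N j δ ≤ Real.exp (-(c * T j)) := by
  have hlog : 0 < -Real.log a := neg_pos.2 (Real.log_neg ha0 ha1)
  obtain ⟨c, hc0, hc⟩ : ∃ c > 0, ∀ δ, c < θ δ * -Real.log a := by
    have h1 : ∀ᶠ c : ℝ in 𝓝[>] 0, ∀ δ, c < θ δ * -Real.log a := by
      rw [eventually_all]
      exact fun δ => nhdsWithin_le_nhds (eventually_lt_nhds (mul_pos (hθ δ) hlog))
    obtain ⟨c, hc, hc'⟩ := (h1.and self_mem_nhdsWithin).exists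
    exact ⟨c, hc', hc⟩
  refine ⟨c, hc0, eventually_all.2 fun δ => ?_⟩
  filter_upwards [((hN δ).mul_const (-Real.log a)).eventually_const_lt (hc δ),
    hT.eventually_gt_atTop 0] with j hj hTj
  rw [div_mul_eq_mul_div, lt_div_iff₀ hTj] at hj
  rw [← Real.exp_log (pow_pos ha0 _), Real.log_pow]
  exact Real.exp_le_exp.2 (by linarith)

lemma exists_pow_le_exp (hT : Tendsto T atTop atTop)
    (hN : ∀ δ, Tendsto (fun j => (N j δ : ℝ) / T j) atTop (𝓝 (θ δ))) {W : ℝ} (hW : 1 ≤ W) :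
    ∃ c, ∀ᶠ j in atTop, ∀ δ, W ^ N j δ ≤ Real.exp (c * T j) := by
  obtain ⟨c, hc⟩ : ∃ c, ∀ δ, θ δ * Real.log W < c := by
    have h1 : ∀ᶠ c : ℝ in atTop, ∀ δ, θ δ * Real.log W < c :=
      eventually_all.2 fun δ => eventually_gt_atTop _
    exact h1.exists
  refine ⟨c, eventually_all.2 fun δ => ?_⟩
  filter_upwards [((hN δ).mul_const (Real.log W)).eventually_lt_const (hc δ),
    hT.eventually_gt_atTop 0] with j hj hTj
  rw [div_mul_eq_mul_div, div_lt_iff₀ hTj] at hj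
  rw [← Real.exp_log (pow_pos (by linarith : 0 < W) _), Real.log_pow]
  exact Real.exp_le_exp.2 hj.le

end Growth

section UpperBound

variable {K D I : Type*} [Field K] [CharZero K] [Fintype I] {π : I → D}
  {fc : I → ℕ → K} {ω : I → ℂ}

lemma exists_norm_eval_le (σ₀ : K →+* ℂ) {F : MvPolynomial I ℚ} (hF : MvPolynomial.aeval ω F = 0)
    {M : ℕ} {P R : MvPolynomial (D ⊕ I) K}
    (hPR : MvPolynomial.X none ^ M ∣ scaleVars (P + truncSubst π fc M F * R))
    {A : ℕ → D → ℂ} {s : ℕ → I → ℂ} {ζ : ℕ → ℝ} (hζ : ∀ᶠ j in atTop, 0 < ζ j ∧ ζ j ≤ 1)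
    (hA : ∀ᶠ j in atTop, ∀ δ, ‖A j δ‖ ≤ ζ j)
    (happrox : ∀ i M, ∃ C, ∀ᶠ j in atTop,
      ‖ω i - s j i - ∑ n ∈ range M, σ₀ (fc i n) * A j (π i) ^ n‖ ≤ C * ‖A j (π i)‖ ^ M) :
    ∃ C, ∀ᶠ j in atTop,
      ‖MvPolynomial.eval (Sum.elim (A j) (s j)) (MvPolynomial.map σ₀ P)‖ ≤ C * ζ j ^ M := by
  obtain ⟨E, hE⟩ := hPR
  choose C hC using fun i => happrox i M
  choose C0 hC0 using fun i => happrox i 0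
  have hCi : ∀ i, |C i| ≤ ∑ i, |C i| := fun i =>
    Finset.single_le_sum (f := fun i => |C i|) (fun _ _ => abs_nonneg _) (Finset.mem_univ i)
  have hC0i : ∀ i, |C0 i| + ‖ω i‖ ≤ ∑ i, (|C0 i| + ‖ω i‖) := fun i =>
    Finset.single_le_sum (f := fun i => |C0 i| + ‖ω i‖) (fun _ _ => by positivity)
      (Finset.mem_univ i)
  have hωi : ∀ i, ‖ω i‖ ≤ ∑ i, ‖ω i‖ := fun i =>
    Finset.single_le_sum (f := fun i => ‖ω i‖) (fun _ _ => by positivity) (Finset.mem_univ i)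
  have hsum0 : 0 ≤ ∑ i, (|C0 i| + ‖ω i‖) := by positivity
  have hsumC : 0 ≤ ∑ i, |C i| := by positivity
  set ρ : ℝ := 1 + ∑ i, (|C0 i| + ‖ω i‖) with hρ
  obtain ⟨K1, hK1, hE1⟩ := exists_norm_eval_sub_le (MvPolynomial.map σ₀ E) ρ
  obtain ⟨K2, hK2, hR1⟩ := exists_norm_eval_sub_le (MvPolynomial.map σ₀ R) ρ
  obtain ⟨K3, hK3, hF1⟩ := exists_norm_eval_sub_le (MvPolynomial.map (algebraMap ℚ ℂ) F)
    (∑ i, ‖ω i‖ + ∑ i, |C i|)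
  refine ⟨K1 + K3 * (∑ i, |C i|) * K2, ?_⟩
  filter_upwards [hζ, hA, eventually_all.2 hC, eventually_all.2 hC0] with j ⟨hζ0, hζ1⟩ hAj hj hj0
  have hs : ∀ i, ‖s j i‖ ≤ ρ := by
    intro i
    have h1 := hj0 i
    simp only [range_zero, sum_empty, sub_zero, pow_zero, mul_one] at h1
    have h2 := norm_le_norm_add_norm_sub (ω i) (s j i)
    have h3 := hC0i i
    have h4 := le_abs_self (C0 i)
    linarith
  have hζc : (ζ j : ℂ) ≠ 0 := by exact_mod_cast hζ0.ne'
  have hζn : ‖(ζ j : ℂ)‖ = ζ j := by rw [Complex.norm_real, Real.norm_of_nonneg hζ0.le]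
  have hPRe : ‖MvPolynomial.eval (Sum.elim (A j) (s j))
      (MvPolynomial.map σ₀ (P + truncSubst π fc M F * R))‖ ≤ K1 * ζ j ^ M := by
    have h1 := eval_scaleVars (MvPolynomial.map σ₀ (P + truncSubst π fc M F * R))
      (fun δ => A j δ / ζ j) (s j) (ζ j)
    simp only [div_mul_cancel₀ _ hζc] at h1
    rw [← h1, ← map_scaleVars, hE]
    simp only [map_mul, map_pow, MvPolynomial.map_X, MvPolynomial.eval_X, Option.elim_none,
      norm_mul, norm_pow, hζn]
    rw [mul_comm]
    refine mul_le_mul_of_nonneg_right ?_ (by positivity)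
    have h2 : ∀ v : Option (D ⊕ I),
        ‖v.elim (ζ j : ℂ) (Sum.elim (fun δ => A j δ / ζ j) (s j))‖ ≤ ρ := by
      rintro (_ | δ | i)
      · simp only [Option.elim_none, hζn]; linarith
      · simp only [Option.elim_some, Sum.elim_inl, norm_div, hζn]
        exact ((div_le_one hζ0).2 (hAj δ)).trans (by linarith)
      · exact hs i
    exact (hE1 _ _ 0 h2 h2 (by simp) le_rfl).1
  have hRe : ‖MvPolynomial.eval (Sum.elim (A j) (s j)) (MvPolynomial.map σ₀ R)‖ ≤ K2 := by
    have h2 : ∀ v : D ⊕ I, ‖Sum.elim (A j) (s j) v‖ ≤ ρ := by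
      rintro (δ | i)
      · exact (hAj δ).trans (by linarith)
      · exact hs i
    exact (hR1 _ _ 0 h2 h2 (by simp) le_rfl).1
  have hFe : ‖MvPolynomial.eval (Sum.elim (A j) (s j))
      (MvPolynomial.map σ₀ (truncSubst π fc M F))‖ ≤ K3 * ((∑ i, |C i|) * ζ j ^ M) := by
    rw [eval_map_truncSubst]
    have hdiff : ∀ i, ‖s j i + ∑ n ∈ range M, σ₀ (fc i n) * A j (π i) ^ n - ω i‖ ≤
        (∑ i, |C i|) * ζ j ^ M := by
      intro i
      rw [norm_sub_rev, ← sub_sub]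
      refine (hj i).trans (mul_le_mul ((le_abs_self _).trans (hCi i))
        (pow_le_pow_left₀ (norm_nonneg _) (hAj _) _) (by positivity) hsumC)
    have h0 : MvPolynomial.eval ω (MvPolynomial.map (algebraMap ℚ ℂ) F) = 0 := by
      rw [MvPolynomial.eval_map, ← hF, MvPolynomial.aeval_def]
    have h1 := (hF1 (fun i => s j i + ∑ n ∈ range M, σ₀ (fc i n) * A j (π i) ^ n) ω
      ((∑ i, |C i|) * ζ j ^ M) ?_ ?_ hdiff (by positivity)).2
    · rwa [h0, sub_zero] at h1
    · intro i
      have h2 := norm_le_norm_add_norm_sub' (s j i + ∑ n ∈ range M, σ₀ (fc i n) * A j (π i) ^ n)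
        (ω i)
      have h3 := hdiff i
      have h4 : (∑ i, |C i|) * ζ j ^ M ≤ ∑ i, |C i| :=
        mul_le_of_le_one_right hsumC (pow_le_one₀ hζ0.le hζ1)
      have := hωi i
      linarith
    · intro i
      exact (hωi i).trans (by linarith)
  rw [map_add, map_add, map_mul, map_mul] at hPRe
  set p := MvPolynomial.eval (Sum.elim (A j) (s j)) (MvPolynomial.map σ₀ P)
  set g := MvPolynomial.eval (Sum.elim (A j) (s j)) (MvPolynomial.map σ₀ (truncSubst π fc M F))
  set r := MvPolynomial.eval (Sum.elim (A j) (s j)) (MvPolynomial.map σ₀ R)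
  have h5 : ‖g * r‖ ≤ K3 * ((∑ i, |C i|) * ζ j ^ M) * K2 := by
    rw [norm_mul]
    exact mul_le_mul hFe hRe (norm_nonneg _) (by positivity)
  have h6 : ‖p‖ ≤ ‖p + g * r‖ + ‖g * r‖ := by
    simpa using norm_sub_le (p + g * r) (g * r)
  calc ‖p‖ ≤ K1 * ζ j ^ M + K3 * ((∑ i, |C i|) * ζ j ^ M) * K2 := by linarith
    _ = _ := by ring

end UpperBound

end AsymptoticGrowth

section Criterion

open Finset Filter Topology

theorem algebraicIndependent_of_approx {K D I : Type*} [Field K] [NumberField K] [Fintype D]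
    [Fintype I] (σ₀ : K →+* ℂ) (π : I → D) {α : K} (hα0 : α ≠ 0)
    (hαint : IsIntegral ℤ α) (hα1 : ‖σ₀ α‖ < 1) {N : ℕ → D → ℕ} {T : ℕ → ℝ} {θ : D → ℝ}
    (hT : Tendsto T atTop atTop) (hθ : ∀ δ, 0 < θ δ)
    (hind : ∀ c : D → ℤ, ∑ δ, c δ * θ δ = 0 → c = 0)
    (hN : ∀ δ, Tendsto (fun j => (N j δ : ℝ) / T j) atTop (𝓝 (θ δ)))
    {fc : I → ℕ → K} (hfc : ∀ i, fc i 0 = 0) {S : ℕ → I → K} {ω : I → ℂ}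
    (happrox : ∀ i M, ∃ C, ∀ᶠ j in atTop,
      ‖ω i - σ₀ (S j i) - ∑ n ∈ range M, σ₀ (fc i n) * (σ₀ α ^ N j (π i)) ^ n‖ ≤
        C * ‖σ₀ α ^ N j (π i)‖ ^ M)
    (harith : ∃ c : ℝ, ∀ᶠ j in atTop, ∃ Q : ℕ, 0 < Q ∧ (Q : ℝ) ≤ Real.exp (c * T j) ∧
      (∀ i, IsIntegral ℤ ((Q : K) * S j i)) ∧
      ∀ (σ : K →+* ℂ) i, ‖σ (S j i)‖ ≤ Real.exp (c * T j))
    (hfun : ∀ δ, AlgebraicIndependent ℂ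
      (Sum.elim (fun i : {i // π i = δ} => PowerSeries.mk fun n => σ₀ (fc i n))
        (fun _ : Unit => (PowerSeries.X : PowerSeries ℂ)))) :
    AlgebraicIndependent ℚ ω := by
  classical
  rw [algebraicIndependent_iff]
  intro F hF
  by_contra hF0
  have hα0' : 0 < ‖σ₀ α‖ := norm_pos_iff.2 ((map_ne_zero σ₀).2 hα0)
  obtain ⟨L, hL⟩ := exists_degreeOf_truncSubst_le (K := K) π fc F
  obtain ⟨c₂, hc₂, hdecay⟩ := exists_pow_le_exp_neg hα0' hα1 hT hθ hN
  obtain ⟨c₃, hgrow⟩ := exists_pow_le_exp hT hN (W := 1 + ∑ σ : K →+* ℂ, ‖σ α‖)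
    (le_add_of_nonneg_right (by positivity))
  obtain ⟨c₄, harith⟩ := harith
  set c₁ := max 0 (max c₃ c₄) with hc₁
  set n := Fintype.card (D ⊕ I) with hn
  set d := Module.finrank ℚ K + 1 with hd
  obtain ⟨B, hB⟩ := exists_nat_gt (c₁ * (2 * n) * d / c₂)
  rw [div_lt_iff₀ hc₂] at hB
  set p := B ^ Fintype.card D * (L + 1) ^ Fintype.card I with hp
  set M := B * (p + 1) with hM
  obtain ⟨P, R, hP0, hPdeg, hPR⟩ := exists_auxiliary_polynomial (hL M)
    (not_X_dvd_scaleVars_truncSubst π hfc M hF0) hp.ge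
  obtain ⟨C₁, hC₁, hliou⟩ := exists_one_le_norm_eval_mul σ₀ P hPdeg
  have hζ : ∀ᶠ j in atTop, 0 < Real.exp (-(c₂ * T j)) ∧ Real.exp (-(c₂ * T j)) ≤ 1 := by
    filter_upwards [hT.eventually_ge_atTop 0] with j hj
    exact ⟨Real.exp_pos _, Real.exp_le_one_iff.2 (neg_nonpos.2 (by positivity))⟩
  obtain ⟨C₂, hupper⟩ := exists_norm_eval_le (A := fun j δ => σ₀ α ^ N j δ)
    (s := fun j i => σ₀ (S j i)) σ₀ hF hPR hζ (by simpa only [norm_pow] using hdecay) happrox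
  have hPc : MvPolynomial.map σ₀ P ≠ 0 := fun h =>
    hP0 (MvPolynomial.map_injective _ σ₀.injective (by rw [h, map_zero]))
  have hu : ∀ i M, ∃ C, ∀ᶠ j in atTop, ‖ω i - σ₀ (S j i) - ∑ n ∈ range M,
      PowerSeries.coeff n (PowerSeries.mk fun n => σ₀ (fc i n)) * (σ₀ α ^ N j (π i)) ^ n‖ ≤
        C * (‖σ₀ α‖ ^ N j (π i)) ^ M := by
    simpa only [norm_pow, PowerSeries.coeff_mk] using happrox
  have hne := eventually_eval_ne_zero (π := π) (f := fun i => PowerSeries.mk fun n => σ₀ (fc i n))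
    (u := fun j i => ω i - σ₀ (S j i)) hfun (reflect_ne_zero ω hPc) hα0' hα1 hT hθ hind hN hu
  set x : ℕ → D ⊕ I → K := fun j => Sum.elim (fun δ => α ^ N j δ) (S j) with hx
  have heval : ∀ j, σ₀ (MvPolynomial.eval (x j) P) =
      MvPolynomial.eval (Sum.elim (fun δ => σ₀ α ^ N j δ) fun i => σ₀ (S j i))
        (MvPolynomial.map σ₀ P) := by
    intro j
    rw [MvPolynomial.eval_map, ← MvPolynomial.coe_eval₂Hom, MvPolynomial.eval,
      MvPolynomial.coe_eval₂Hom, MvPolynomial.coe_eval₂Hom, MvPolynomial.eval₂_comp_left,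
      RingHom.comp_id]
    congr 1
    funext v
    rcases v with δ | i <;> simp [hx]
  have hreflect : ∀ j, MvPolynomial.eval (Sum.elim (fun δ => σ₀ α ^ N j δ)
      fun i => ω i - σ₀ (S j i)) (MvPolynomial.aeval (Sum.elim (fun δ => MvPolynomial.X (.inl δ))
        fun i => MvPolynomial.C (ω i) - MvPolynomial.X (.inr i)) (MvPolynomial.map σ₀ P) :
          MvPolynomial (D ⊕ I) ℂ) = σ₀ (MvPolynomial.eval (x j) P) := by
    intro j
    rw [heval, ← MvPolynomial.coe_aeval_eq_eval, ← MvPolynomial.coe_aeval_eq_eval, RingHom.coe_coe,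
      RingHom.coe_coe, ← AlgHom.comp_apply]
    congr 1
    refine MvPolynomial.algHom_ext fun v => ?_
    rcases v with δ | i <;> simp
  have hev : ∀ᶠ j in atTop, (1 : ℝ) ≤ C₂ * C₁ ^ d *
      Real.exp (-((c₂ * B - c₁ * (2 * n) * d) * (p + 1)) * T j) := by
    filter_upwards [hupper, hne, hgrow, harith, hT.eventually_ge_atTop 0]
      with j hj hnej hgj ⟨Q, hQ0, hQ, hQint, hσ⟩ hTj
    have h4 : Real.exp (c₄ * T j) ≤ Real.exp (c₁ * T j) :=
      Real.exp_le_exp.2 (mul_le_mul_of_nonneg_right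
        ((le_max_right _ _).trans (le_max_right _ _)) hTj)
    have h3 : Real.exp (c₃ * T j) ≤ Real.exp (c₁ * T j) :=
      Real.exp_le_exp.2 (mul_le_mul_of_nonneg_right
        ((le_max_left _ _).trans (le_max_right _ _)) hTj)
    have hlow := hliou (x j) Q (Real.exp (c₁ * T j)) hQ0 (hQ.trans h4) (by
      rintro (δ | i)
      · exact IsIntegral.mul (by simpa using isIntegral_algebraMap (R := ℤ) (A := K) (x := (Q : ℤ)))
          (hαint.pow _)
      · exact hQint i) (by
      rintro σ (δ | i)
      · simp only [hx, Sum.elim_inl, map_pow, norm_pow]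
        refine le_trans (pow_le_pow_left₀ (norm_nonneg _) ?_ _) ((hgj δ).trans h3)
        exact (Finset.single_le_sum (f := fun σ : K →+* ℂ => ‖σ α‖) (fun _ _ => norm_nonneg _)
          (Finset.mem_univ σ)).trans (by simp)
      · exact (hσ σ i).trans h4) (by
      intro h
      rw [hreflect, h, map_zero] at hnej
      exact hnej rfl)
    rw [← heval] at hj
    refine hlow.trans ?_
    have h5 : 0 ≤ C₂ * Real.exp (-(c₂ * T j)) ^ M := (norm_nonneg _).trans hj
    have hC₂ : 0 ≤ C₂ := nonneg_of_mul_nonneg_left h5 (by positivity)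
    calc _ ≤ C₂ * Real.exp (-(c₂ * T j)) ^ M *
          (C₁ * Real.exp (c₁ * T j) ^ (2 * (n * p))) ^ d := by gcongr
      _ = C₂ * C₁ ^ d * Real.exp (-(c₂ * T j) * M + c₁ * T j * (2 * (n * p)) * d) := by
          rw [mul_pow, ← pow_mul, ← Real.exp_nat_mul, ← Real.exp_nat_mul, Real.exp_add]
          push_cast
          ring_nf
      _ ≤ _ := by
          refine mul_le_mul_of_nonneg_left (Real.exp_le_exp.2 ?_) (by positivity)
          have h6 : 0 ≤ c₁ * T j * (2 * n) * d := by
            have : 0 ≤ c₁ := le_max_left _ _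
            positivity
          rw [hM]
          push_cast
          nlinarith
  have hlim : Tendsto (fun j => C₂ * C₁ ^ d *
      Real.exp (-((c₂ * B - c₁ * (2 * n) * d) * (p + 1)) * T j)) atTop (𝓝 (C₂ * C₁ ^ d * 0)) := by
    refine Tendsto.const_mul _ (Real.tendsto_exp_atBot.comp ?_)
    refine hT.const_mul_atTop_of_neg (neg_lt_zero.2 (mul_pos (by linarith) (by positivity)))
  rw [mul_zero] at hlim
  obtain ⟨j, h1, h2⟩ := (hev.and (hlim.eventually_lt_const one_pos)).exists
  linarith

end Criterion

section LambertExpansion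

open Finset

/-- The `(h, n)` entry of the double series obtained by expanding
`∑ β h * ρ m * x ^ (m * r ^ h)` in powers of `x`. -/
def lambertEntry (β ρ : ℕ → ℂ) (r : ℕ) (x : ℂ) (h n : ℕ) : ℂ :=
  if r ^ h ∣ n then β h * ρ (n / r ^ h) * x ^ n else 0

variable {β ρ : ℕ → ℂ} {r : ℕ}

lemma tsum_lambertEntry (hr : 2 ≤ r) (x : ℂ) (h : ℕ) :
    ∑' n, lambertEntry β ρ r x h n = β h * ∑' m, ρ m * (x ^ r ^ h) ^ m := by
  have hpos : 0 < r ^ h := by positivity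
  have hinj : Function.Injective fun m : ℕ => r ^ h * m := fun m m' e =>
    Nat.eq_of_mul_eq_mul_left hpos e
  rw [← hinj.tsum_eq, ← tsum_mul_left]
  · refine tsum_congr fun m => ?_
    rw [lambertEntry, if_pos (dvd_mul_right _ _), Nat.mul_div_cancel_left _ hpos, pow_mul, mul_assoc]
  · intro n hn
    by_cases hd : r ^ h ∣ n
    · obtain ⟨m, rfl⟩ := hd
      exact ⟨m, rfl⟩
    · simp [lambertEntry, hd] at hn

lemma lambertEntry_eq_zero (hr : 2 ≤ r) (hρ0 : ρ 0 = 0) (x : ℂ) {h n : ℕ} (hn : n ≤ h) :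
    lambertEntry β ρ r x h n = 0 := by
  rw [lambertEntry]
  split_ifs with hd
  · rcases Nat.eq_zero_or_pos n with rfl | hn0
    · simp [hρ0]
    · have h1 := Nat.le_of_dvd hn0 hd
      have h2 : h < r ^ h := Nat.lt_pow_self (by omega)
      omega
  · rfl

lemma tsum_lambertEntry_right (hr : 2 ≤ r) (hρ0 : ρ 0 = 0) (x : ℂ) (n : ℕ) :
    ∑' h, lambertEntry β ρ r x h n = mahlerCoeff β ρ r n * x ^ n := by
  rw [tsum_eq_sum (s := range n) fun h hh =>
    lambertEntry_eq_zero hr hρ0 x (by simpa using hh), mahlerCoeff, sum_mul]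
  refine sum_congr rfl fun h _ => ?_
  rw [lambertEntry]
  split_ifs <;> simp

variable {B C R : ℝ}

lemma norm_lambertEntry_le (hr : 2 ≤ r) (hρ0 : ρ 0 = 0) (hβ : ∀ h, ‖β h‖ ≤ B) (hR : 1 ≤ R)
    (hC : 0 ≤ C) (hρ : ∀ m, ‖ρ m‖ ≤ C * R ^ m) (x : ℂ) (h n : ℕ) :
    ‖lambertEntry β ρ r x h n‖ ≤ B * C * ((1 / 2) ^ h * (2 * R * ‖x‖) ^ n) := by
  have hB : 0 ≤ B := (norm_nonneg _).trans (hβ 0)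
  have hrhs : 0 ≤ B * C * ((1 / 2) ^ h * (2 * R * ‖x‖) ^ n) := by positivity
  rcases le_or_gt n h with hn | hn
  · rw [lambertEntry_eq_zero hr hρ0 x hn, norm_zero]
    exact hrhs
  rw [lambertEntry]
  split_ifs with hd
  · rw [norm_mul, norm_mul, norm_pow]
    have h1 : R ^ (n / r ^ h) ≤ R ^ n := pow_le_pow_right₀ hR (Nat.div_le_self _ _)
    have h2 : (1 : ℝ) ≤ (1 / 2) ^ h * 2 ^ n := by
      rw [one_div, inv_pow, ← div_eq_inv_mul, one_le_div (by positivity)]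
      exact pow_le_pow_right₀ (by norm_num) hn.le
    calc ‖β h‖ * ‖ρ (n / r ^ h)‖ * ‖x‖ ^ n ≤ B * (C * R ^ n) * ‖x‖ ^ n := by
          gcongr
          · exact hβ h
          · exact (hρ _).trans (by gcongr)
      _ = B * C * (R ^ n * ‖x‖ ^ n) * 1 := by ring
      _ ≤ B * C * (R ^ n * ‖x‖ ^ n) * ((1 / 2) ^ h * 2 ^ n) := by gcongr
      _ = _ := by rw [mul_pow, mul_pow]; ring
  · simpa using hrhs

lemma summable_lambertEntry (hr : 2 ≤ r) (hρ0 : ρ 0 = 0) (hβ : ∀ h, ‖β h‖ ≤ B) (hR : 1 ≤ R)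
    (hC : 0 ≤ C) (hρ : ∀ m, ‖ρ m‖ ≤ C * R ^ m) {x : ℂ} (hx : 2 * R * ‖x‖ ≤ 1 / 2) :
    Summable (Function.uncurry (lambertEntry β ρ r x)) := by
  have h1 : Summable fun p : ℕ × ℕ => (1 / 2 : ℝ) ^ p.1 * (2 * R * ‖x‖) ^ p.2 :=
    Summable.mul_of_nonneg (f := fun h : ℕ => (1 / 2 : ℝ) ^ h)
      (g := fun n : ℕ => (2 * R * ‖x‖) ^ n)
      (summable_geometric_of_lt_one (by norm_num) (by norm_num))
      (summable_geometric_of_lt_one (by positivity) (by linarith))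
      (fun _ => by positivity) (fun _ => by positivity)
  exact Summable.of_norm_bounded (h1.mul_left (B * C)) fun p =>
    norm_lambertEntry_le hr hρ0 hβ hR hC hρ x p.1 p.2

lemma summable_lambert (hr : 2 ≤ r) (hρ0 : ρ 0 = 0) (hβ : ∀ h, ‖β h‖ ≤ B) (hR : 1 ≤ R)
    (hC : 0 ≤ C) (hρ : ∀ m, ‖ρ m‖ ≤ C * R ^ m) {x : ℂ} (hx : 2 * R * ‖x‖ ≤ 1 / 2) :
    Summable fun h => β h * ∑' m, ρ m * (x ^ r ^ h) ^ m := by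
  simpa only [Function.uncurry_apply_pair, tsum_lambertEntry hr] using
    (summable_lambertEntry hr hρ0 hβ hR hC hρ hx).prod

lemma norm_lambert_sub_le (hr : 2 ≤ r) (hρ0 : ρ 0 = 0) (hβ : ∀ h, ‖β h‖ ≤ B) (hR : 1 ≤ R)
    (hC : 0 ≤ C) (hρ : ∀ m, ‖ρ m‖ ≤ C * R ^ m) {x : ℂ} (hx : 2 * R * ‖x‖ ≤ 1 / 2) (M : ℕ) :
    ‖(∑' h, β h * ∑' m, ρ m * (x ^ r ^ h) ^ m) -
      ∑ n ∈ range M, mahlerCoeff β ρ r n * x ^ n‖ ≤ 4 * (B * C) * (2 * R) ^ M * ‖x‖ ^ M := by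
  have hB : 0 ≤ B := (norm_nonneg _).trans (hβ 0)
  have hs := summable_lambertEntry hr hρ0 hβ hR hC hρ hx
  have hs2 : Summable fun n => mahlerCoeff β ρ r n * x ^ n := by
    simpa only [Function.uncurry_apply_pair, Prod.swap_prod_mk, tsum_lambertEntry_right hr hρ0] using
      hs.prod_symm.prod
  have hy0 : 0 ≤ 2 * R * ‖x‖ := by positivity
  have hy1 : 2 * R * ‖x‖ < 1 := by linarith
  have hn : ∀ n, ‖mahlerCoeff β ρ r n * x ^ n‖ ≤ 2 * (B * C) * (2 * R * ‖x‖) ^ n := by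
    intro n
    rw [← tsum_lambertEntry_right hr hρ0]
    refine tsum_of_norm_bounded (g := fun h => B * C * ((1 / 2) ^ h * (2 * R * ‖x‖) ^ n)) ?_
      fun h => norm_lambertEntry_le hr hρ0 hβ hR hC hρ x h n
    rw [show 2 * (B * C) * (2 * R * ‖x‖) ^ n = B * C * (2 * (2 * R * ‖x‖) ^ n) by ring]
    exact (hasSum_geometric_two.mul_right ((2 * R * ‖x‖) ^ n)).mul_left (B * C)
  have h3 : (∑' h, β h * ∑' m, ρ m * (x ^ r ^ h) ^ m) = ∑' n, mahlerCoeff β ρ r n * x ^ n := by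
    simp only [← tsum_lambertEntry hr, ← tsum_lambertEntry_right hr hρ0]
    exact hs.tsum_comm.symm
  rw [h3, ← hs2.sum_add_tsum_nat_add M, add_sub_cancel_left]
  have hg : HasSum (fun n => 2 * (B * C) * (2 * R * ‖x‖) ^ M * (2 * R * ‖x‖) ^ n)
      (2 * (B * C) * (2 * R * ‖x‖) ^ M * (1 - 2 * R * ‖x‖)⁻¹) :=
    (hasSum_geometric_of_lt_one hy0 hy1).mul_left _
  refine (tsum_of_norm_bounded hg fun n => ?_).trans ?_
  · refine (hn (n + M)).trans_eq ?_
    rw [pow_add]; ring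
  · have : (1 - 2 * R * ‖x‖)⁻¹ ≤ 2 := by
      rw [inv_le_comm₀ (by linarith) (by norm_num)]
      linarith
    calc _ ≤ 2 * (B * C) * (2 * R * ‖x‖) ^ M * 2 := by gcongr
      _ = _ := by rw [mul_pow]; ring

end LambertExpansion

section SumTerms

variable {F E : Type*} [Field F] [Field E]

/-- The `h`-th term of the sum of the given kind attached to `r`, over a field containing a root
`phi` of `x ^ 2 = x + 1`. -/
def kindTerm (phi : F) (a b c : ℕ → F) (k : ℕ) : SumKind → ℕ → ℕ → F :=
  Sum.elim (fun μ r h => a h / phi ^ (μ * k * r ^ h))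
    (Sum.elim
      (fun ℓ r h => if 0 < (k * r ^ h + ℓ : ℤ) then b h / (Nat.fib (k * r ^ h + ℓ : ℤ).toNat : F)
        else 0)
      (fun ℓ r h => if 0 ≤ (k * r ^ h + ℓ : ℤ) then c h / (lucasNum (k * r ^ h + ℓ : ℤ).toNat : F)
        else 0))

/-- The index shift `ℓ` of a Fibonacci or Lucas sum. -/
def kindShift : SumKind → ℤ := Sum.elim (fun _ => 0) (Sum.elim id id)

lemma map_kindTerm (σ : F →+* E) (phi : F) (a b c : ℕ → F) (k : ℕ) (κ : SumKind) (r h : ℕ) :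
    σ (kindTerm phi a b c k κ r h) = kindTerm (σ phi) (σ ∘ a) (σ ∘ b) (σ ∘ c) k κ r h := by
  rcases κ with μ | ℓ | ℓ
  · simp [kindTerm]
  · simp only [kindTerm, Sum.elim_inr, Sum.elim_inl, apply_ite σ, map_div₀, map_natCast, map_zero,
      Function.comp_apply]
  · simp only [kindTerm, Sum.elim_inr, apply_ite σ, map_div₀, map_natCast, map_zero,
      Function.comp_apply]

lemma map_mahlerCoeff (σ : F →+* E) (β ρ : ℕ → F) (r n : ℕ) :
    σ (mahlerCoeff β ρ r n) = mahlerCoeff (fun h => σ (β h)) (fun m => σ (ρ m)) r n := by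
  simp only [mahlerCoeff, map_sum, apply_ite σ, map_mul, map_zero]

lemma map_kindSeq (σ : F →+* E) (a b c : ℕ → F) (κ : SumKind) (h : ℕ) :
    σ (kindSeq a b c κ h) = kindSeq (σ ∘ a) (σ ∘ b) (σ ∘ c) κ h := by
  rcases κ with μ | ℓ | ℓ <;> rfl

lemma map_oddChar (σ : F →+* E) (ε : F) (m : ℕ) : σ (oddChar ε m) = oddChar (σ ε) m := by
  simp only [oddChar, apply_ite σ, map_pow, map_zero]

lemma map_kindRho (σ : F →+* E) (lam s : F) (eps : ℤ → F) (κ : SumKind) (m : ℕ) :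
    σ (kindRho lam s eps κ m) = kindRho (σ lam) (σ s) (fun ℓ => σ (eps ℓ)) κ m := by
  rcases κ with μ | ℓ | ℓ
  · simp only [kindRho, Sum.elim_inl, apply_ite σ, map_one, map_zero]
  · simp only [kindRho, Sum.elim_inr, Sum.elim_inl, map_mul, map_oddChar, map_zpow₀]
  · simp only [kindRho, Sum.elim_inr, map_mul, map_oddChar, map_zpow₀, map_neg]

lemma kindRho_zero (lam s : F) (eps : ℤ → F) {κ : SumKind} (hκ : κ ≠ Sum.inl 0) :
    kindRho lam s eps κ 0 = 0 := by
  rcases κ with μ | ℓ | ℓ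
  · have : (0 : ℕ) ≠ μ := fun h => hκ (by rw [h])
    simp [kindRho, this]
  · simp [kindRho, oddChar]
  · simp [kindRho, oddChar]

section Binet

variable {phi : F} (hphi : phi ^ 2 = phi + 1)
include hphi

lemma phi_mul_phi_sub_one : phi * (phi - 1) = 1 := by linear_combination hphi

lemma phi_ne_zero_of_sq : phi ≠ 0 := left_ne_zero_of_mul_eq_one (phi_mul_phi_sub_one hphi)

lemma inv_eq_phi_sub_one : phi⁻¹ = phi - 1 := inv_eq_of_mul_eq_one_right (phi_mul_phi_sub_one hphi)

lemma fib_eq_pow_sub_pow (n : ℕ) : (2 * phi - 1) * (Nat.fib n : F) = phi ^ n - (-phi⁻¹) ^ n := by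
  rw [inv_eq_phi_sub_one hphi]
  induction n using Nat.twoStepInduction with
  | zero => simp
  | one => simp; ring
  | more n h1 h2 =>
    rw [Nat.fib_add_two, Nat.cast_add, mul_add, h1, h2]
    linear_combination (-phi ^ n + (-(phi - 1)) ^ n) * hphi

lemma lucasNum_eq_pow_add_pow (n : ℕ) : (lucasNum n : F) = phi ^ n + (-phi⁻¹) ^ n := by
  rw [inv_eq_phi_sub_one hphi]
  induction n using Nat.twoStepInduction with
  | zero => simp [lucasNum]; norm_num
  | one => simp [lucasNum]
  | more n h1 h2 =>
    rw [lucasNum, Nat.cast_add, h1, h2]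
    linear_combination (-phi ^ n - (-(phi - 1)) ^ n) * hphi

lemma two_mul_phi_sub_one_ne_zero [CharZero F] : 2 * phi - 1 ≠ 0 := by
  intro h
  have h5 : (5 : F) = 0 := by linear_combination (2 * phi - 1) * h - 4 * hphi
  norm_num at h5

end Binet

lemma lucasNum_pos (n : ℕ) : 0 < lucasNum n := by
  induction n using Nat.twoStepInduction with
  | zero => simp [lucasNum]
  | one => simp [lucasNum]
  | more n h1 h2 => rw [lucasNum]; omega

lemma tsum_oddChar {ε y : ℂ} (h : ‖ε * y ^ 2‖ < 1) :
    ∑' m, oddChar ε m * y ^ m = y / (1 - ε * y ^ 2) := by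
  have hinj : Function.Injective fun t : ℕ => 2 * t + 1 := fun t t' e => by
    simpa using e
  rw [← hinj.tsum_eq, div_eq_mul_inv, ← tsum_geometric_of_norm_lt_one h, ← tsum_mul_left]
  · refine tsum_congr fun t => ?_
    rw [oddChar, if_pos (by omega), show (2 * t + 1) / 2 = t by omega, pow_succ, mul_pow, pow_mul]
    ring
  · intro m hm
    rw [Function.mem_support, oddChar] at hm
    split_ifs at hm with h1
    · exact ⟨m / 2, by dsimp only; omega⟩
    · simp at hm

lemma kindTerm_eq_tsum {phi : ℂ} (hphi : phi ^ 2 = phi + 1) (hphi1 : 1 < ‖phi‖) (a b c : ℕ → ℂ)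
    {k : ℕ} {κ : SumKind} {r h : ℕ} (hpos : 0 < (k * r ^ h + kindShift κ : ℤ)) {eps : ℤ → ℂ}
    (heps : ∀ ℓ, eps ℓ = (-1) ^ (k * r ^ h + ℓ : ℤ)) :
    kindTerm phi a b c k κ r h = kindSeq a b c κ h *
      ∑' m, kindRho phi⁻¹ (2 * phi - 1) eps κ m * (((phi⁻¹ ^ k) ^ r ^ h) ^ m) := by
  have hphi0 : phi ≠ 0 := phi_ne_zero_of_sq hphi
  have hs := two_mul_phi_sub_one_ne_zero hphi
  have key : ∀ (ℓ : ℤ) (n : ℕ), (k * r ^ h + ℓ : ℤ) = n → ∀ m : ℕ,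
      phi⁻¹ ^ (ℓ * (m : ℤ)) * ((phi⁻¹ ^ k) ^ r ^ h) ^ m = (phi⁻¹ ^ n) ^ m := by
    intro ℓ n hn m
    rw [zpow_mul, zpow_natCast, ← mul_pow, ← pow_mul, ← zpow_natCast phi⁻¹ (k * r ^ h),
      ← zpow_add₀ (inv_ne_zero hphi0), ← zpow_natCast phi⁻¹ n, ← hn]
    push_cast
    rw [add_comm]
  have hsmall : ∀ n : ℕ, 0 < n → ‖(phi⁻¹ ^ n) ^ 2‖ < 1 := by
    intro n hn
    rw [← pow_mul, norm_pow, norm_inv]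
    exact pow_lt_one₀ (by positivity) (inv_lt_one_of_one_lt₀ hphi1) (by omega)
  have hexp : ∀ (n : ℕ) (ε : ℂ),
      phi⁻¹ ^ n / (1 - ε * (phi⁻¹ ^ n) ^ 2) = (phi ^ n - ε * phi⁻¹ ^ n)⁻¹ := by
    intro n ε
    have h1 : phi ^ n * phi⁻¹ ^ n = 1 := by rw [← mul_pow, mul_inv_cancel₀ hphi0, one_pow]
    have hmul : phi ^ n - ε * phi⁻¹ ^ n = phi ^ n * (1 - ε * (phi⁻¹ ^ n) ^ 2) := by
      linear_combination ε * phi⁻¹ ^ n * h1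
    rw [hmul, mul_inv, ← inv_pow, div_eq_mul_inv]
  rcases κ with μ | ℓ | ℓ
  · simp only [kindTerm, kindSeq, kindRho, Sum.elim_inl, ite_mul, one_mul, zero_mul, tsum_ite_eq]
    rw [div_eq_mul_inv, ← pow_mul, ← pow_mul, inv_pow, mul_comm μ, mul_right_comm k μ, mul_assoc k]
  · simp only [kindShift, Sum.elim_inl, Sum.elim_inr, id] at hpos
    obtain ⟨n, hn⟩ := Int.eq_ofNat_of_zero_le hpos.le
    have hn0 : 0 < n := by omega
    have hε : eps ℓ = (-1) ^ n := by rw [heps, hn, zpow_natCast]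
    have hε1 : ‖eps ℓ‖ = 1 := by rw [hε]; simp
    simp only [kindTerm, kindSeq, kindRho, Sum.elim_inl, Sum.elim_inr]
    rw [if_pos hpos, hn, Int.toNat_natCast]
    have h1 : ∀ m : ℕ, (2 * phi - 1) * oddChar (eps ℓ) m * phi⁻¹ ^ (ℓ * (m : ℤ)) *
        ((phi⁻¹ ^ k) ^ r ^ h) ^ m = (2 * phi - 1) * (oddChar (eps ℓ) m * (phi⁻¹ ^ n) ^ m) := by
      intro m
      rw [mul_assoc, key ℓ n hn, mul_assoc]
    rw [tsum_congr h1, tsum_mul_left, tsum_oddChar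
      (by rw [norm_mul, hε1, one_mul]; exact hsmall n hn0), hexp]
    have h4 : (2 * phi - 1) * (Nat.fib n : ℂ) = phi ^ n - eps ℓ * phi⁻¹ ^ n := by
      rw [fib_eq_pow_sub_pow hphi, neg_pow, hε]
    rw [← h4, mul_inv, mul_inv_cancel_left₀ hs, div_eq_mul_inv]
  · simp only [kindShift, Sum.elim_inr, id] at hpos
    obtain ⟨n, hn⟩ := Int.eq_ofNat_of_zero_le hpos.le
    have hn0 : 0 < n := by omega
    have hε : eps ℓ = (-1) ^ n := by rw [heps, hn, zpow_natCast]
    have hε1 : ‖-eps ℓ‖ = 1 := by rw [hε]; simp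
    simp only [kindTerm, kindSeq, kindRho, Sum.elim_inr]
    rw [if_pos hpos.le, hn, Int.toNat_natCast]
    have h1 : ∀ m : ℕ, oddChar (-eps ℓ) m * phi⁻¹ ^ (ℓ * (m : ℤ)) *
        ((phi⁻¹ ^ k) ^ r ^ h) ^ m = oddChar (-eps ℓ) m * (phi⁻¹ ^ n) ^ m := by
      intro m
      rw [mul_assoc, key ℓ n hn]
    rw [tsum_congr h1, tsum_oddChar
      (by rw [norm_mul, hε1, one_mul]; exact hsmall n hn0), hexp, lucasNum_eq_pow_add_pow hphi,
      neg_pow, ← hε, neg_mul, sub_neg_eq_add, div_eq_mul_inv]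

lemma exists_norm_kindRho_le (lam s : ℂ) {eps : ℤ → ℂ} (heps : ∀ ℓ, eps ℓ ^ 2 = 1) (κ : SumKind) :
    ∃ C R : ℝ, 0 ≤ C ∧ 1 ≤ R ∧ ∀ m, ‖kindRho lam s eps κ m‖ ≤ C * R ^ m := by
  have hodd : ∀ ε : ℂ, ε ^ 2 = 1 → ∀ m, ‖oddChar ε m‖ ≤ 1 := by
    intro ε hε m
    have h1 : ‖ε‖ = 1 := by
      have : ‖ε‖ ^ 2 = 1 := by rw [← norm_pow, hε, norm_one]
      exact (pow_eq_one_iff_of_nonneg (norm_nonneg _) two_ne_zero).1 this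
    rw [oddChar]
    split_ifs
    · rw [norm_pow, h1, one_pow]
    · simp
  have hpow : ∀ (ℓ : ℤ) (m : ℕ), ‖lam ^ (ℓ * (m : ℤ))‖ ≤ (1 + ‖lam ^ ℓ‖) ^ m := by
    intro ℓ m
    rw [zpow_mul, zpow_natCast, norm_pow]
    gcongr
    linarith
  rcases κ with μ | ℓ | ℓ
  · refine ⟨1, 1, zero_le_one, le_rfl, fun m => ?_⟩
    simp only [kindRho, Sum.elim_inl]
    split_ifs <;> simp
  · refine ⟨‖s‖, 1 + ‖lam ^ ℓ‖, norm_nonneg _, by linarith [norm_nonneg (lam ^ ℓ)], fun m => ?_⟩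
    simp only [kindRho, Sum.elim_inl, Sum.elim_inr]
    rw [norm_mul, norm_mul]
    have := hodd _ (heps ℓ) m
    calc _ ≤ ‖s‖ * 1 * (1 + ‖lam ^ ℓ‖) ^ m := by
          gcongr
          exact hpow ℓ m
      _ = _ := by ring
  · refine ⟨1, 1 + ‖lam ^ ℓ‖, zero_le_one, by linarith [norm_nonneg (lam ^ ℓ)], fun m => ?_⟩
    simp only [kindRho, Sum.elim_inr]
    rw [norm_mul]
    have := hodd (-eps ℓ) (by rw [neg_sq, heps]) m
    gcongr
    exact hpow ℓ m

end SumTerms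

section SumArithmetic

open Finset

lemma fib_le_two_pow (n : ℕ) : Nat.fib n ≤ 2 ^ n := by
  induction n using Nat.twoStepInduction with
  | zero => simp
  | one => simp
  | more n h1 h2 =>
    rw [Nat.fib_add_two]
    rw [pow_succ] at h2 ⊢
    rw [pow_succ]
    omega

lemma lucasNum_le_two_pow (n : ℕ) : lucasNum n ≤ 2 ^ (n + 1) := by
  induction n using Nat.twoStepInduction with
  | zero => simp [lucasNum]
  | one => simp [lucasNum]
  | more n h1 h2 =>
    rw [lucasNum]
    rw [pow_succ, pow_succ] at *
    rw [pow_succ] at *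
    omega

lemma sum_range_pow_le {r : ℕ} (hr : 2 ≤ r) (H : ℕ) : ∑ h ∈ range H, r ^ h ≤ r ^ H := by
  induction H with
  | zero => simp
  | succ H ih =>
    rw [sum_range_succ, pow_succ]
    nlinarith [Nat.mul_le_mul_left (r ^ H) hr]

variable {K : Type*} [Field K] [NumberField K]

lemma exists_nat_mul_isIntegral (x : K) : ∃ D : ℕ, 0 < D ∧ IsIntegral ℤ ((D : K) * x) := by
  obtain ⟨y, hy0, hy⟩ := ((IsFractionRing.isAlgebraic_iff ℤ ℚ K).2
    (Algebra.IsAlgebraic.isAlgebraic x)).exists_integral_multiple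
  refine ⟨y.natAbs, Int.natAbs_pos.2 hy0, ?_⟩
  rw [zsmul_eq_mul] at hy
  rcases Int.natAbs_eq y with h | h
  · rwa [h, Int.cast_natCast] at hy
  · have := hy.neg
    rwa [h, Int.cast_neg, Int.cast_natCast, neg_mul, neg_neg] at this

lemma exists_bounds_of_periodic {β : ℕ → K} {p : ℕ} (hp : 0 < p) (hβ : Function.Periodic β p) :
    ∃ (D : ℕ) (A : ℝ), 0 < D ∧ 1 ≤ A ∧ ∀ h, IsIntegral ℤ ((D : K) * β h) ∧
      ∀ σ : K →+* ℂ, ‖σ (β h)‖ ≤ A := by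
  choose D hD hDint using fun h => exists_nat_mul_isIntegral (β h)
  refine ⟨∏ h ∈ range p, D h, 1 + ∑ h ∈ range p, ∑ σ : K →+* ℂ, ‖σ (β h)‖,
    prod_pos fun h _ => hD h, ?_, fun h => ?_⟩
  · have : 0 ≤ ∑ h ∈ range p, ∑ σ : K →+* ℂ, ‖σ (β h)‖ := by positivity
    linarith
  have hmem : h % p ∈ range p := mem_range.2 (Nat.mod_lt _ hp)
  rw [← hβ.map_mod_nat h]
  constructor
  · rw [← mul_prod_erase _ _ hmem, Nat.cast_mul, mul_right_comm]
    exact (hDint _).mul (isIntegral_natCast _)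
  · intro σ
    have h1 := single_le_sum (f := fun h => ∑ σ : K →+* ℂ, ‖σ (β h)‖)
      (fun _ _ => by positivity) hmem
    have h2 := single_le_sum (f := fun σ : K →+* ℂ => ‖σ (β (h % p))‖)
      (fun _ _ => by positivity) (mem_univ σ)
    linarith


section Golden

variable {phi : K} (hphi : phi ^ 2 = phi + 1)
include hphi

omit [NumberField K] in
lemma isIntegral_inv_of_sq : IsIntegral ℤ phi⁻¹ := by
  refine ⟨Polynomial.X ^ 2 + Polynomial.X - 1, by monicity!, ?_⟩
  rw [inv_eq_phi_sub_one hphi]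
  simp
  linear_combination hphi

lemma norm_map_inv_le_two (σ : K →+* ℂ) : ‖σ phi⁻¹‖ ≤ 2 := by
  set y := σ phi⁻¹ with hy
  have h1 : y ^ 2 = 1 - y := by
    rw [hy, inv_eq_phi_sub_one hphi, ← map_pow, ← map_one σ, ← map_sub]
    congr 1
    linear_combination hphi
  have h2 : ‖y‖ ^ 2 ≤ 1 + ‖y‖ := by
    rw [← norm_pow, h1]
    exact (norm_sub_le _ _).trans_eq (by rw [norm_one])
  nlinarith

lemma exists_kindTerm_bounds {a b c : ℕ → K} {D : ℕ} {A : ℝ} (κ : SumKind) (hA : 1 ≤ A)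
    (hDA : ∀ h, IsIntegral ℤ ((D : K) * kindSeq a b c κ h) ∧
      ∀ σ : K →+* ℂ, ‖σ (kindSeq a b c κ h)‖ ≤ A) (k : ℕ) {r : ℕ} (hr : 2 ≤ r) :
    ∃ V : ℕ, 1 ≤ V ∧ ∀ h, ∃ w : ℕ, 0 < w ∧ w ≤ V ^ r ^ h ∧
      IsIntegral ℤ ((D : K) * w * kindTerm phi a b c k κ r h) ∧
      ∀ σ : K →+* ℂ, ‖σ (kindTerm phi a b c k κ r h)‖ ≤ A * (V : ℝ) ^ r ^ h := by
  have hA0 : 0 ≤ A := zero_le_one.trans hA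
  have quot : ∀ (x : K) (w : ℕ), 0 < w → IsIntegral ℤ ((D : K) * x) →
      (∀ σ : K →+* ℂ, ‖σ x‖ ≤ A) → IsIntegral ℤ ((D : K) * w * (x / w)) ∧
        ∀ σ : K →+* ℂ, ‖σ (x / w)‖ ≤ A := by
    intro x w hw hx hσ
    have hw0 : (w : K) ≠ 0 := Nat.cast_ne_zero.2 hw.ne'
    refine ⟨by rwa [mul_assoc, mul_div_cancel₀ _ hw0], fun σ => ?_⟩
    rw [map_div₀, map_natCast, norm_div, Complex.norm_natCast]
    exact (div_le_self (norm_nonneg _) (by exact_mod_cast hw)).trans (hσ σ)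
  have hexp : ∀ (ℓ : ℤ) (h : ℕ),
      2 ^ ((k * r ^ h + ℓ : ℤ).toNat + 1) ≤ (2 ^ (k + ℓ.natAbs + 1)) ^ r ^ h := by
    intro ℓ h
    rw [← pow_mul]
    refine Nat.pow_le_pow_right two_pos ?_
    have h1 : 1 ≤ r ^ h := Nat.one_le_pow _ _ (by omega)
    have h2 : (k * r ^ h + ℓ : ℤ).toNat ≤ k * r ^ h + ℓ.natAbs := by
      have : ((k * r ^ h : ℕ) : ℤ) = k * r ^ h := by push_cast; ring
      omega
    nlinarith [Nat.zero_le ℓ.natAbs]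
  have hV : ∀ V h : ℕ, 1 ≤ V → A ≤ A * (V : ℝ) ^ r ^ h := fun V h hV =>
    le_mul_of_one_le_right hA0 (one_le_pow₀ (by exact_mod_cast hV))
  have zero : ∀ V h : ℕ, 1 ≤ V → ∃ w : ℕ, 0 < w ∧ w ≤ V ^ r ^ h ∧
      IsIntegral ℤ ((D : K) * w * (0 : K)) ∧ ∀ σ : K →+* ℂ, ‖σ (0 : K)‖ ≤ A * (V : ℝ) ^ r ^ h :=
    fun V h hV => ⟨1, one_pos, Nat.one_le_pow _ _ hV, by simpa using isIntegral_zero, fun σ => by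
      rw [map_zero, norm_zero]; positivity⟩
  rcases κ with μ | ℓ | ℓ
  · refine ⟨2 ^ (μ * k), Nat.one_le_two_pow, fun h =>
      ⟨1, one_pos, Nat.one_le_pow _ _ (by positivity), ?_, fun σ => ?_⟩⟩
    · have := (hDA h).1.mul ((isIntegral_inv_of_sq hphi).pow (μ * k * r ^ h))
      simpa only [kindTerm, Sum.elim_inl, kindSeq, Nat.cast_one, mul_one, div_eq_mul_inv, inv_pow,
        mul_assoc] using this
    · simp only [kindTerm, Sum.elim_inl]
      rw [div_eq_mul_inv, ← inv_pow, map_mul, map_pow, norm_mul, norm_pow, Nat.cast_pow,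
        Nat.cast_ofNat, ← pow_mul]
      gcongr
      · exact (hDA h).2 σ
      · exact norm_map_inv_le_two hphi σ
  · refine ⟨2 ^ (k + ℓ.natAbs + 1), Nat.one_le_two_pow, fun h => ?_⟩
    simp only [kindTerm, Sum.elim_inl, Sum.elim_inr]
    split_ifs with hpos
    · have hw : 0 < Nat.fib (k * r ^ h + ℓ : ℤ).toNat := Nat.fib_pos.2 (by omega)
      obtain ⟨h1, h2⟩ := quot _ _ hw (hDA h).1 (hDA h).2
      exact ⟨_, hw, (fib_le_two_pow _).trans ((Nat.pow_le_pow_right two_pos (Nat.le_succ _)).trans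
        (hexp ℓ h)), h1, fun σ => (h2 σ).trans (hV _ h Nat.one_le_two_pow)⟩
    · exact zero _ h Nat.one_le_two_pow
  · refine ⟨2 ^ (k + ℓ.natAbs + 1), Nat.one_le_two_pow, fun h => ?_⟩
    simp only [kindTerm, Sum.elim_inr]
    split_ifs with hpos
    · have hw := lucasNum_pos (k * r ^ h + ℓ : ℤ).toNat
      obtain ⟨h1, h2⟩ := quot _ _ hw (hDA h).1 (hDA h).2
      exact ⟨_, hw, (lucasNum_le_two_pow _).trans (hexp ℓ h), h1,
        fun σ => (h2 σ).trans (hV _ h Nat.one_le_two_pow)⟩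
    · exact zero _ h Nat.one_le_two_pow

lemma exists_sum_kindTerm_bounds {a b c : ℕ → K} {D : ℕ} {A : ℝ} (κ : SumKind) (hD : 0 < D)
    (hA : 1 ≤ A) (hDA : ∀ h, IsIntegral ℤ ((D : K) * kindSeq a b c κ h) ∧
      ∀ σ : K →+* ℂ, ‖σ (kindSeq a b c κ h)‖ ≤ A) (k : ℕ) {r : ℕ} (hr : 2 ≤ r) :
    ∃ V B : ℝ, 1 ≤ V ∧ 1 ≤ B ∧ ∀ H, ∃ Q : ℕ, 0 < Q ∧ (Q : ℝ) ≤ B * V ^ r ^ H ∧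
      IsIntegral ℤ ((Q : K) * ∑ h ∈ range H, kindTerm phi a b c k κ r h) ∧
      ∀ σ : K →+* ℂ, ‖σ (∑ h ∈ range H, kindTerm phi a b c k κ r h)‖ ≤ B * V ^ r ^ H := by
  obtain ⟨V, hV, hterm⟩ := exists_kindTerm_bounds hphi κ hA hDA k hr
  choose w hw hwV hintegral hnorm using hterm
  have hV1 : (1 : ℝ) ≤ V := by exact_mod_cast hV
  have hD1 : (1 : ℝ) ≤ D := by exact_mod_cast hD
  refine ⟨2 * V, D + A, by linarith, by linarith, fun H => ⟨D * ∏ h ∈ range H, w h,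
    Nat.mul_pos hD (prod_pos fun h _ => hw h), ?_, ?_, fun σ => ?_⟩⟩
  · have h1 : ∏ h ∈ range H, w h ≤ V ^ r ^ H :=
      (prod_le_prod' fun h _ => hwV h).trans (by
        rw [prod_pow_eq_pow_sum]
        exact Nat.pow_le_pow_right hV (sum_range_pow_le hr H))
    have h2 : ((∏ h ∈ range H, w h : ℕ) : ℝ) ≤ (2 * V) ^ r ^ H := by
      refine le_trans (by exact_mod_cast h1 : _ ≤ (V : ℝ) ^ r ^ H) ?_
      gcongr
      linarith
    rw [Nat.cast_mul]
    gcongr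
    linarith
  · rw [mul_sum]
    refine IsIntegral.sum _ fun h hh => ?_
    rw [← mul_prod_erase _ _ hh, ← mul_assoc, Nat.cast_mul, mul_right_comm, Nat.cast_mul]
    exact (hintegral h).mul (isIntegral_natCast _)
  · have h1 : ∀ h ∈ range H, ‖σ (kindTerm phi a b c k κ r h)‖ ≤ A * (V : ℝ) ^ r ^ H := by
      intro h hh
      refine (hnorm h σ).trans ?_
      have : r ^ h ≤ r ^ H := Nat.pow_le_pow_right (by omega) (mem_range.1 hh).le
      gcongr
    have h2 : (H : ℝ) ≤ 2 ^ r ^ H := by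
      have h3 : H < r ^ H := Nat.lt_pow_self (by omega)
      have h4 : r ^ H < 2 ^ r ^ H := Nat.lt_two_pow_self
      exact_mod_cast (h3.trans h4).le
    rw [map_sum]
    refine (norm_sum_le_of_le _ h1).trans ?_
    rw [sum_const, card_range, nsmul_eq_mul, mul_pow]
    calc (H : ℝ) * (A * (V : ℝ) ^ r ^ H) ≤ 2 ^ r ^ H * ((D + A) * (V : ℝ) ^ r ^ H) := by
          gcongr
          linarith
      _ = _ := by ring

end Golden

end SumArithmetic

section KindTerms

open Finset Filter Topology

variable {K D I : Type*}

lemma periodic_kindSeq {a b c : ℕ → K} {pa pb pc : ℕ} (ha : Function.Periodic a pa)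
    (hb : Function.Periodic b pb) (hc : Function.Periodic c pc) (κ : SumKind) :
    Function.Periodic (kindSeq a b c κ) (pa * pb * pc) := by
  rcases κ with μ | ℓ | ℓ
  · have := ha.nat_mul (pb * pc)
    rwa [Nat.cast_id, mul_comm, ← mul_assoc] at this
  · have := hb.nat_mul (pa * pc)
    rwa [Nat.cast_id, mul_right_comm] at this
  · have := hc.nat_mul (pa * pb)
    rwa [Nat.cast_id] at this

lemma neg_one_zpow_eq_of_pow {F : Type*} [Field F] (k d n : ℕ) (hn : n ≠ 0) (ℓ : ℤ) :
    (-1 : F) ^ (k * d + ℓ : ℤ) = (-1) ^ (k * d ^ n + ℓ : ℤ) := by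
  have h : Even (k * d + ℓ : ℤ) ↔ Even (k * d ^ n + ℓ : ℤ) := by
    simp [Int.even_add, Int.even_mul, Int.even_pow, hn]
  rcases Int.even_or_odd (k * d + ℓ : ℤ) with h1 | h1
  · rw [h1.neg_one_zpow, (h.1 h1).neg_one_zpow]
  · have h2 : Odd (k * d ^ n + ℓ : ℤ) := by
      rw [← Int.not_even_iff_odd] at h1 ⊢
      rwa [← h]
    rw [h1.neg_one_zpow, h2.neg_one_zpow]

/-- The tail of a sum of a given kind, expanded in powers of `phi⁻¹ ^ (k * r ^ H)`. -/
lemma norm_tsum_kindTerm_sub_le {phi : ℂ} (hphi : phi ^ 2 = phi + 1) (hphi1 : 1 < ‖phi‖)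
    {a b c : ℕ → ℂ} {k r : ℕ} (hr : 2 ≤ r) {κ : SumKind} (hκ : κ ≠ Sum.inl 0) {p : ℕ} (hp : 0 < p)
    (hper : Function.Periodic (kindSeq a b c κ) p) {eps : ℤ → ℂ}
    (heps : ∀ h ≠ 0, ∀ ℓ, eps ℓ = (-1) ^ (k * r ^ h + ℓ : ℤ)) (M : ℕ) :
    ∃ C : ℝ, ∃ y : ℝ, 0 < y ∧ ∀ H ≠ 0, p ∣ H → 0 < (k * r ^ H + kindShift κ : ℤ) →
      ‖(phi⁻¹ ^ k) ^ r ^ H‖ < y →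
      ‖(∑' h, kindTerm phi a b c k κ r h) - ∑ h ∈ range H, kindTerm phi a b c k κ r h -
        ∑ n ∈ range M, mahlerCoeff (kindSeq a b c κ) (kindRho phi⁻¹ (2 * phi - 1) eps κ) r n *
          ((phi⁻¹ ^ k) ^ r ^ H) ^ n‖ ≤ C * ‖(phi⁻¹ ^ k) ^ r ^ H‖ ^ M := by
  have heps2 : ∀ ℓ, eps ℓ ^ 2 = 1 := fun ℓ => by
    rw [heps 1 one_ne_zero, ← zpow_natCast, ← zpow_mul, mul_comm, zpow_mul]
    simp
  obtain ⟨C, R, hC, hR, hρ⟩ := exists_norm_kindRho_le phi⁻¹ (2 * phi - 1) heps2 κ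
  have hB : ∃ B, ∀ h, ‖kindSeq a b c κ h‖ ≤ B := by
    refine ⟨∑ h ∈ range p, ‖kindSeq a b c κ h‖, fun h => ?_⟩
    rw [← hper.map_mod_nat h]
    exact single_le_sum (f := fun h => ‖kindSeq a b c κ h‖) (fun _ _ => norm_nonneg _)
      (mem_range.2 (Nat.mod_lt _ hp))
  obtain ⟨B, hB⟩ := hB
  have hρ0 := kindRho_zero phi⁻¹ (2 * phi - 1) eps hκ
  refine ⟨4 * (B * C) * (2 * R) ^ M, 1 / (4 * R), by positivity, fun H hH hpH hpos hsmall => ?_⟩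
  set x := (phi⁻¹ ^ k) ^ r ^ H with hx
  have hx2 : 2 * R * ‖x‖ ≤ 1 / 2 := by
    rw [lt_div_iff₀ (by positivity)] at hsmall
    linarith
  have hterm : ∀ h, kindTerm phi a b c k κ r (h + H) =
      kindSeq a b c κ h * ∑' m, kindRho phi⁻¹ (2 * phi - 1) eps κ m * (x ^ r ^ h) ^ m := by
    intro h
    have hle : (r ^ H : ℤ) ≤ r ^ (h + H) := by
      exact_mod_cast Nat.pow_le_pow_right (by omega : 0 < r) (Nat.le_add_left H h)
    have hpos' : 0 < (k * r ^ (h + H) + kindShift κ : ℤ) := by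
      have := mul_le_mul_of_nonneg_left hle (Int.natCast_nonneg k)
      linarith
    have hshift : kindSeq a b c κ (h + H) = kindSeq a b c κ h := by
      obtain ⟨q, rfl⟩ := hpH
      have := hper.nat_mul q h
      rwa [Nat.cast_id, mul_comm] at this
    rw [kindTerm_eq_tsum hphi hphi1 a b c hpos' (heps _ (by omega)), hshift, hx, ← pow_mul _ (r ^ H),
      ← pow_add, add_comm H h]
  have hsum : Summable fun h => kindTerm phi a b c k κ r (h + H) := by
    simp only [hterm]
    exact summable_lambert hr hρ0 hB hR hC hρ hx2
  rw [← ((summable_nat_add_iff H).1 hsum).sum_add_tsum_nat_add H, add_sub_cancel_left,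
    tsum_congr hterm]
  exact norm_lambert_sub_le hr hρ0 hB hR hC hρ hx2 M


variable [Field K] [NumberField K] [Fintype D] [Fintype I]

lemma exists_sum_kindTerm_exp_bounds {phi : K} (hphi : phi ^ 2 = phi + 1) {a b c : ℕ → K} {p : ℕ}
    (hp : 0 < p) (hper : ∀ κ, Function.Periodic (kindSeq a b c κ) p) (k : ℕ) (π : I → D)
    (κ : I → SumKind) {r : I → ℕ} (hr : ∀ i, 2 ≤ r i) {N : ℕ → D → ℕ} {T : ℕ → ℝ} {θ : D → ℝ}
    (hT : Tendsto T atTop atTop)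
    (hN : ∀ δ, Tendsto (fun j => (N j δ : ℝ) / T j) atTop (𝓝 (θ δ))) :
    ∃ C : ℝ, ∀ᶠ j in atTop, ∀ H : I → ℕ, (∀ i, r i ^ H i = N j (π i)) →
      ∃ Q : ℕ, 0 < Q ∧ (Q : ℝ) ≤ Real.exp (C * T j) ∧
        (∀ i, IsIntegral ℤ ((Q : K) * ∑ h ∈ range (H i), kindTerm phi a b c k (κ i) (r i) h)) ∧
        ∀ (σ : K →+* ℂ) i, ‖σ (∑ h ∈ range (H i), kindTerm phi a b c k (κ i) (r i) h)‖ ≤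
          Real.exp (C * T j) := by
  classical
  choose D₀ A hD₀ hA hDA using fun i => exists_bounds_of_periodic hp (hper (κ i))
  choose V B hV hB hbd using fun i =>
    exists_sum_kindTerm_bounds hphi (κ i) (hD₀ i) (hA i) (hDA i) k (hr i)
  choose c hc using fun i => exists_pow_le_exp hT hN (hV i)
  refine ⟨∑ i, |c i + 1|, ?_⟩
  have hBT : ∀ᶠ j in atTop, ∀ i, B i ≤ Real.exp (T j) :=
    eventually_all.2 fun i => (Real.tendsto_exp_atTop.comp hT).eventually_ge_atTop (B i)
  filter_upwards [eventually_all.2 hc, hBT, hT.eventually_ge_atTop 0] with j hcj hBj hTj H hH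
  have hle : ∀ i, B i * V i ^ r i ^ H i ≤ Real.exp (|c i + 1| * T j) := by
    intro i
    rw [hH]
    calc B i * V i ^ N j (π i) ≤ Real.exp (T j) * Real.exp (c i * T j) := by
          have := hV i
          gcongr
          · exact hBj i
          · exact hcj i _
      _ = Real.exp ((c i + 1) * T j) := by rw [← Real.exp_add]; ring_nf
      _ ≤ _ := Real.exp_le_exp.2 (mul_le_mul_of_nonneg_right (le_abs_self _) hTj)
  choose Q hQ0 hQ hQint hnorm using fun i => hbd i (H i)
  refine ⟨∏ i, Q i, prod_pos fun i _ => hQ0 i, ?_, fun i => ?_, fun σ i => ?_⟩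
  · rw [Nat.cast_prod, sum_mul, Real.exp_sum]
    exact prod_le_prod (fun i _ => Nat.cast_nonneg _) fun i _ => (hQ i).trans (hle i)
  · rw [← mul_prod_erase _ _ (mem_univ i), Nat.cast_mul, mul_right_comm]
    exact (hQint i).mul (isIntegral_natCast _)
  · refine (hnorm i σ).trans ((hle i).trans (Real.exp_le_exp.2
      (mul_le_mul_of_nonneg_right ?_ hTj)))
    exact single_le_sum (f := fun i => |c i + 1|) (fun _ _ => abs_nonneg _) (mem_univ i)

/-- Algebraic independence of a finite family of sums with coefficients in a number field. -/
theorem algebraicIndependent_tsum_kindTerm (σ₀ : K →+* ℂ) {phi : K} (hphi : phi ^ 2 = phi + 1)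
    (hphi1 : 1 < ‖σ₀ phi‖) {a b c : ℕ → K} {pa pb pc : ℕ}
    (hpa : 0 < pa) (ha : Function.Periodic a pa) (ha0 : a ≠ 0)
    (hpb : 0 < pb) (hb : Function.Periodic b pb) (hb' : ¬ ∃ v, ∀ h, b h = v)
    (hpc : 0 < pc) (hc : Function.Periodic c pc) (hc0 : c ≠ 0)
    {k : ℕ} (hk : 1 ≤ k) {d : D → ℕ} (hd : ∀ δ, 2 ≤ d δ)
    (hind : ∀ δ δ', δ ≠ δ' → ∀ a b : ℕ, 0 < a → 0 < b → d δ ^ a ≠ d δ' ^ b)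
    (π : I → D) (κ : I → SumKind) (jj : I → ℕ)
    (hinj : Function.Injective fun i => (π i, κ i, jj i)) (hjj : ∀ i, 1 ≤ jj i)
    (hμ : ∀ i μ, κ i = Sum.inl μ → 1 ≤ μ ∧ μ < d (π i)) :
    AlgebraicIndependent ℚ fun i =>
      ∑' h, kindTerm (σ₀ phi) (σ₀ ∘ a) (σ₀ ∘ b) (σ₀ ∘ c) k (κ i) (d (π i) ^ jj i) h := by
  classical
  set p := pa * pb * pc with hp_def
  have hp : 0 < p := by positivity
  have hper : ∀ κ, Function.Periodic (kindSeq a b c κ) p := periodic_kindSeq ha hb hc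
  have hphi0 := phi_ne_zero_of_sq hphi
  have hphiC : σ₀ phi ^ 2 = σ₀ phi + 1 := by rw [← map_pow, hphi, map_add, map_one]
  have hr : ∀ i, 2 ≤ d (π i) ^ jj i := fun i =>
    (hd _).trans (Nat.le_self_pow (by have := hjj i; omega) _)
  obtain ⟨e, T, θ, hT, hθ, hθind, he, hN⟩ := exists_generic_exponents hd hind
    (P := p * ∏ i, jj i) (Nat.mul_pos hp (prod_pos fun i _ => hjj i))
  have hdvd : ∀ j i, jj i * p ∣ e j (π i) := fun j i => by
    rw [mul_comm]
    exact (Nat.mul_dvd_mul_left p (dvd_prod_of_mem jj (mem_univ i))).trans (he j _)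
  choose q hq using hdvd
  set H : ℕ → I → ℕ := fun j i => p * q j i with hH
  set N : ℕ → D → ℕ := fun j δ => d δ ^ e j δ with hN_def
  have hHN : ∀ j i, (d (π i) ^ jj i) ^ H j i = N j (π i) := fun j i => by
    rw [← pow_mul, hH, hN_def]
    dsimp only
    rw [hq, mul_assoc (jj i)]
  have hN' : ∀ δ, Tendsto (fun j => (N j δ : ℝ) / T j) atTop (𝓝 (θ δ)) := fun δ => by
    simpa only [hN_def, Nat.cast_pow] using hN δ
  have hNtop : ∀ δ, Tendsto (fun j => N j δ) atTop atTop := by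
    intro δ
    rw [← tendsto_natCast_atTop_iff (R := ℝ)]
    refine (((hN' δ).pos_mul_atTop (hθ δ) hT)).congr' ?_
    filter_upwards [hT.eventually_gt_atTop 0] with j hj
    rw [div_mul_cancel₀ _ hj.ne']
  set eps : D → ℤ → K := fun δ ℓ => (-1) ^ (k * d δ + ℓ : ℤ) with heps
  have hepsC : ∀ δ ℓ, σ₀ (eps δ ℓ) = (-1) ^ (k * d δ + ℓ : ℤ) := fun δ ℓ => by
    rw [heps]
    dsimp only
    rw [map_zpow₀, map_neg, map_one]
  have hlam1 : ‖σ₀ phi⁻¹‖ < 1 := by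
    rw [map_inv₀, norm_inv]
    exact inv_lt_one_of_one_lt₀ hphi1
  have hα1 : ‖σ₀ (phi⁻¹ ^ k)‖ < 1 := by
    rw [map_pow, norm_pow]
    exact pow_lt_one₀ (norm_nonneg _) hlam1 (by omega)
  set fc : I → ℕ → K := fun i => mahlerCoeff (kindSeq a b c (κ i))
    (kindRho phi⁻¹ (2 * phi - 1) (eps (π i)) (κ i)) (d (π i) ^ jj i) with hfc
  have hfcC : ∀ i n, σ₀ (fc i n) = mahlerCoeff (kindSeq (σ₀ ∘ a) (σ₀ ∘ b) (σ₀ ∘ c) (κ i))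
      (kindRho (σ₀ phi)⁻¹ (2 * σ₀ phi - 1) (fun ℓ => σ₀ (eps (π i) ℓ)) (κ i))
      (d (π i) ^ jj i) n := by
    intro i n
    rw [hfc]
    simp only [map_mahlerCoeff, map_kindSeq, map_kindRho, map_inv₀, map_sub, map_mul, map_ofNat,
      map_one]
  refine algebraicIndependent_of_approx σ₀ π (α := phi⁻¹ ^ k)
    (pow_ne_zero _ (inv_ne_zero hphi0)) ((isIntegral_inv_of_sq hphi).pow k) hα1 hT hθ hθind hN'
    (fc := fc) (fun i => mahlerCoeff_zero _ _ _)
    (S := fun j i => ∑ h ∈ range (H j i), kindTerm phi a b c k (κ i) (d (π i) ^ jj i) h)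
    (fun i M => ?_) ?_ fun δ => ?_
  · have hκ0 : κ i ≠ Sum.inl 0 := fun h => by simpa using (hμ i 0 h).1
    have hperC : Function.Periodic (kindSeq (σ₀ ∘ a) (σ₀ ∘ b) (σ₀ ∘ c) (κ i)) p := fun h => by
      rw [← map_kindSeq, ← map_kindSeq, hper (κ i) h]
    obtain ⟨C, y, hy, hC⟩ := norm_tsum_kindTerm_sub_le hphiC hphi1 (k := k) (hr i) hκ0 hp hperC
      (eps := fun ℓ => σ₀ (eps (π i) ℓ)) (fun h hh ℓ => by
        have hne : jj i * h ≠ 0 := mul_ne_zero (by have := hjj i; omega) hh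
        rw [hepsC, neg_one_zpow_eq_of_pow k (d (π i)) _ hne, Nat.cast_pow, pow_mul]) M
    refine ⟨C, ?_⟩
    have hsmall : Tendsto (fun j => ‖σ₀ (phi⁻¹ ^ k) ^ N j (π i)‖) atTop (𝓝 0) := by
      simp only [norm_pow]
      exact (tendsto_pow_atTop_nhds_zero_of_lt_one (norm_nonneg _) hα1).comp (hNtop _)
    filter_upwards [hsmall.eventually_lt_const hy,
      (hNtop (π i)).eventually_gt_atTop (max 1 (kindShift (κ i)).natAbs)] with j hj1 hj2
    have hH0 : H j i ≠ 0 := by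
      intro h0
      have := hHN j i
      rw [h0, pow_zero] at this
      omega
    have hposj : 0 < (k * ((d (π i) ^ jj i : ℕ) : ℤ) ^ H j i + kindShift (κ i) : ℤ) := by
      have h1 : ((d (π i) ^ jj i : ℕ) : ℤ) ^ H j i = N j (π i) := by exact_mod_cast hHN j i
      rw [h1]
      have h2 : N j (π i) ≤ k * N j (π i) := Nat.le_mul_of_pos_left _ hk
      have h3 : (N j (π i) : ℤ) ≤ k * N j (π i) := by exact_mod_cast h2
      omega
    have hα : ((σ₀ phi)⁻¹ ^ k) ^ (d (π i) ^ jj i) ^ H j i = σ₀ (phi⁻¹ ^ k) ^ N j (π i) := by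
      rw [hHN, map_pow, map_inv₀]
    have := hC (H j i) hH0 (dvd_mul_right _ _) hposj (by rwa [hα])
    rw [hα] at this
    simpa only [map_sum, map_kindTerm, hfcC] using this
  · obtain ⟨C, hC⟩ := exists_sum_kindTerm_exp_bounds hphi hp hper k π κ hr hT hN'
    exact ⟨C, hC.mono fun j hj => hj (H j) (hHN j)⟩
  · have hs := two_mul_phi_sub_one_ne_zero hphiC
    have key := algebraicIndependent_mk_mahlerCoeff (a := σ₀ ∘ a) (b := σ₀ ∘ b) (c := σ₀ ∘ c)
      (lam := (σ₀ phi)⁻¹) (s := 2 * σ₀ phi - 1) (eps := fun ℓ => σ₀ (eps δ ℓ)) (hd δ) hpa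
      (ha.comp σ₀) ?_ hpb (hb.comp σ₀) ?_ hpc (hc.comp σ₀) ?_ hs ?_ ?_ ?_ ?_
      (fun i : {i // π i = δ} => κ i) (fun i => jj i) ?_ (fun i => hjj i) ?_
    · refine Eq.mp (congrArg (fun v => AlgebraicIndependent ℂ (Sum.elim v _)) ?_) key
      funext ⟨i, hi⟩
      subst hi
      exact congrArg PowerSeries.mk (funext fun n => (hfcC i n).symm)
    · exact fun h => ha0 (funext fun n => (map_eq_zero σ₀).1 (congrFun h n))
    · rintro ⟨v, hv⟩
      exact hb' ⟨b 0, fun h => σ₀.injective ((hv h).trans (hv 0).symm)⟩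
    · exact fun h => hc0 (funext fun n => (map_eq_zero σ₀).1 (congrFun h n))
    · intro ℓ
      rw [hepsC, ← zpow_natCast, ← zpow_mul, mul_comm, zpow_mul]
      simp
    · intro h2
      rw [hepsC, h2, add_zero, mul_comm]
      exact Even.neg_one_zpow (by simp)
    · exact norm_pos_iff.2 (inv_ne_zero (phi_ne_zero_of_sq hphiC))
    · rwa [← map_inv₀]
    · rintro ⟨i, hi⟩ ⟨i', hi'⟩ h
      rw [Prod.mk.injEq] at h
      exact Subtype.ext (hinj (by
        dsimp only
        rw [hi, hi', h.1, h.2]))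
    · rintro ⟨i, rfl⟩ μ h
      exact hμ i μ h

end KindTerms

section Indices

lemma exists_eq_pow_notPerfectPower (r : ℕ) (hr : 2 ≤ r) :
    ∃ d j : ℕ, NotPerfectPower d ∧ 1 ≤ j ∧ r = d ^ j := by
  induction r using Nat.strong_induction_on with
  | _ r ih =>
    by_cases h : NotPerfectPower r
    · exact ⟨r, 1, h, le_rfl, (pow_one r).symm⟩
    · rw [NotPerfectPower] at h
      push Not at h
      obtain ⟨a, n, hn, rfl⟩ := h hr
      have ha : 2 ≤ a := by
        by_contra ha
        interval_cases a
        · rw [zero_pow (by omega)] at hr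
          omega
        · rw [one_pow] at hr
          omega
      have hlt : a < a ^ n := by
        calc a = a ^ 1 := (pow_one a).symm
          _ < a ^ n := Nat.pow_lt_pow_right (by omega) (by omega)
      obtain ⟨d, j, hd, hj, rfl⟩ := ih a hlt ha
      exact ⟨d, j * n, hd, Nat.mul_pos hj (by omega), (pow_mul d j n).symm⟩

lemma NotPerfectPower.eq_of_pow_eq_pow {d d' m n : ℕ} (hd : NotPerfectPower d)
    (hd' : NotPerfectPower d') (hm : 0 < m) (hn : 0 < n) (h : d ^ m = d' ^ n) : d = d' := by
  obtain ⟨c, h1, h2⟩ := Nat.exists_eq_pow_of_pow_eq_pow (Or.inl hm.ne') h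
  have hone : ∀ {e x : ℕ}, NotPerfectPower e → 0 < x → e = c ^ x → e = c := by
    intro e x he hx hex
    have : x = 1 := by
      by_contra hx1
      exact he.2 c x (by omega) hex
    rw [hex, this, pow_one]
  rw [hone hd (Nat.div_pos (Nat.le_of_dvd hn (Nat.gcd_dvd_right m n))
      (Nat.gcd_pos_of_pos_left n hm)) h1,
    hone hd' (Nat.div_pos (Nat.le_of_dvd hm (Nat.gcd_dvd_left m n))
      (Nat.gcd_pos_of_pos_left n hm)) h2]

/-- The kind of the sum attached to an index. -/
def indexKind : QIdx ⊕ (FLIdx ⊕ FLIdx) → SumKind :=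
  Sum.elim (fun i => Sum.inl i.1.1)
    (Sum.elim (fun i => Sum.inr (Sum.inl i.1.1)) (fun i => Sum.inr (Sum.inr i.1.1)))

/-- The integer `r` of an index. -/
def indexBase : QIdx ⊕ (FLIdx ⊕ FLIdx) → ℕ :=
  Sum.elim (fun i => i.1.2) (Sum.elim (fun i => i.1.2) (fun i => i.1.2))

lemma two_le_indexBase (i : QIdx ⊕ (FLIdx ⊕ FLIdx)) : 2 ≤ indexBase i := by
  rcases i with i | i | i
  · obtain ⟨d, j, hd, hj, h, -⟩ := i.2
    change 2 ≤ i.1.2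
    rw [h]
    exact hd.1.trans (Nat.le_self_pow (by omega) d)
  · exact i.2
  · exact i.2

lemma index_ext {i i' : QIdx ⊕ (FLIdx ⊕ FLIdx)} (h1 : indexKind i = indexKind i')
    (h2 : indexBase i = indexBase i') : i = i' := by
  rcases i with i | i | i <;> rcases i' with i' | i' | i' <;>
    simp only [indexKind, indexBase, Sum.elim_inl, Sum.elim_inr, Sum.inl.injEq, Sum.inr.injEq,
      reduceCtorEq] at h1 h2 ⊢ <;>
    exact Subtype.ext (Prod.ext h1 h2)

end Indices

lemma finite_range_of_periodic {α : Type*} {f : ℕ → α} {p : ℕ} (hp : 0 < p)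
    (hf : Function.Periodic f p) : (Set.range f).Finite :=
  ((Finset.range p).finite_toSet.image f).subset (by
    rintro _ ⟨n, rfl⟩
    exact ⟨n % p, Finset.mem_coe.2 (Finset.mem_range.2 (Nat.mod_lt _ hp)), hf.map_mod_nat n⟩)

lemma goldenRatioC_eq : goldenRatioC = (Real.goldenRatio : ℂ) := by
  rw [goldenRatioC, Real.goldenRatio]
  push_cast
  rfl

lemma goldenRatioC_sq : goldenRatioC ^ 2 = goldenRatioC + 1 := by
  rw [goldenRatioC_eq]
  exact_mod_cast Real.goldenRatio_sq

lemma one_lt_norm_goldenRatioC : 1 < ‖goldenRatioC‖ := by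
  rw [goldenRatioC_eq, Complex.norm_real, Real.norm_of_nonneg Real.goldenRatio_pos.le]
  exact Real.one_lt_goldenRatio

lemma isIntegral_goldenRatioC : IsIntegral ℚ goldenRatioC := by
  refine ⟨Polynomial.X ^ 2 - Polynomial.X - 1, by monicity!, ?_⟩
  simp
  linear_combination goldenRatioC_sq

theorem algIndep_fibonacci_lucas_sums_nonconstant
    (k : ℕ) (hk : 1 ≤ k) (a b c : ℕ → ℂ)
    (ha_per : ∃ p : ℕ, 0 < p ∧ Function.Periodic a p)
    (hb_per : ∃ p : ℕ, 0 < p ∧ Function.Periodic b p)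
    (hc_per : ∃ p : ℕ, 0 < p ∧ Function.Periodic c p)
    (ha_ne : a ≠ 0) (hb_ne : b ≠ 0) (hc_ne : c ≠ 0)
    (ha_alg : ∀ h, IsAlgebraic ℚ (a h))
    (hb_alg : ∀ h, IsAlgebraic ℚ (b h))
    (hc_alg : ∀ h, IsAlgebraic ℚ (c h))
    (hb_nonconst : ¬ ∃ v : ℂ, ∀ h, b h = v) :
    AlgebraicIndependent ℚ
      (Sum.elim
        (fun i : QIdx =>
          ∑' h : ℕ, a h / goldenRatioC ^ (i.1.1 * k * i.1.2 ^ h))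
        (Sum.elim
          (fun i : FLIdx =>
            ∑' h : ℕ,
              if 0 < (k * i.1.2 ^ h + i.1.1 : ℤ) then
                b h / (Nat.fib (k * i.1.2 ^ h + i.1.1 : ℤ).toNat : ℂ)
              else 0)
          (fun i : FLIdx =>
            ∑' h : ℕ,
              if 0 ≤ (k * i.1.2 ^ h + i.1.1 : ℤ) then
                c h / (lucasNum (k * i.1.2 ^ h + i.1.1 : ℤ).toNat : ℂ)
              else 0))) := by
  classical
  obtain ⟨pa, hpa, ha⟩ := ha_per
  obtain ⟨pb, hpb, hb⟩ := hb_per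
  obtain ⟨pc, hpc, hc⟩ := hc_per
  set S : Set ℂ := {goldenRatioC} ∪ (Set.range a ∪ (Set.range b ∪ Set.range c)) with hS
  have hSfin : Finite S := ((Set.finite_singleton _).union ((finite_range_of_periodic hpa ha).union
    ((finite_range_of_periodic hpb hb).union (finite_range_of_periodic hpc hc)))).to_subtype
  have hSint : ∀ x ∈ S, IsIntegral ℚ x := by
    rintro x (rfl | ⟨h, rfl⟩ | ⟨h, rfl⟩ | ⟨h, rfl⟩)
    · exact isIntegral_goldenRatioC
    · exact (ha_alg h).isIntegral
    · exact (hb_alg h).isIntegral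
    · exact (hc_alg h).isIntegral
  set K := IntermediateField.adjoin ℚ S with hK
  have hKfin : FiniteDimensional ℚ K := IntermediateField.finiteDimensional_adjoin hSint
  have hKnf : NumberField K := { to_charZero := inferInstance, to_finiteDimensional := hKfin }
  have hmem : ∀ x ∈ S, x ∈ K := IntermediateField.subset_adjoin ℚ S
  set σ₀ : K →+* ℂ := algebraMap K ℂ with hσ₀
  set phi : K := ⟨goldenRatioC, hmem _ (Or.inl rfl)⟩ with hphi
  set a' : ℕ → K := fun h => ⟨a h, hmem _ (Or.inr (Or.inl ⟨h, rfl⟩))⟩ with ha'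
  set b' : ℕ → K := fun h => ⟨b h, hmem _ (Or.inr (Or.inr (Or.inl ⟨h, rfl⟩)))⟩ with hb'
  set c' : ℕ → K := fun h => ⟨c h, hmem _ (Or.inr (Or.inr (Or.inr ⟨h, rfl⟩)))⟩ with hc'
  choose dd jj hdd hjj hr using fun i => exists_eq_pow_notPerfectPower _ (two_le_indexBase i)
  refine algebraicIndependent_of_finite_type fun t ht => ?_
  have : Fintype t := ht.fintype
  have key := algebraicIndependent_tsum_kindTerm (D := Finset.univ.image fun i : t => dd i) (I := t)
    σ₀ (phi := phi) (Subtype.ext goldenRatioC_sq) one_lt_norm_goldenRatioC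
    (a := a') (b := b') (c := c') hpa (fun h => Subtype.ext (ha h)) ?_ hpb
    (fun h => Subtype.ext (hb h)) ?_ hpc (fun h => Subtype.ext (hc h)) ?_ hk
    (d := fun δ => δ.1) ?_ ?_
    (fun i => ⟨dd i, Finset.mem_image_of_mem _ (Finset.mem_univ i)⟩) (fun i => indexKind i)
    (fun i => jj i) ?_ (fun i => hjj i) ?_
  · refine Eq.mp (congrArg (fun v : t → ℂ => AlgebraicIndependent ℚ v) (funext fun i => ?_)) key
    dsimp only
    rw [← hr]
    rcases i with ⟨i | i | i, hi⟩ <;> rfl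
  · exact fun h => ha_ne (funext fun n => congrArg Subtype.val (congrFun h n))
  · rintro ⟨v, hv⟩
    exact hb_nonconst ⟨v, fun h => congrArg Subtype.val (hv h)⟩
  · exact fun h => hc_ne (funext fun n => congrArg Subtype.val (congrFun h n))
  · rintro ⟨δ, hδ⟩
    obtain ⟨i, -, rfl⟩ := Finset.mem_image.1 hδ
    exact (hdd i).1
  · rintro ⟨δ, hδ⟩ ⟨δ', hδ'⟩ hne m n hm hn h
    obtain ⟨i, -, rfl⟩ := Finset.mem_image.1 hδ
    obtain ⟨i', -, rfl⟩ := Finset.mem_image.1 hδ'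
    exact hne (Subtype.ext ((hdd i).eq_of_pow_eq_pow (hdd i') hm hn h))
  · intro i i' h
    simp only [Prod.mk.injEq, Subtype.mk.injEq] at h
    refine Subtype.ext (index_ext h.2.1 ?_)
    rw [hr i, hr i', h.1, h.2.2]
  · rintro ⟨i | i | i, hi⟩ μ h
    · obtain ⟨d, j, hd, hj, h1, h2, h3⟩ := i.2
      have h4 : dd (Sum.inl i) = d :=
        (hdd _).eq_of_pow_eq_pow hd (hjj _) hj ((hr (Sum.inl i)).symm.trans h1)
      have h5 : i.1.1 = μ := Sum.inl.inj h
      have h6 := hd.1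
      dsimp only
      rw [h4]
      omega
    · cases h
    · cases h
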